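/- Suppose B̂₀ > 0 and B_∞(x,θ) ≥ 0 for all (x,θ) ∈ 𝕋² × S¹. Then every quantum limit ν for 𝓛_α can be decomposed as ν = c₀·Leb_{𝕋²} + Σ_{Λ} ν_Λ, where c₀ ∈ [0,1], the (countable) sum runs over the primitive rank-one sublattices Λ = ℤe of ℤ², and each ν_Λ is a finite nonnegative Borel measure on 𝕋² which is supported on the set 𝒵_Λ(B) = {x ∈ 𝕋² : B_∞(x, e^⊥/|e|) = 0} and is invariant under the translations x ↦ x + t e^⊥/|e| for all t ∈ ℝ (so ν_Λ lies in the closed convex hull of the measures c·δ_γ, c ∈ [0,1], δ_γ the normalized arc-length measure on a closed geodesic γ ⊂ 𝒵_Λ(B) in direction e^⊥). -/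

import Mathlib

open MeasureTheory Filter Topology
open scoped Real ENNReal

noncomputable section

abbrev Pt : Type := ℝ × ℝ

/-- `v ∧ w = v₁w₂ - v₂w₁`. -/
def wedge (v w : Pt) : ℝ := v.1 * w.2 - v.2 * w.1

/-- Euclidean dot product on `ℝ²`. -/
def dotp (v w : Pt) : ℝ := v.1 * w.1 + v.2 * w.2

/-- The fundamental domain `[0,1]²` of the torus `𝕋² = ℝ²/ℤ²`. -/
def fund : Set Pt := Set.Icc (0, 0) (1, 1)

/-- `ℤ²`-periodicity of a function on `ℝ²`. -/
def IsPeriodic {E : Type*} (f : Pt → E) : Prop :=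
  ∀ (m : ℤ × ℤ) (x : Pt), f (x.1 + m.1, x.2 + m.2) = f x

/-- The magnetic translation `𝒯_m^B` associated to the flux `B0 = B̂₀`. -/
def magTrans (B0 : ℝ) (m : ℤ × ℤ) (u : Pt → ℂ) : Pt → ℂ := fun x =>
  Complex.exp (Complex.I * (B0 / 2) * (wedge ((m.1 : ℝ), (m.2 : ℝ)) x : ℝ)) *
    u (x.1 - m.1, x.2 - m.2)

/-- First partial derivative of a complex valued function on `ℝ²`. -/
def pd1 (u : Pt → ℂ) : Pt → ℂ := fun x => fderiv ℝ u x (1, 0)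

/-- Second partial derivative of a complex valued function on `ℝ²`. -/
def pd2 (u : Pt → ℂ) : Pt → ℂ := fun x => fderiv ℝ u x (0, 1)

/-- First partial derivative of a real valued function on `ℝ²`. -/
def pdR1 (f : Pt → ℝ) : Pt → ℝ := fun x => fderiv ℝ f x (1, 0)

/-- Second partial derivative of a real valued function on `ℝ²`. -/
def pdR2 (f : Pt → ℝ) : Pt → ℝ := fun x => fderiv ℝ f x (0, 1)

/-- The vector potential `A⁰(x₁,x₂) = (B̂₀/2)(−x₂, x₁)`. -/
def A0 (B0 : ℝ) : Pt → Pt := fun x => (B0 / 2 * (-x.2), B0 / 2 * x.1)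

/-- `(-i∂₁ - α₁ - A₁) u`. -/
def Dop1 (α : Pt) (A : Pt → Pt) (u : Pt → ℂ) : Pt → ℂ := fun x =>
  -Complex.I * pd1 u x - ((α.1 + (A x).1 : ℝ) : ℂ) * u x

/-- `(-i∂₂ - α₂ - A₂) u`. -/
def Dop2 (α : Pt) (A : Pt → Pt) (u : Pt → ℂ) : Pt → ℂ := fun x =>
  -Complex.I * pd2 u x - ((α.2 + (A x).2 : ℝ) : ℂ) * u x

/-- The magnetic Laplacian `𝓛_α u = (−i∂₁−α₁−A₁)²u + (−i∂₂−α₂−A₂)²u`. -/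
def magLap (α : Pt) (A : Pt → Pt) (u : Pt → ℂ) : Pt → ℂ := fun x =>
  Dop1 α A (Dop1 α A u) x + Dop2 α A (Dop2 α A u) x

/-- Membership in `C^∞(𝕋²,L)`: smooth and invariant under all magnetic translations. -/
def MemCL (B0 : ℝ) (u : Pt → ℂ) : Prop :=
  ContDiff ℝ (⊤ : ℕ∞) u ∧ ∀ m : ℤ × ℤ, magTrans B0 m u = u

end

/-- The torus `𝕋² = ℝ²/ℤ²`. -/
abbrev T2 : Type := UnitAddCircle × UnitAddCircle

/-- The canonical projection `ℝ² → 𝕋²`. -/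
noncomputable def proj2 (x : Pt) : T2 := ((x.1 : UnitAddCircle), (x.2 : UnitAddCircle))

/-- `ν` is a quantum limit for `𝓛_α`: a probability measure on `𝕋²` which is the weak-⋆
limit of the position densities `|u_n|²dx` of a normalized sequence of `o(h_n^{3/2})`
quasimodes of `h_n²𝓛_α`. -/
def IsQuantumLimit (B0 : ℝ) (α : Pt) (A : Pt → Pt) (ν : MeasureTheory.Measure T2) : Prop :=
  MeasureTheory.IsProbabilityMeasure ν ∧
  ∃ (h : ℕ → ℝ) (u : ℕ → Pt → ℂ),
    (∀ n, 0 < h n) ∧ Tendsto h atTop (𝓝 0) ∧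
    (∀ n, ContDiff ℝ 2 (u n)) ∧ (∀ n (m : ℤ × ℤ), magTrans B0 m (u n) = u n) ∧
    (∀ n, ∫ x in fund, ‖u n x‖ ^ 2 = 1) ∧
    ((fun n => (∫ x in fund,
        ‖((h n ^ 2 : ℝ) : ℂ) * magLap α A (u n) x - u n x‖ ^ 2) ^ ((1 : ℝ) / 2))
      =o[atTop] fun n => h n ^ ((3 : ℝ) / 2)) ∧
    (∀ f : T2 → ℂ, Continuous f →
      Tendsto (fun n => ∫ x in fund, f (proj2 x) * ((‖u n x‖ ^ 2 : ℝ) : ℂ)) atTop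
        (𝓝 (∫ p, f p ∂ν)))

/-- The unit vector `e^⊥/|e|` orthogonal to a lattice vector `e`. -/
noncomputable def unitPerp (e : ℤ × ℤ) : Pt :=
  (-(e.2 : ℝ) / Real.sqrt ((e.1 : ℝ) ^ 2 + (e.2 : ℝ) ^ 2),
    (e.1 : ℝ) / Real.sqrt ((e.1 : ℝ) ^ 2 + (e.2 : ℝ) ^ 2))

/-- The set of critical geodesics `𝒵_Λ(B) = {x ∈ 𝕋² : B_∞(x, e^⊥/|e|) = 0}`, viewed
inside the torus. -/
def Zset (Binf : Pt → Pt → ℝ) (e : ℤ × ℤ) : Set T2 :=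
  {p : T2 | ∀ y : Pt, proj2 y = p → Binf y (unitPerp e) = 0}

/-- A lattice vector seen as a point of the plane. -/
def latt (m : ℤ × ℤ) : Pt := ((m.1 : ℝ), (m.2 : ℝ))

lemma magTrans_eq_iff {B0 : ℝ} {u : Pt → ℂ} :
    (∀ m : ℤ × ℤ, magTrans B0 m u = u) ↔
      ∀ (m : ℤ × ℤ) (x : Pt),
        u (x + latt m) = Complex.exp (Complex.I * (B0 / 2 * wedge (latt m) x : ℝ)) * u x := by
  have key : ∀ (m : ℤ × ℤ) (x : Pt), magTrans B0 m u (x + latt m) =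
      Complex.exp (Complex.I * (B0 / 2 * wedge (latt m) x : ℝ)) * u x := by
    intro m x
    have h1 : (((x + latt m).1 - m.1, (x + latt m).2 - m.2) : Pt) = x := by
      ext <;> simp [latt]
    have h2 : wedge ((m.1 : ℝ), (m.2 : ℝ)) (x + latt m) = wedge (latt m) x := by
      simp [wedge, latt]; ring
    simp only [magTrans, h1, h2]
    push_cast
    congr 2
    ring
  constructor
  · intro h m x
    rw [← key m x, h m]
  · intro h m
    ext x
    have := key m (x - latt m)
    rw [sub_add_cancel] at this
    rw [this, ← h m, sub_add_cancel]

/-- Smooth sections: smooth functions invariant under all magnetic translations. -/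
def secSubmodule (B0 : ℝ) : Submodule ℂ (Pt → ℂ) where
  carrier := {u | ContDiff ℝ (⊤ : ℕ∞) u ∧ ∀ (m : ℤ × ℤ) (x : Pt),
    u (x + latt m) = Complex.exp (Complex.I * (B0 / 2 * wedge (latt m) x : ℝ)) * u x}
  add_mem' := fun ha hb => ⟨ha.1.add hb.1, fun m x => by
    simp only [Pi.add_apply, ha.2, hb.2]; ring⟩
  zero_mem' := ⟨contDiff_const, fun m x => by simp⟩
  smul_mem' := fun c u hu => ⟨contDiff_const.mul hu.1, fun m x => by
    simp only [Pi.smul_apply, hu.2, smul_eq_mul]; ring⟩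

/-- The space of smooth sections, to be equipped with its `L²` inner product. -/
def Sec (B0 : ℝ) : Type := secSubmodule B0

namespace Sec

variable {B0 : ℝ}

noncomputable instance : AddCommGroup (Sec B0) := inferInstanceAs (AddCommGroup (secSubmodule B0))
noncomputable instance : Module ℂ (Sec B0) := inferInstanceAs (Module ℂ (secSubmodule B0))

/-- The function on the plane underlying a section. -/
def toFun (u : Sec B0) : Pt → ℂ := Subtype.val (p := fun f => f ∈ secSubmodule B0) u

instance : CoeFun (Sec B0) (fun _ => Pt → ℂ) := ⟨toFun⟩

lemma smooth (u : Sec B0) : ContDiff ℝ (⊤ : ℕ∞) u := u.2.1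

lemma continuous (u : Sec B0) : Continuous u := u.smooth.continuous

lemma translate (u : Sec B0) (m : ℤ × ℤ) (x : Pt) : u (x + latt m) =
    Complex.exp (Complex.I * (B0 / 2 * wedge (latt m) x : ℝ)) * u x := u.2.2 m x

@[ext] lemma ext {u v : Sec B0} (h : ∀ x, u x = v x) : u = v := Subtype.ext (a1 := u) (a2 := v) (funext h)

@[simp] lemma add_apply (u v : Sec B0) (x : Pt) : (u + v) x = u x + v x := rfl
@[simp] lemma sub_apply (u v : Sec B0) (x : Pt) : (u - v) x = u x - v x := rfl
@[simp] lemma smul_apply (c : ℂ) (u : Sec B0) (x : Pt) : (c • u) x = c * u x := rfl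
@[simp] lemma zero_apply (x : Pt) : (0 : Sec B0) x = 0 := rfl

lemma norm_exp_I_mul (t : ℝ) : ‖Complex.exp (Complex.I * t)‖ = 1 := by
  rw [mul_comm]; exact Complex.norm_exp_ofReal_mul_I t

lemma norm_translate (u : Sec B0) (m : ℤ × ℤ) (x : Pt) : ‖u (x + latt m)‖ = ‖u x‖ := by
  rw [u.translate, norm_mul, norm_exp_I_mul, one_mul]

end Sec

lemma isCompact_fund : IsCompact fund := isCompact_Icc

lemma measurableSet_fund : MeasurableSet fund := measurableSet_Icc

lemma Continuous.integrableOn_fund {f : Pt → ℂ} (hf : Continuous f) : IntegrableOn f fund :=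
  hf.continuousOn.integrableOn_compact isCompact_fund

lemma exists_translate_mem_fund (x : Pt) : ∃ y ∈ interior fund ∪ fund, ∃ m : ℤ × ℤ, x = y + latt m := by
  refine ⟨(Int.fract x.1, Int.fract x.2), Or.inr ?_, (⌊x.1⌋, ⌊x.2⌋), ?_⟩
  · exact ⟨⟨Int.fract_nonneg _, Int.fract_nonneg _⟩,
      ⟨(Int.fract_lt_one _).le, (Int.fract_lt_one _).le⟩⟩
  · ext <;> simp [latt]

namespace Sec

variable {B0 : ℝ}

/-- The `L²` inner product of two sections. -/
noncomputable def ip (u v : Sec B0) : ℂ := ∫ x in fund, (starRingEnd ℂ) (u x) * v x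

lemma integrableOn_ip (u v : Sec B0) :
    IntegrableOn (fun x => (starRingEnd ℂ) (u x) * v x) fund :=
  Continuous.integrableOn_fund ((Complex.continuous_conj.comp u.continuous).mul v.continuous)

lemma ip_self (u : Sec B0) : ip u u = ((∫ x in fund, ‖u x‖ ^ 2 : ℝ) : ℂ) := by
  rw [ip, ← integral_complex_ofReal]
  refine integral_congr_ae (Eventually.of_forall fun x => ?_)
  simp only
  rw [mul_comm, Complex.mul_conj, Complex.normSq_eq_norm_sq]

lemma closure_interior_fund : closure (interior fund) = fund := by
  have h : interior fund = Set.Ioo (0:ℝ) 1 ×ˢ Set.Ioo (0:ℝ) 1 := by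
    rw [fund, ← Set.Icc_prod_Icc, interior_prod_eq, interior_Icc]
  rw [h, closure_prod_eq, closure_Ioo (by norm_num), fund, Set.Icc_prod_Icc]

lemma eq_zero_of_integral {u : Sec B0} (h : ∫ x in fund, ‖u x‖ ^ 2 = 0) : u = 0 := by
  have hc : Continuous fun x => ‖u x‖ ^ 2 := u.continuous.norm.pow 2
  have h1 : (fun x => ‖u x‖ ^ 2) =ᵐ[volume.restrict fund] 0 :=
    (integral_eq_zero_iff_of_nonneg (fun x => by positivity)
      (hc.continuousOn.integrableOn_compact isCompact_fund)).1 h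
  have h2 : Set.EqOn (fun x => ‖u x‖ ^ 2) 0 fund := by
    refine Measure.eqOn_of_ae_eq (μ := volume) h1 hc.continuousOn continuousOn_const ?_
    rw [closure_interior_fund]
  ext x
  obtain ⟨y, hy, m, rfl⟩ := exists_translate_mem_fund x
  have hy' : y ∈ fund := hy.elim (fun h => interior_subset h) id
  have := h2 hy'
  simp only [Pi.zero_apply] at this
  rw [zero_apply, ← norm_eq_zero, norm_translate]
  simpa using this

noncomputable instance core : InnerProductSpace.Core ℂ (Sec B0) where
  inner := ip
  conj_inner_symm u v := by
    simp only [ip]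
    rw [← integral_conj]
    refine integral_congr_ae (Eventually.of_forall fun x => ?_)
    simp [mul_comm]
  re_inner_nonneg u := by
    change 0 ≤ (ip u u).re
    rw [ip_self, Complex.ofReal_re]
    positivity
  add_left u v w := by
    change ip _ _ = ip _ _ + ip _ _
    simp only [ip]
    rw [← integral_add (integrableOn_ip u w) (integrableOn_ip v w)]
    refine integral_congr_ae (Eventually.of_forall fun x => ?_)
    simp [add_mul]
  smul_left u v c := by
    change ip _ _ = _ * ip _ _
    simp only [ip]
    rw [← integral_const_mul]
    refine integral_congr_ae (Eventually.of_forall fun x => ?_)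
    simp [mul_assoc]
  definite u h := by
    change ip u u = 0 at h
    rw [ip_self] at h
    exact eq_zero_of_integral (by exact_mod_cast h)

noncomputable instance : NormedAddCommGroup (Sec B0) :=
  @InnerProductSpace.Core.toNormedAddCommGroup ℂ (Sec B0) _ _ _ core

noncomputable instance : InnerProductSpace ℂ (Sec B0) := InnerProductSpace.ofCore core.toCore

lemma inner_def (u v : Sec B0) : inner ℂ u v = ∫ x in fund, (starRingEnd ℂ) (u x) * v x := rfl

lemma norm_sq (u : Sec B0) : ‖u‖ ^ 2 = ∫ x in fund, ‖u x‖ ^ 2 := by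
  have h : (inner ℂ u u : ℂ) = ((∫ x in fund, ‖u x‖ ^ 2 : ℝ) : ℂ) := ip_self u
  rw [inner_self_eq_norm_sq_to_K] at h
  exact Complex.ofReal_injective (by rw [← h]; simp)

end Sec

lemma IsPeriodic.add_latt {E : Type*} {f : Pt → E} (hf : IsPeriodic f) (m : ℤ × ℤ) (x : Pt) :
    f (x + latt m) = f x := hf m x

lemma integral_fund_fderiv_eq_zero {g : Pt → ℂ} (hg : ContDiff ℝ 1 g) (hper : IsPeriodic g)
    (v : Pt) : ∫ x in fund, fderiv ℝ g x v = 0 := by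
  have hd : ∀ x, HasFDerivAt g (fderiv ℝ g x) x := fun x =>
    (hg.differentiable (by norm_num) x).hasFDerivAt
  have hcont : Continuous (fderiv ℝ g) := hg.continuous_fderiv (by norm_num)
  have key := integral_divergence_prod_Icc_of_hasFDerivAt_of_le
    (fun x => (v.1 : ℂ) * g x) (fun x => (v.2 : ℂ) * g x)
    (fun x => (v.1 : ℂ) • fderiv ℝ g x) (fun x => (v.2 : ℂ) • fderiv ℝ g x)
    (0, 0) (1, 1) ⟨by norm_num, by norm_num⟩
    (continuous_const.mul hg.continuous).continuousOn
    (continuous_const.mul hg.continuous).continuousOn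
    (fun x _ => (hd x).const_mul _) (fun x _ => (hd x).const_mul _)
    (Continuous.integrableOn_fund (by fun_prop))
  have h1 : ∀ y : ℝ, g (1, y) = g (0, y) := fun y => by
    have := hper (1, 0) (0, y); simpa using this
  have h2 : ∀ y : ℝ, g (y, 1) = g (y, 0) := fun y => by
    have := hper (0, 1) (y, 0); simpa using this
  simp only [h1, h2, sub_self, zero_add] at key
  rw [← key]
  refine integral_congr_ae (Eventually.of_forall fun x => ?_)
  have hv : v = v.1 • ((1, 0) : Pt) + v.2 • ((0, 1) : Pt) := by ext <;> simp
  simp only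
  conv_lhs => rw [hv]
  rw [map_add, map_smul, map_smul]
  simp

/-- A vector potential whose magnetic field has flux `B0` through the torus. -/
structure GaugePot (B0 : ℝ) where
  /-- The underlying vector field. -/
  a : Pt → Pt
  smooth : ContDiff ℝ (⊤ : ℕ∞) a
  shift : ∀ (m : ℤ × ℤ) (x : Pt), a (x + latt m) = a x + A0 B0 (latt m)

/-- Smooth complex valued periodic functions. -/
def PerFun : Type := {f : Pt → ℂ // ContDiff ℝ (⊤ : ℕ∞) f ∧ IsPeriodic f}

namespace PerFun

/-- The underlying function of a smooth periodic function. -/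
def toFun (f : PerFun) : Pt → ℂ := f.1

instance : CoeFun PerFun (fun _ => Pt → ℂ) := ⟨toFun⟩

lemma smooth (f : PerFun) : ContDiff ℝ (⊤ : ℕ∞) f := f.2.1
lemma continuous (f : PerFun) : Continuous f := f.smooth.continuous
lemma periodic (f : PerFun) : IsPeriodic f := f.2.2

/-- The complex conjugate. -/
def conj (f : PerFun) : PerFun := ⟨fun x => (starRingEnd ℂ) (f x),
  Complex.conjCLE.contDiff.comp f.smooth, fun m x => congrArg _ (f.periodic m x)⟩

@[simp] lemma conj_apply (f : PerFun) (x : Pt) : f.conj x = (starRingEnd ℂ) (f x) := rfl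

/-- The symbol `-i∂_v f` of the commutator of a covariant derivative with `f`. -/
noncomputable def der (v : Pt) (f : PerFun) : PerFun :=
  ⟨fun x => -Complex.I * fderiv ℝ f x v,
    contDiff_const.mul ((f.smooth.fderiv_right (m := (⊤ : ℕ∞)) (by simp)).clm_apply contDiff_const),
    fun m x => by
      have h : (fun y => f (y + latt m)) = f := funext fun y => f.periodic.add_latt m y
      have h2 := fderiv_comp_add_right (𝕜 := ℝ) (f := f) (x := x) (latt m)
      rw [h] at h2
      change -Complex.I * fderiv ℝ f (x + latt m) v = _
      rw [← h2]⟩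

lemma der_apply (v : Pt) (f : PerFun) (x : Pt) : der v f x = -Complex.I * fderiv ℝ f x v := rfl

lemma exists_bound (f : PerFun) : ∃ C, 0 ≤ C ∧ ∀ x, ‖f x‖ ≤ C := by
  obtain ⟨C, hC⟩ := isCompact_fund.exists_bound_of_continuousOn f.continuous.continuousOn
  refine ⟨max C 0, le_max_right _ _, fun x => ?_⟩
  obtain ⟨y, hy, m, rfl⟩ := exists_translate_mem_fund x
  rw [f.periodic.add_latt]
  exact (hC y (hy.elim (fun h => interior_subset h) id)).trans (le_max_left _ _)

end PerFun

namespace Sec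

variable {B0 : ℝ}

/-- Multiplication of sections by a smooth periodic function. -/
def mul (f : PerFun) : Sec B0 →ₗ[ℂ] Sec B0 where
  toFun u := ⟨fun x => f x * u x, f.smooth.mul u.smooth, fun m x => by
    simp only [f.periodic.add_latt, u.translate]; ring⟩
  map_add' u v := by ext x; exact mul_add _ _ _
  map_smul' c u := by ext x; exact mul_left_comm _ _ _

@[simp] lemma mul_apply (f : PerFun) (u : Sec B0) (x : Pt) : mul f u x = f x * u x := rfl

lemma inner_mul (f : PerFun) (u v : Sec B0) :
    inner ℂ (mul f u) v = inner ℂ u (mul f.conj v) := by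
  simp only [inner_def]
  refine integral_congr_ae (Eventually.of_forall fun x => ?_)
  simp; ring

lemma norm_mul_le {f : PerFun} {C : ℝ} (hC0 : 0 ≤ C) (hC : ∀ x, ‖f x‖ ≤ C) (u : Sec B0) :
    ‖mul f u‖ ≤ C * ‖u‖ := by
  refine abs_le_of_sq_le_sq' ?_ (by positivity) |>.2
  rw [mul_pow, norm_sq, norm_sq, ← integral_const_mul]
  refine setIntegral_mono ?_ ?_ fun x => ?_
  · exact ((mul f u).continuous.norm.pow 2).continuousOn.integrableOn_compact isCompact_fund
  · exact ((u.continuous.norm.pow 2).const_mul _).continuousOn.integrableOn_compact isCompact_fund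
  · simp only [mul_apply, norm_mul, mul_pow]
    gcongr
    exact hC x

/-- The covariant derivative `-i∂_v - a·v`. -/
noncomputable def covD (a : GaugePot B0) (v : Pt) : Sec B0 →ₗ[ℂ] Sec B0 where
  toFun u := ⟨fun x => -Complex.I * fderiv ℝ u x v - (dotp (a.a x) v : ℝ) * u x, by
      refine ContDiff.sub (contDiff_const.mul
        ((u.smooth.fderiv_right (m := (⊤ : ℕ∞)) (by simp)).clm_apply contDiff_const)) ?_
      refine ContDiff.mul ?_ u.smooth
      exact Complex.ofRealCLM.contDiff.comp
        ((a.smooth.fst.mul contDiff_const).add (a.smooth.snd.mul contDiff_const)), fun m x => by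
      have h2 := fderiv_comp_add_right (𝕜 := ℝ) (f := u) (x := x) (latt m)
      have h : (fun y => u (y + latt m)) =
          fun y => Complex.exp (Complex.I * (B0 / 2 * wedge (latt m) y : ℝ)) * u y :=
        funext fun y => u.translate m y
      have h3 : HasFDerivAt (fun y : Pt => Complex.I * ((B0 / 2 * wedge (latt m) y : ℝ) : ℂ))
          (Complex.I • (Complex.ofRealCLM ∘L ((B0 / 2) • ((latt m).1 • ContinuousLinearMap.snd ℝ ℝ ℝ
            - (latt m).2 • ContinuousLinearMap.fst ℝ ℝ ℝ)))) x := by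
        refine HasFDerivAt.const_mul ?_ _
        refine Complex.ofRealCLM.hasFDerivAt.comp x ?_
        refine HasFDerivAt.const_mul ?_ _
        exact (hasFDerivAt_snd.const_mul _).sub (hasFDerivAt_fst.const_mul _)
      have h4 := (h3.cexp.mul (u.smooth.differentiable (by simp) x).hasFDerivAt).fderiv
      have h5 : fderiv ℝ u (x + latt m) = _ := (h2.symm.trans (by rw [h]; rfl)).trans h4
      simp only
      rw [h5, u.translate, a.shift]
      simp [dotp, A0, wedge]
      ring_nf
      simp
      ring⟩
  map_add' u w := by
    ext x
    change -Complex.I * fderiv ℝ (fun x => u x + w x) x v - _ * (u x + w x) = _ - _ + (_ - _)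
    rw [fderiv_fun_add (u.smooth.differentiable (by simp) x) (w.smooth.differentiable (by simp) x)]
    simp
    ring
  map_smul' c u := by
    ext x
    change -Complex.I * fderiv ℝ (fun x => c * u x) x v - _ * (c * u x) = c * (_ - _)
    rw [fderiv_const_mul (u.smooth.differentiable (by simp) x)]
    simp
    ring

lemma covD_apply (a : GaugePot B0) (v : Pt) (u : Sec B0) (x : Pt) :
    covD a v u x = -Complex.I * fderiv ℝ u x v - (dotp (a.a x) v : ℝ) * u x := rfl

lemma covD_eq (a : GaugePot B0) (v : Pt) :
    covD a v = (v.1 : ℂ) • covD a (1, 0) + (v.2 : ℂ) • covD a (0, 1) := by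
  refine LinearMap.ext fun u => ext fun x => ?_
  change _ = (v.1 : ℂ) * covD a (1, 0) u x + (v.2 : ℂ) * covD a (0, 1) u x
  have hv : v = v.1 • ((1, 0) : Pt) + v.2 • ((0, 1) : Pt) := by ext <;> simp
  simp only [covD_apply]
  conv_lhs => rw [hv]
  rw [map_add, map_smul, map_smul]
  simp [dotp]
  ring

lemma inner_covD (a : GaugePot B0) (v : Pt) (u w : Sec B0) :
    inner ℂ (covD a v u) w = inner ℂ u (covD a v w) := by
  have hper : IsPeriodic fun x => (starRingEnd ℂ) (u x) * w x := by
    intro m x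
    change (starRingEnd ℂ) (u (x + latt m)) * w (x + latt m) = _
    rw [u.translate, w.translate, map_mul, mul_mul_mul_comm, Complex.conj_mul', norm_exp_I_mul]
    simp
  have hs : ContDiff ℝ (⊤ : ℕ∞) fun x => (starRingEnd ℂ) (u x) * w x :=
    (Complex.conjCLE.contDiff.comp u.smooth).mul w.smooth
  have h0 := integral_fund_fderiv_eq_zero (hs.of_le (by simp)) hper v
  rw [← sub_eq_zero]
  simp only [inner_def]
  rw [← integral_sub (integrableOn_ip _ _) (integrableOn_ip _ _), ← mul_zero Complex.I, ← h0,
    ← integral_const_mul]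
  refine integral_congr_ae (Eventually.of_forall fun x => ?_)
  have hu := (u.smooth.differentiable (by simp) x).hasFDerivAt
  have hw := (w.smooth.differentiable (by simp) x).hasFDerivAt
  have hcu : HasFDerivAt (fun x => (starRingEnd ℂ) (u x))
      ((Complex.conjCLE : ℂ →L[ℝ] ℂ) ∘L fderiv ℝ u x) x :=
    Complex.conjCLE.hasFDerivAt.comp x hu
  have h4 := (hcu.mul hw).fderiv
  simp only
  erw [h4]
  simp [covD_apply]
  ring_nf

lemma covD_mul (a : GaugePot B0) (v : Pt) (f : PerFun) (u : Sec B0) :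
    covD a v (mul f u) = mul f (covD a v u) + mul (f.der v) u := by
  ext x
  have h4 := ((f.smooth.differentiable (by simp) x).hasFDerivAt.mul
    (u.smooth.differentiable (by simp) x).hasFDerivAt).fderiv
  have h5 : fderiv ℝ (mul f u) x = _ := h4
  simp only [covD_apply, add_apply, mul_apply, PerFun.der_apply]
  rw [h5]
  simp
  ring

lemma fderiv_covD (a : GaugePot B0) (v w : Pt) (u : Sec B0) (x : Pt) :
    fderiv ℝ (covD a v u) x w = -Complex.I * fderiv ℝ (fderiv ℝ u) x w v
      - ((dotp (fderiv ℝ a.a x w) v : ℝ) * u x + (dotp (a.a x) v : ℝ) * fderiv ℝ u x w) := by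
  have hu := (u.smooth.differentiable (by simp) x).hasFDerivAt
  have huu : HasFDerivAt (fderiv ℝ u) _ x :=
    ((u.smooth.fderiv_right (m := (⊤ : ℕ∞)) (by simp)).differentiable (by simp) x).hasFDerivAt
  have ha := (a.smooth.differentiable (by simp) x).hasFDerivAt
  have h1 : HasFDerivAt (fun y => dotp (a.a y) v)
      (v.1 • (ContinuousLinearMap.fst ℝ ℝ ℝ ∘L fderiv ℝ a.a x)
        + v.2 • (ContinuousLinearMap.snd ℝ ℝ ℝ ∘L fderiv ℝ a.a x)) x :=
    (ha.fst.mul_const _).add (ha.snd.mul_const _)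
  have h2 := Complex.ofRealCLM.hasFDerivAt.comp x h1
  have h3 := (((huu.clm_apply (hasFDerivAt_const v x)).const_mul (-Complex.I)).sub
    (h2.mul hu)).fderiv
  have h4 : fderiv ℝ (covD a v u) x = _ := h3
  rw [h4]
  simp [dotp]
  ring

lemma covD_comm (a : GaugePot B0) (B : PerFun)
    (hB : ∀ x, B x = (((fderiv ℝ a.a x (1, 0)).2 - (fderiv ℝ a.a x (0, 1)).1 : ℝ) : ℂ))
    (u : Sec B0) :
    covD a (1, 0) (covD a (0, 1) u) - covD a (0, 1) (covD a (1, 0) u)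
      = Complex.I • mul B u := by
  ext x
  have hsymm := (u.smooth.contDiffAt (x := x)).isSymmSndFDerivAt (by
    simp only [minSmoothness_of_isRCLikeNormedField]
    exact WithTop.coe_le_coe.2 le_top)
  have h := hsymm.eq (1, 0) (0, 1)
  simp only [sub_apply, smul_apply, mul_apply]
  rw [covD_apply, covD_apply a (0, 1) (covD a (1, 0) u), fderiv_covD, fderiv_covD, h, hB]
  simp only [covD_apply]
  simp [dotp]
  ring

end Sec

lemma contDiff_integral_zero_one {P E : Type*} [NormedAddCommGroup P] [NormedSpace ℝ P]
    [NormedAddCommGroup E] [NormedSpace ℝ E] [CompleteSpace E] {F : P → ℝ → E}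
    (hF : ContDiff ℝ (⊤ : ℕ∞) (fun q : P × ℝ => F q.1 q.2)) :
    ContDiff ℝ (⊤ : ℕ∞) fun p => ∫ t in (0:ℝ)..1, F p t := by
  let χ : ContDiffBump (0 : ℝ) := ⟨1, 2, by norm_num, by norm_num⟩
  have h := contDiffOn_convolution_right_with_param_comp (μ := volume) (n := ⊤)
    (ContinuousLinearMap.lsmul ℝ ℝ : ℝ →L[ℝ] E →L[ℝ] E) (s := (Set.univ : Set P))
    (v := fun _ => (0 : ℝ)) contDiffOn_const
    (f := Set.indicator (Set.Ioc (0:ℝ) 1) fun _ => (1 : ℝ))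
    (g := fun p y => χ y • F p (-y)) (k := Metric.closedBall (0:ℝ) 2) isOpen_univ
    (isCompact_closedBall _ _) (fun p x _ hx => by
      have : χ x = 0 := by
        by_contra h
        have : x ∈ Function.support χ := h
        rw [χ.support_eq] at this
        exact hx (Metric.ball_subset_closedBall this)
      simp [this])
    ((integrable_indicator_iff measurableSet_Ioc).2
      (integrableOn_const (by simp))).locallyIntegrable
    (ContDiff.contDiffOn (by
      refine (χ.contDiff.comp contDiff_snd).smul ?_
      exact hF.comp (contDiff_fst.prodMk contDiff_snd.neg)))
  rw [contDiffOn_univ] at h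
  convert h using 2 with p
  rw [convolution_def, intervalIntegral.integral_of_le zero_le_one,
    ← integral_indicator measurableSet_Ioc]
  refine integral_congr_ae (Eventually.of_forall fun t => ?_)
  by_cases ht : t ∈ Set.Ioc (0:ℝ) 1
  · have : χ (-t) = 1 := χ.one_of_mem_closedBall (by
      simp [χ, abs_of_pos ht.1, ht.2])
    simp [ht, this]
  · simp [ht]

namespace GaugePot

variable {B0 : ℝ} (a : GaugePot B0)

/-- The component of the potential in the direction `v`. -/
noncomputable def comp (v x : Pt) : ℝ := dotp (a.a x) v

lemma comp_smooth (v : Pt) : ContDiff ℝ (⊤ : ℕ∞) (a.comp v) :=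
  (a.smooth.fst.mul contDiff_const).add (a.smooth.snd.mul contDiff_const)

lemma comp_shift (v : Pt) (m : ℤ × ℤ) (x : Pt) :
    a.comp v (x + latt m) = a.comp v x + B0 / 2 * wedge (latt m) v := by
  simp [comp, a.shift, dotp, A0, wedge]; ring

/-- The circulation of the potential along the segment from `x` to `x + t v`. -/
noncomputable def circ (v x : Pt) (t : ℝ) : ℝ := ∫ s in (0:ℝ)..t, a.comp v (x + s • v)

lemma continuous_comp_line (v x : Pt) : Continuous fun s : ℝ => a.comp v (x + s • v) :=
  (a.comp_smooth v).continuous.comp (by fun_prop)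

lemma circ_smooth (v : Pt) : ContDiff ℝ (⊤ : ℕ∞) fun q : Pt × ℝ => a.circ v q.1 q.2 := by
  have h : (fun q : Pt × ℝ => a.circ v q.1 q.2) =
      fun q => q.2 * ∫ s in (0:ℝ)..1, a.comp v (q.1 + (q.2 * s) • v) := by
    ext q
    have := intervalIntegral.smul_integral_comp_mul_left (a := 0) (b := 1)
      (fun s => a.comp v (q.1 + s • v)) q.2
    rw [smul_eq_mul] at this
    rw [this]; simp [circ]
  rw [h]
  refine contDiff_snd.mul (contDiff_integral_zero_one ?_)
  refine (a.comp_smooth v).comp ?_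
  fun_prop

lemma circ_add_line (v x : Pt) (t τ : ℝ) :
    a.circ v (x + τ • v) t = a.circ v x (t + τ) - a.circ v x τ := by
  have hi : ∀ p q, IntervalIntegrable (fun s : ℝ => a.comp v (x + s • v)) volume p q :=
    fun p q => (a.continuous_comp_line v x).intervalIntegrable p q
  have h := intervalIntegral.integral_comp_add_left (a := 0) (b := t)
    (fun s => a.comp v (x + s • v)) τ
  simp only [circ]
  rw [intervalIntegral.integral_interval_sub_left (hi _ _) (hi _ _)]
  rw [add_zero, add_comm τ t] at h
  rw [← h]
  refine intervalIntegral.integral_congr fun s _ => ?_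
  simp only [add_smul, add_assoc]

lemma hasDerivAt_circ (v x : Pt) : HasDerivAt (a.circ v x) (a.comp v x) 0 := by
  have h := intervalIntegral.integral_hasDerivAt_right (a := 0) (b := 0)
    (f := fun s : ℝ => a.comp v (x + s • v)) (by simp)
    (a.continuous_comp_line v x).stronglyMeasurable.stronglyMeasurableAtFilter
    (a.continuous_comp_line v x).continuousAt
  have h' : HasDerivAt (a.circ v x) (a.comp v (x + (0:ℝ) • v)) 0 := h
  rwa [zero_smul, add_zero] at h'

lemma circ_shift (v : Pt) (m : ℤ × ℤ) (x : Pt) (t : ℝ) :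
    a.circ v (x + latt m) t = a.circ v x t + t * (B0 / 2 * wedge (latt m) v) := by
  simp only [circ]
  have : ∀ s : ℝ, a.comp v (x + latt m + s • v) =
      a.comp v (x + s • v) + B0 / 2 * wedge (latt m) v := fun s => by
    rw [← a.comp_shift]; congr 1; abel
  simp only [this]
  rw [intervalIntegral.integral_add ((a.continuous_comp_line v x).intervalIntegrable _ _)
    intervalIntegrable_const]
  simp only [intervalIntegral.integral_const, sub_zero, smul_eq_mul]

lemma circ_one_line (e : ℤ × ℤ) (x : Pt) (τ : ℝ) :
    a.circ (latt e) (x + τ • latt e) 1 = a.circ (latt e) x 1 := by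
  have hp : Function.Periodic (fun s : ℝ => a.comp (latt e) (x + s • latt e)) 1 := fun s => by
    simp only [add_smul, one_smul, ← add_assoc]
    rw [a.comp_shift]
    simp [wedge]
    right; ring
  have h := hp.intervalIntegral_add_eq τ 0
  rw [circ_add_line]
  simp only [circ]
  rw [intervalIntegral.integral_interval_sub_left
    ((a.continuous_comp_line _ x).intervalIntegrable _ _)
    ((a.continuous_comp_line _ x).intervalIntegrable _ _), add_comm 1 τ, h, zero_add]

end GaugePot

namespace Sec

variable {B0 : ℝ} (a : GaugePot B0) (e : ℤ × ℤ) (ρ : ℝ) (v : Sec B0)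

/-- Parallel transport of `v` along `e` with exponential damping. -/
noncomputable def damped (x : Pt) (t : ℝ) : ℂ :=
  Complex.exp (-(ρ * t : ℝ) - Complex.I * (a.circ (latt e) x t : ℝ)) * v (x + t • latt e)

/-- The damped holonomy along the closed geodesic in direction `e` through `x`. -/
noncomputable def holo (x : Pt) : ℂ :=
  Complex.exp (-(ρ : ℝ) + Complex.I * (B0 / 2 * wedge (latt e) x - a.circ (latt e) x 1 : ℝ))

/-- The solution `w` of `(X + iρ) w = v`, where `X` is the covariant derivative along `e`. -/
noncomputable def resolventFun (x : Pt) : ℂ :=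
  -Complex.I * (1 - holo a e ρ x)⁻¹ * ∫ t in (0:ℝ)..1, damped a e ρ v x t

lemma damped_smooth : ContDiff ℝ (⊤ : ℕ∞) fun q : Pt × ℝ => damped a e ρ v q.1 q.2 := by
  refine ContDiff.mul (ContDiff.cexp ?_) (v.smooth.comp (by fun_prop))
  exact (Complex.ofRealCLM.contDiff.comp (contDiff_const.mul contDiff_snd)).neg.sub
    (contDiff_const.mul (Complex.ofRealCLM.contDiff.comp (a.circ_smooth _)))

lemma holo_smooth : ContDiff ℝ (⊤ : ℕ∞) (holo a e ρ) := by
  refine ContDiff.cexp (contDiff_const.add (contDiff_const.mul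
    (Complex.ofRealCLM.contDiff.comp (ContDiff.sub ?_ ?_))))
  · exact contDiff_const.mul ((contDiff_const.mul contDiff_snd).sub
      (contDiff_const.mul contDiff_fst))
  · exact (a.circ_smooth (latt e)).comp (contDiff_id.prodMk contDiff_const)

variable {ρ}

lemma holo_ne_one (hρ : ρ ≠ 0) (x : Pt) : 1 - holo a e ρ x ≠ 0 := by
  intro h
  have h1 : ‖holo a e ρ x‖ = 1 := by rw [← sub_eq_zero.1 h, norm_one]
  rw [holo, Complex.norm_exp] at h1
  simp at h1
  exact hρ h1

lemma damped_line (x : Pt) (t τ : ℝ) : damped a e ρ v (x + τ • latt e) t =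
    Complex.exp ((ρ * τ : ℝ) + Complex.I * (a.circ (latt e) x τ : ℝ)) *
      damped a e ρ v x (t + τ) := by
  simp only [damped]
  rw [a.circ_add_line, ← mul_assoc, ← Complex.exp_add, add_smul, add_assoc x, add_comm (τ • _)]
  congr 2
  push_cast
  ring

lemma holo_line (x : Pt) (τ : ℝ) : holo a e ρ (x + τ • latt e) = holo a e ρ x := by
  simp only [holo]
  rw [a.circ_one_line]
  have : wedge (latt e) (x + τ • latt e) = wedge (latt e) x := by
    simp [wedge]; ring
  rw [this]

lemma damped_zero (x : Pt) : damped a e ρ v x 0 = v x := by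
  simp [damped, GaugePot.circ]

lemma damped_one (x : Pt) : damped a e ρ v x 1 = holo a e ρ x * v x := by
  simp only [damped, one_smul, v.translate, holo]
  rw [← mul_assoc, ← Complex.exp_add]
  congr 2
  push_cast
  ring

lemma hasDerivAt_resolventFun (hρ : ρ ≠ 0) (x : Pt) :
    HasDerivAt (fun τ : ℝ => resolventFun a e ρ v (x + τ • latt e))
      (((ρ : ℂ) + Complex.I * (a.comp (latt e) x : ℝ)) * resolventFun a e ρ v x
        + Complex.I * v x) 0 := by
  have hc : Continuous (damped a e ρ v x) :=
    (damped_smooth a e ρ v).continuous.comp (by fun_prop : Continuous fun t : ℝ => (x, t))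
  have hi : ∀ p q, IntervalIntegrable (damped a e ρ v x) volume p q :=
    fun p q => hc.intervalIntegrable p q
  have h1 : ∀ τ : ℝ, resolventFun a e ρ v (x + τ • latt e) =
      -Complex.I * (1 - holo a e ρ x)⁻¹ *
      (Complex.exp ((ρ * τ : ℝ) + Complex.I * (a.circ (latt e) x τ : ℝ)) *
        ((∫ t in (0:ℝ)..(1 + τ), damped a e ρ v x t) - ∫ t in (0:ℝ)..τ, damped a e ρ v x t)) := by
    intro τ
    rw [resolventFun, holo_line]
    simp only [damped_line]
    rw [intervalIntegral.integral_const_mul,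
      intervalIntegral.integral_interval_sub_left (hi _ _) (hi _ _),
      intervalIntegral.integral_comp_add_right (fun t => damped a e ρ v x t)]
    simp
  simp only [h1]
  have h2 : HasDerivAt (fun τ : ℝ => Complex.exp ((ρ * τ : ℝ)
      + Complex.I * (a.circ (latt e) x τ : ℝ)))
      ((ρ : ℂ) + Complex.I * (a.comp (latt e) x : ℝ)) 0 := by
    have h3 : HasDerivAt (fun τ : ℝ => (((ρ * τ : ℝ) : ℂ)
      + Complex.I * (a.circ (latt e) x τ : ℝ))) ((ρ : ℂ) + Complex.I * (a.comp (latt e) x : ℝ)) 0 :=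
      HasDerivAt.add (by simpa using ((hasDerivAt_id (0:ℝ)).const_mul ρ).ofReal_comp)
        ((a.hasDerivAt_circ _ x).ofReal_comp.const_mul _)
    have := h3.cexp
    simpa [GaugePot.circ] using this
  have h4 : HasDerivAt (fun τ : ℝ => ∫ t in (0:ℝ)..(1 + τ), damped a e ρ v x t)
      (damped a e ρ v x 1) 0 := by
    have := intervalIntegral.integral_hasDerivAt_right (hi 0 (1 + 0))
      hc.stronglyMeasurable.stronglyMeasurableAtFilter hc.continuousAt
    have h5 := HasDerivAt.comp_const_add (1:ℝ) 0 this
    simpa using h5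
  have h5 : HasDerivAt (fun τ : ℝ => ∫ t in (0:ℝ)..τ, damped a e ρ v x t)
      (damped a e ρ v x 0) 0 :=
    intervalIntegral.integral_hasDerivAt_right (hi 0 0)
      hc.stronglyMeasurable.stronglyMeasurableAtFilter hc.continuousAt
  have h6 := (h2.mul (h4.sub h5)).const_mul (-Complex.I * (1 - holo a e ρ x)⁻¹)
  refine h6.congr_deriv ?_
  have hne := holo_ne_one a e hρ x
  rw [damped_zero, damped_one, resolventFun]
  simp [GaugePot.circ]
  field_simp
  ring

lemma damped_shift (m : ℤ × ℤ) (x : Pt) (t : ℝ) : damped a e ρ v (x + latt m) t =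
    Complex.exp (Complex.I * (B0 / 2 * wedge (latt m) x : ℝ)) * damped a e ρ v x t := by
  simp only [damped]
  have h : x + latt m + t • latt e = (x + t • latt e) + latt m := by abel
  rw [a.circ_shift, h, v.translate, ← mul_assoc, ← mul_assoc (Complex.exp _) (Complex.exp _),
    ← Complex.exp_add, ← Complex.exp_add]
  congr 2
  simp [wedge]
  ring

lemma holo_shift (hflux : ∃ k : ℤ, B0 = 2 * π * k) (m : ℤ × ℤ) (x : Pt) :
    holo a e ρ (x + latt m) = holo a e ρ x := by
  obtain ⟨k, hk⟩ := hflux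
  simp only [holo]
  rw [a.circ_shift]
  rw [Complex.exp_eq_exp_iff_exists_int]
  refine ⟨k * (e.1 * m.2 - e.2 * m.1), ?_⟩
  simp [wedge, latt, hk]
  ring

lemma exists_resolvent (hflux : ∃ k : ℤ, B0 = 2 * π * k) (hρ : ρ ≠ 0) :
    ∃ w : Sec B0, covD a (latt e) w + (Complex.I * ρ) • w = v := by
  have hsm : ContDiff ℝ (⊤ : ℕ∞) (resolventFun a e ρ v) :=
    (contDiff_const.mul ((contDiff_const.sub (holo_smooth a e ρ)).inv (holo_ne_one a e hρ))).mul
      (contDiff_integral_zero_one (damped_smooth a e ρ v))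
  obtain ⟨w, hw⟩ : ∃ w : Sec B0, w.toFun = resolventFun a e ρ v := by
    refine ⟨⟨resolventFun a e ρ v, hsm, fun m x => ?_⟩, rfl⟩
    simp only [resolventFun, holo_shift a e hflux, damped_shift]
    rw [intervalIntegral.integral_const_mul]
    ring
  refine ⟨w, ext fun x => ?_⟩
  have h1 := hasDerivAt_resolventFun a e v hρ x
  have h2 : HasDerivAt (fun τ : ℝ => x + τ • latt e) (latt e) 0 := by
    simpa using ((hasDerivAt_id (0:ℝ)).smul_const (latt e)).const_add x
  have h3 : HasFDerivAt (resolventFun a e ρ v) (fderiv ℝ (resolventFun a e ρ v) x)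
      (x + (0:ℝ) • latt e) := by
    rw [zero_smul, add_zero]
    exact (hsm.differentiable (by simp) x).hasFDerivAt
  have h4 := HasDerivAt.unique (HasFDerivAt.comp_hasDerivAt (l := resolventFun a e ρ v)
    (f := fun τ : ℝ => x + τ • latt e) (0:ℝ) h3 h2) h1
  rw [add_apply, smul_apply, covD_apply, hw, h4]
  simp only [GaugePot.comp]
  linear_combination (-(dotp (a.a x) (latt e) * resolventFun a e ρ v x) - v x) * Complex.I_sq

end Sec

/-- `a i = O(s i ^ k)` uniformly in `i`, for parameters `s i ∈ (0, 1]`. -/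
def Sz {ι W : Type*} [Norm W] (s : ι → ℝ) (k : ℤ) (a : ι → W) : Prop :=
  (∀ i, 0 < s i ∧ s i ≤ 1) ∧ ∃ C, 0 ≤ C ∧ ∀ i, ‖a i‖ ≤ C * s i ^ k

namespace Sz

variable {ι W V : Type*} {s : ι → ℝ} {j k : ℤ}

section Norm

variable [SeminormedAddCommGroup W] {a b : ι → W}

lemma congr (h : Sz s k a) (hb : ∀ i, b i = a i) : Sz s k b := by
  rwa [show b = a from funext hb]

lemma mono (h : Sz s k a) (hk : j ≤ k) : Sz s j a := by
  obtain ⟨hs, C, hC, h⟩ := h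
  refine ⟨hs, C, hC, fun i => (h i).trans ?_⟩
  exact mul_le_mul_of_nonneg_left (zpow_le_zpow_right_of_le_one₀ (hs i).1 (hs i).2 hk) hC

lemma add (h : Sz s k a) (h' : Sz s k b) : Sz s k fun i => a i + b i := by
  obtain ⟨hs, C, hC, h⟩ := h
  obtain ⟨-, C', hC', h'⟩ := h'
  refine ⟨hs, C + C', by positivity, fun i => (norm_add_le _ _).trans ?_⟩
  rw [add_mul]
  exact add_le_add (h i) (h' i)

lemma neg (h : Sz s k a) : Sz s k fun i => -a i := by
  obtain ⟨hs, C, hC, h⟩ := h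
  exact ⟨hs, C, hC, fun _ => by rw [norm_neg]; exact h _⟩

lemma sub (h : Sz s k a) (h' : Sz s k b) : Sz s k fun i => a i - b i :=
  (h.add h'.neg).congr fun _ => sub_eq_add_neg _ _

lemma of_le (h : Sz s k a) {b : ι → V} [Norm V] (C : ℝ) (hb : ∀ i, ‖b i‖ ≤ C * ‖a i‖) :
    Sz s k b := by
  obtain ⟨hs, C', hC, h⟩ := h
  refine ⟨hs, |C| * C', by positivity, fun i => (hb i).trans ?_⟩
  rw [mul_assoc]
  exact mul_le_mul (le_abs_self _) (h i) (norm_nonneg _) (abs_nonneg _)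

lemma smul [NormedSpace ℂ W] {c : ι → ℂ} (hc : Sz s j c) (h : Sz s k a) :
    Sz s (j + k) fun i => c i • a i := by
  obtain ⟨hs, C, hC, h⟩ := h
  obtain ⟨-, C', hC', h'⟩ := hc
  refine ⟨hs, C' * C, by positivity, fun i => ?_⟩
  rw [norm_smul, zpow_add₀ (hs i).1.ne']
  calc ‖c i‖ * ‖a i‖ ≤ (C' * s i ^ j) * (C * s i ^ k) := by
        have := (hs i).1
        exact mul_le_mul (h' i) (h i) (norm_nonneg _) (by positivity)
    _ = _ := by ring

lemma const_smul [NormedSpace ℂ W] (c : ℂ) (h : Sz s k a) : Sz s k fun i => c • a i :=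
  h.of_le ‖c‖ fun i => (norm_smul _ _).le

lemma tendsto {l : Filter ι} (h : Sz s 1 a) (hl : Tendsto s l (𝓝 0)) : Tendsto a l (𝓝 0) := by
  obtain ⟨hs, C, hC, h⟩ := h
  refine squeeze_zero_norm h ?_
  simpa using hl.const_mul C

end Norm

lemma mul {a b : ι → ℂ} (h : Sz s j a) (h' : Sz s k b) : Sz s (j + k) fun i => a i * b i :=
  h.smul h'

lemma pow (hs : ∀ i, 0 < s i ∧ s i ≤ 1) (m : ℕ) : Sz s m fun i => (s i : ℂ) ^ m := by
  refine ⟨hs, 1, zero_le_one, fun i => ?_⟩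
  rw [norm_pow, Complex.norm_real, Real.norm_eq_abs, abs_of_pos (hs i).1, one_mul, zpow_natCast]

variable [NormedAddCommGroup V] [InnerProductSpace ℂ V]

lemma inner {a b : ι → V} (h : Sz s j a) (h' : Sz s k b) :
    Sz s (j + k) fun i => inner ℂ (a i) (b i) := by
  obtain ⟨hs, C, hC, h⟩ := h
  obtain ⟨-, C', hC', h'⟩ := h'
  refine ⟨hs, C * C', by positivity, fun i => (norm_inner_le_norm _ _).trans ?_⟩
  rw [zpow_add₀ (hs i).1.ne']
  calc ‖a i‖ * ‖b i‖ ≤ (C * s i ^ j) * (C' * s i ^ k) := by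
        have := (hs i).1
        exact mul_le_mul (h i) (h' i) (norm_nonneg _) (by positivity)
    _ = _ := by ring

end Sz

/-- A multiplication operator `E` with adjoint `E'` having scalar commutators with `X` and `Y`. -/
structure IsMult {V : Type*} [NormedAddCommGroup V] [InnerProductSpace ℂ V]
    (X Y E E' : V →ₗ[ℂ] V) (c d : ℂ) : Prop where
  adj : ∀ a b, inner ℂ (E' a) b = inner ℂ a (E b)
  norm_le : ∀ a, ‖E a‖ ≤ ‖a‖
  norm_le' : ∀ a, ‖E' a‖ ≤ ‖a‖
  X_comm : ∀ a, X (E a) = E (X a) + c • E a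
  Y_comm : ∀ a, Y (E a) = E (Y a) + d • E a
  X_comm' : ∀ a, X (E' a) = E' (X a) - c • E' a
  Y_comm' : ∀ a, Y (E' a) = E' (Y a) - d • E' a

lemma inner_sq_comm {V : Type*} [NormedAddCommGroup V] [InnerProductSpace ℂ V]
    {X T Q : V →ₗ[ℂ] V} (hX : X.IsSymmetric) (hT : ∀ a, X (T a) = T (X a) + Q a) (v w : V) :
    inner ℂ (X (X v)) (T w) - inner ℂ v (T (X (X w))) =
      inner ℂ (X v) (Q w) + inner ℂ v (Q (X w)) := by
  rw [hX, hT, inner_add_right, hX v, hT, inner_add_right]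
  ring

/-- Two symmetric operators with bounded commutator, together with the resolvent of the first. -/
structure Frame (V : Type*) [NormedAddCommGroup V] [InnerProductSpace ℂ V] where
  X : V →ₗ[ℂ] V
  Y : V →ₗ[ℂ] V
  β : V →ₗ[ℂ] V
  β₁ : V →ₗ[ℂ] V
  β₂ : V →ₗ[ℂ] V
  G : ℝ → V →ₗ[ℂ] V
  bd : ℝ
  symX : X.IsSymmetric
  symY : Y.IsSymmetric
  comm : ∀ a, X (Y a) = Y (X a) + β a
  commX : ∀ a, X (β a) = β (X a) + β₁ a
  commY : ∀ a, Y (β a) = β (Y a) + β₂ a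
  bd_nonneg : 0 ≤ bd
  norm_β : ∀ a, ‖β a‖ ≤ bd * ‖a‖
  norm_β₁ : ∀ a, ‖β₁ a‖ ≤ bd * ‖a‖
  norm_β₂ : ∀ a, ‖β₂ a‖ ≤ bd * ‖a‖
  X_G : ∀ ρ, ρ ≠ 0 → ∀ a, X (G ρ a) + (Complex.I * ρ) • G ρ a = a

lemma norm_symm_add_smul {V : Type*} [NormedAddCommGroup V] [InnerProductSpace ℂ V]
    {X : V →ₗ[ℂ] V} (hX : X.IsSymmetric) (ρ : ℝ) (w : V) :
    ‖X w + (Complex.I * ρ) • w‖ ^ 2 = ‖X w‖ ^ 2 + ρ ^ 2 * ‖w‖ ^ 2 := by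
  have h2 : (inner ℂ (X w) ((Complex.I * ρ) • w)).re = 0 := by
    have him : (inner ℂ (X w) w).im = 0 := hX.im_inner_apply_self w
    rw [inner_smul_right]
    simp [him]
  have h1 := norm_add_sq (𝕜 := ℂ) (X w) ((Complex.I * ρ) • w)
  change _ = _ + 2 * (inner ℂ (X w) ((Complex.I * ρ) • w)).re + _ at h1
  rw [h1, h2, norm_smul, mul_pow]
  simp

namespace Frame

variable {V : Type*} [NormedAddCommGroup V] [InnerProductSpace ℂ V] (F : Frame V) {ρ : ℝ}

/-- The bounded operator `iρ(X+iρ)⁻¹`. -/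
noncomputable def K (ρ : ℝ) : V →ₗ[ℂ] V := (Complex.I * ρ) • F.G ρ

lemma K_apply (ρ : ℝ) (a : V) : F.K ρ a = (Complex.I * ρ) • F.G ρ a := rfl

lemma X_G_eq (hρ : ρ ≠ 0) (a : V) : F.X (F.G ρ a) = a - F.K ρ a := by
  rw [eq_sub_iff_add_eq, K_apply, F.X_G ρ hρ]

lemma X_K (hρ : ρ ≠ 0) (a : V) : F.X (F.K ρ a) = (Complex.I * ρ) • (a - F.K ρ a) := by
  rw [F.K_apply, map_smul, F.X_G_eq hρ, F.K_apply]

lemma norm_G (hρ : ρ ≠ 0) (a : V) : ‖F.G ρ a‖ ≤ |ρ|⁻¹ * ‖a‖ := by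
  have h := norm_symm_add_smul F.symX ρ (F.G ρ a)
  rw [F.X_G ρ hρ] at h
  have hp : 0 < |ρ| := abs_pos.2 hρ
  rw [inv_mul_eq_div, le_div_iff₀ hp]
  refine le_of_sq_le_sq ?_ (norm_nonneg a)
  rw [h, mul_pow, sq_abs]
  nlinarith [sq_nonneg ‖F.X (F.G ρ a)‖]

lemma norm_K (hρ : ρ ≠ 0) (a : V) : ‖F.K ρ a‖ ≤ ‖a‖ := by
  rw [K_apply, norm_smul]
  have h := F.norm_G hρ a
  have hp : 0 < |ρ| := abs_pos.2 hρ
  rw [inv_mul_eq_div, le_div_iff₀ hp] at h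
  simpa [mul_comm] using h

lemma G_unique (hρ : ρ ≠ 0) {a b : V} (h : F.X b + (Complex.I * ρ) • b = a) : F.G ρ a = b := by
  have h1 := norm_symm_add_smul F.symX ρ (F.G ρ a - b)
  have h2 : F.X (F.G ρ a - b) + (Complex.I * ρ) • (F.G ρ a - b) = 0 := by
    have := F.X_G ρ hρ a
    rw [map_sub, smul_sub]
    rw [← h] at this ⊢
    rw [← sub_eq_zero.2 this]
    abel
  rw [h2, norm_zero] at h1
  have h3 : ρ ^ 2 * ‖F.G ρ a - b‖ ^ 2 = 0 := by
    have := sq_nonneg ‖F.X (F.G ρ a - b)‖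
    have := mul_nonneg (sq_nonneg ρ) (sq_nonneg ‖F.G ρ a - b‖)
    linarith
  have h4 : ‖F.G ρ a - b‖ = 0 := by simpa [hρ] using h3
  exact sub_eq_zero.1 (norm_eq_zero.1 h4)

lemma G_X (hρ : ρ ≠ 0) (a : V) : F.G ρ (F.X a) = a - F.K ρ a := by
  have : F.G ρ (F.X a + (Complex.I * ρ) • a) = a := F.G_unique hρ rfl
  rw [map_add, map_smul] at this
  rw [eq_sub_iff_add_eq, K_apply, this]

lemma K_X (hρ : ρ ≠ 0) (a : V) : F.K ρ (F.X a) = (Complex.I * ρ) • (a - F.K ρ a) := by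
  rw [F.K_apply, F.G_X hρ, F.K_apply]

/-- Commutation of the resolvent with an operator. -/
lemma G_comm (hρ : ρ ≠ 0) {T Q : V →ₗ[ℂ] V} (h : ∀ a, F.X (T a) = T (F.X a) + Q a) (a : V) :
    T (F.G ρ a) = F.G ρ (T a) + F.G ρ (Q (F.G ρ a)) := by
  symm
  rw [← map_add]
  refine F.G_unique hρ ?_
  rw [h, F.X_G_eq hρ, map_sub, F.K_apply, map_smul]
  abel

lemma Y_G (hρ : ρ ≠ 0) (a : V) :
    F.Y (F.G ρ a) = F.G ρ (F.Y a) + F.G ρ (F.β (F.G ρ a)) := F.G_comm hρ F.comm a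

lemma G_adj (hρ : ρ ≠ 0) (a b : V) : inner ℂ (F.G ρ a) b = inner ℂ a (F.G (-ρ) b) := by
  have hρ' : -ρ ≠ 0 := neg_ne_zero.2 hρ
  conv_lhs => rw [← F.X_G (-ρ) hρ' b]
  conv_rhs => rw [← F.X_G ρ hρ a]
  rw [inner_add_left, inner_add_right, F.symX, inner_smul_left, inner_smul_right]
  simp

lemma K_adj (hρ : ρ ≠ 0) (a b : V) : inner ℂ (F.K ρ a) b = inner ℂ a (F.K (-ρ) b) := by
  rw [K_apply, K_apply, inner_smul_left, inner_smul_right, F.G_adj hρ]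
  simp

lemma K_neg_K (hρ : ρ ≠ 0) (a : V) :
    F.K (-ρ) (F.K ρ a) = (2⁻¹ : ℂ) • (F.K ρ a + F.K (-ρ) a) := by
  have hρ' : -ρ ≠ 0 := neg_ne_zero.2 hρ
  have h1 := F.X_K hρ a
  have h2 : F.K (-ρ) (F.X (F.K ρ a)) = _ := F.K_X hρ' (F.K ρ a)
  rw [h1, map_smul, map_sub] at h2
  have h3 : (Complex.I * ρ) • (F.K (-ρ) a - F.K (-ρ) (F.K ρ a) + F.K ρ a - F.K (-ρ) (F.K ρ a))
      = 0 := by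
    rw [← sub_eq_zero] at h2
    rw [← h2]
    push_cast
    module
  have h4 := (smul_eq_zero.1 h3).resolve_left (by simp [hρ])
  have h5 : (2:ℂ) • F.K (-ρ) (F.K ρ a) = F.K ρ a + F.K (-ρ) a := by
    rw [← sub_eq_zero, ← neg_eq_zero, ← h4]; module
  rw [← h5, smul_smul]; norm_num

lemma G_sub_G {ρ' : ℝ} (hρ : ρ ≠ 0) (hρ' : ρ' ≠ 0) (a : V) :
    F.G ρ a - F.G ρ' a = (Complex.I * (ρ' - ρ)) • F.G ρ (F.G ρ' a) := by
  have h1 := F.G_X hρ (F.G ρ' a)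
  rw [F.X_G_eq hρ', map_sub, F.K_apply, F.K_apply, map_smul] at h1
  rw [← sub_eq_zero] at h1 ⊢
  rw [← h1]
  module

end Frame

variable {ι V : Type*} [NormedAddCommGroup V] [InnerProductSpace ℂ V]

/-- `w i` is an approximate solution of `s⁴(X² + Y²)w = E₀ w` with remainder `r`. -/
def Frame.Quasi (F : Frame V) (s : ι → ℝ) (E₀ : ℝ) (w r : ι → V) : Prop :=
  ∀ i, ((s i : ℂ) ^ 4) • (F.X (F.X (w i)) + F.Y (F.Y (w i))) = (E₀ : ℂ) • w i + r i

section Mult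

variable {X Y E E' : V →ₗ[ℂ] V} {c d : ℂ} (hE : IsMult X Y E E' c d) {s : ι → ℝ} {k : ℤ}
  {w : ι → V}
include hE

lemma IsMult.sz (h : Sz s k w) : Sz s k fun i => E (w i) :=
  h.of_le 1 fun i => by rw [one_mul]; exact hE.norm_le _

lemma IsMult.sz' (h : Sz s k w) : Sz s k fun i => E' (w i) :=
  h.of_le 1 fun i => by rw [one_mul]; exact hE.norm_le' _

lemma IsMult.sz_X' (h : Sz s 0 w) (h1 : Sz s k fun i => X (w i)) (hk : k ≤ 0) :
    Sz s k fun i => X (E' (w i)) :=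
  ((hE.sz' h1).sub (((hE.sz' h).const_smul c).mono hk)).congr fun _ => hE.X_comm' _

lemma IsMult.sz_Y' (h : Sz s 0 w) (h1 : Sz s k fun i => Y (w i)) (hk : k ≤ 0) :
    Sz s k fun i => Y (E' (w i)) :=
  ((hE.sz' h1).sub (((hE.sz' h).const_smul d).mono hk)).congr fun _ => hE.Y_comm' _

end Mult

namespace Frame

variable (F : Frame V) {s : ι → ℝ} {E₀ ρ : ℝ} {w r u : ι → V} {k : ℤ}

lemma sz_β (h : Sz s k w) : Sz s k fun i => F.β (w i) := h.of_le F.bd fun _ => F.norm_β _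
lemma sz_β₁ (h : Sz s k w) : Sz s k fun i => F.β₁ (w i) := h.of_le F.bd fun _ => F.norm_β₁ _
lemma sz_β₂ (h : Sz s k w) : Sz s k fun i => F.β₂ (w i) := h.of_le F.bd fun _ => F.norm_β₂ _

/-- Modes whose momentum along `X` is small do not correlate through a multiplier which is
not invariant along `Y`. -/
lemma inner_mult_small {E E' : V →ₗ[ℂ] V} {c d : ℂ} (hE : IsMult F.X F.Y E E' c d)
    (hw : Sz s 0 w) (hX : Sz s (-1) fun i => F.X (w i)) (hY : Sz s (-2) fun i => F.Y (w i))
    (hr : Sz s 3 r) (hq : F.Quasi s E₀ w r) :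
    Sz s 1 fun i => 2 * d * E₀ * inner ℂ (w i) (E (w i)) := by
  have hX' := hE.sz_X' hw hX (by norm_num)
  have hY' := hE.sz_Y' hw hY (by norm_num)
  have p4 := Sz.pow hw.1 4
  have key : ∀ i, 2 * d * E₀ * inner ℂ (w i) (E (w i)) =
      inner ℂ (r i) (E (F.Y (w i))) - inner ℂ (F.Y (E' (w i))) (r i)
      - (s i : ℂ) ^ 4 * (c * inner ℂ (F.X (w i)) (E (F.Y (w i)))
        + inner ℂ (F.X (w i)) (E (F.β (w i))) + c * inner ℂ (F.Y (E' (w i))) (F.X (w i))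
        + inner ℂ (E' (w i)) (F.β (F.X (w i))) + d ^ 2 * inner ℂ (E' (w i)) (F.Y (w i)))
      - 2 * d * inner ℂ (E' (w i)) (r i)
      + 2 * d * ((s i : ℂ) ^ 4 * inner ℂ (F.X (E' (w i))) (F.X (w i))) := by
    intro i
    have h1 := inner_sq_comm F.symX (T := E ∘ₗ F.Y) (Q := c • (E ∘ₗ F.Y) + E ∘ₗ F.β)
      (fun a => by
        simp only [LinearMap.add_apply, LinearMap.smul_apply, LinearMap.comp_apply, hE.X_comm,
          F.comm, map_add]
        abel) (w i) (w i)
    have h2 := inner_sq_comm F.symY (T := E ∘ₗ F.Y) (Q := d • (E ∘ₗ F.Y))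
      (fun a => by
        simp only [LinearMap.smul_apply, LinearMap.comp_apply, hE.Y_comm]) (w i) (w i)
    have h3 := hq i
    have h4 : inner ℂ (((s i : ℂ) ^ 4) • (F.X (F.X (w i)) + F.Y (F.Y (w i)))) (E (F.Y (w i))) =
      inner ℂ ((E₀ : ℂ) • w i + r i) (E (F.Y (w i))) := by rw [h3]
    have h5 : inner ℂ (F.Y (E' (w i))) (((s i : ℂ) ^ 4) • (F.X (F.X (w i)) + F.Y (F.Y (w i)))) =
      inner ℂ (F.Y (E' (w i))) ((E₀ : ℂ) • w i + r i) := by rw [h3]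
    have h6 : inner ℂ (E' (w i)) (((s i : ℂ) ^ 4) • (F.X (F.X (w i)) + F.Y (F.Y (w i)))) =
      inner ℂ (E' (w i)) ((E₀ : ℂ) • w i + r i) := by rw [h3]
    have h7 : inner ℂ (F.Y (w i)) (E (F.Y (w i))) =
        inner ℂ (E' (w i)) (F.Y (F.Y (w i))) + d * inner ℂ (E' (w i)) (F.Y (w i)) := by
      rw [F.symY, hE.Y_comm, inner_add_right, inner_smul_right, hE.adj, hE.adj]
    have h8 : inner ℂ (E' (w i)) (F.X (F.X (w i))) = inner ℂ (F.X (E' (w i))) (F.X (w i)) :=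
      (F.symX _ _).symm
    have hc : (starRingEnd ℂ) ((s i : ℂ) ^ 4) = (s i : ℂ) ^ 4 := by simp
    have hY2 : ∀ v, inner ℂ (w i) (E (F.Y v)) = inner ℂ (F.Y (E' (w i))) v := fun v => by
      rw [F.symY, hE.adj]
    rw [inner_smul_left, inner_add_left, inner_add_left, inner_smul_left] at h4
    simp only [LinearMap.add_apply, LinearMap.smul_apply, LinearMap.comp_apply, inner_add_right,
      inner_smul_right, hc, Complex.conj_ofReal, hY2, ← hE.adj] at h1 h2 h4 h5 h6 h7 ⊢
    have h9 : inner ℂ (E' (w i)) (F.Y (F.Y (w i))) = inner ℂ (F.Y (E' (w i))) (F.Y (w i)) :=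
      (F.symY _ _).symm
    linear_combination h4 - h5 - 2 * d * h6 - (s i : ℂ) ^ 4 * (h1 + h2) +
      (s i : ℂ) ^ 4 * d * (h9 - h7 + 2 * h8)
  have q := ((((hr.inner (hE.sz hY)).mono (j := 1) (by norm_num)).sub
    ((hY'.inner hr).mono (by norm_num))).sub
    ((p4.mul ((((((hX.inner (hE.sz hY)).const_smul c).mono (j := -3) (by norm_num)).add
      ((hX.inner (hE.sz (F.sz_β hw))).mono (by norm_num))).add
      (((hY'.inner hX).const_smul c).mono (by norm_num))).add
      (((hE.sz' hw).inner (F.sz_β hX)).mono (by norm_num)) |>.add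
      ((((hE.sz' hw).inner hY).const_smul (d ^ 2)).mono (by norm_num)))).mono (by norm_num))).sub
    ((((hE.sz' hw).inner hr).const_smul (2 * d)).mono (by norm_num)) |>.add
    (((p4.mul (hX'.inner hX)).const_smul (2 * d)).mono (by norm_num))
  exact q.congr fun i => by rw [key i]; simp only [smul_eq_mul]

lemma inner_cross_small {E E' X' γ : V →ₗ[ℂ] V} {c d c' p q : ℂ} {C : ℝ}
    (hE : IsMult F.X F.Y E E' c d) (hX' : X'.IsSymmetric)
    (hX'Y : ∀ a, X' (F.Y a) = F.Y (X' a) + γ a) (hγ : ∀ a, ‖γ a‖ ≤ C * ‖a‖)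
    (hYX : ∀ a, F.Y a = p • F.X a + q • X' a) (hX'E : ∀ a, X' (E' a) = E' (X' a) - c' • E' a)
    (hw : Sz s 0 w) (hX : Sz s (-1) fun i => F.X (w i)) (hY : Sz s (-2) fun i => F.Y (w i))
    (hr : Sz s 3 r) (hq : F.Quasi s E₀ w r)
    (hu : Sz s 0 u) (huX' : Sz s (-1) fun i => X' (u i)) (huX : Sz s (-2) fun i => F.X (u i))
    (huY : Sz s (-2) fun i => F.Y (u i)) :
    Sz s 1 fun i => (E₀ : ℂ) * inner ℂ (u i) (E (w i)) := by
  have h1 := hE.sz_X' hu huX (by norm_num)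
  have h2 := hE.sz_Y' hu huY (by norm_num)
  have h3 : Sz s (-1) fun i => X' (E' (u i)) :=
    ((hE.sz' huX').sub (((hE.sz' hu).const_smul c').mono (by norm_num))).congr fun _ => hX'E _
  have h4 : Sz s 0 fun i => γ (E' (u i)) := (hE.sz' hu).of_le C fun _ => hγ _
  have p4 := Sz.pow hw.1 4
  have hsz := ((p4.mul (((h1.inner hX).mono (j := -3) (by norm_num)).add
    ((((h2.inner hX).const_smul p).mono (by norm_num)).add
      ((((h3.inner hY).mono (by norm_num)).add ((h4.inner hw).mono (by norm_num))).const_smul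
        q)))).mono (j := 1) (by norm_num)).sub (((hE.sz' hu).inner hr).mono (by norm_num))
  refine hsz.congr fun i => ?_
  have h5 : inner ℂ (E' (u i)) (((s i : ℂ) ^ 4) • (F.X (F.X (w i)) + F.Y (F.Y (w i)))) =
      inner ℂ (E' (u i)) ((E₀ : ℂ) • w i + r i) := by rw [hq i]
  have h6 : inner ℂ (F.Y (E' (u i))) (X' (w i)) =
      inner ℂ (X' (E' (u i))) (F.Y (w i)) + inner ℂ (γ (E' (u i))) (w i) := by
    rw [← hX', hX'Y, inner_add_left, F.symY]
  have h7 : inner ℂ (F.Y (E' (u i))) (F.Y (w i)) =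
      p * inner ℂ (F.Y (E' (u i))) (F.X (w i)) + q * inner ℂ (F.Y (E' (u i))) (X' (w i)) := by
    rw [hYX (w i), inner_add_right, inner_smul_right, inner_smul_right]
  have h8 := F.symX (E' (u i)) (F.X (w i))
  have h9 := F.symY (E' (u i)) (F.Y (w i))
  rw [inner_smul_right, inner_add_right, inner_add_right, inner_smul_right, hE.adj _ (w i)] at h5
  simp only [smul_eq_mul]
  linear_combination -h5 + (s i : ℂ) ^ 4 * (q * h6 + h7 - h8 - h9)

lemma quasi_bound (hu : Sz s 0 u) (hr : Sz s 3 r) (hq : F.Quasi s E₀ u r) :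
    Sz s (-2) (fun i => F.X (u i)) ∧ Sz s (-2) (fun i => F.Y (u i)) := by
  obtain ⟨hs, C, hC, h⟩ := hu.inner (((hu.const_smul E₀).add (hr.mono (by norm_num))))
  have key : ∀ i, ‖F.X (u i)‖ ^ 2 + ‖F.Y (u i)‖ ^ 2 ≤ C * (s i ^ (-2 : ℤ)) ^ 2 := by
    intro i
    have h1 : inner ℂ (u i) (((s i : ℂ) ^ 4) • (F.X (F.X (u i)) + F.Y (F.Y (u i)))) =
      inner ℂ (u i) ((E₀ : ℂ) • u i + r i) := by rw [hq i]
    rw [inner_smul_right, inner_add_right, ← F.symX, ← F.symY, inner_self_eq_norm_sq_to_K,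
      inner_self_eq_norm_sq_to_K] at h1
    have h2 := h i
    simp only [← h1, norm_mul, norm_pow, Complex.norm_real] at h2
    have hsi := (hs i).1
    have h3 : ‖((‖F.X (u i)‖ : ℂ) ^ 2 + (‖F.Y (u i)‖ : ℂ) ^ 2)‖ =
        ‖F.X (u i)‖ ^ 2 + ‖F.Y (u i)‖ ^ 2 := by
      rw [← Complex.ofReal_pow, ← Complex.ofReal_pow, ← Complex.ofReal_add, Complex.norm_real,
        Real.norm_eq_abs, abs_of_nonneg (by positivity)]
    have h4 : s i ^ 4 * (‖F.X (u i)‖ ^ 2 + ‖F.Y (u i)‖ ^ 2) ≤ C := by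
      rw [← h3]
      simpa [abs_of_pos hsi] using h2
    have h5 : (s i ^ (-2 : ℤ)) ^ 2 = (s i ^ 4)⁻¹ := by
      rw [zpow_neg, inv_pow]; congr 1; norm_cast; ring
    rw [h5, ← div_eq_mul_inv, le_div_iff₀ (by positivity), mul_comm]
    exact h4
  have hpos : ∀ i, 0 ≤ √C * s i ^ (-2 : ℤ) := fun i => by
    have := (hs i).1
    positivity
  refine ⟨⟨hs, √C, by positivity, fun i => ?_⟩, ⟨hs, √C, by positivity, fun i => ?_⟩⟩ <;>
  · refine le_of_sq_le_sq ?_ (hpos i)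
    rw [mul_pow, Real.sq_sqrt hC]
    nlinarith [key i, sq_nonneg ‖F.X (u i)‖, sq_nonneg ‖F.Y (u i)‖]

variable {R : ℝ}

lemma div_ne {ι : Type*} {s : ι → ℝ} {R : ℝ} (hR : R ≠ 0) (hs : ∀ i, 0 < s i ∧ s i ≤ 1) (i : ι) :
    R / s i ≠ 0 := div_ne_zero hR (hs i).1.ne'

lemma sz_G (hR : R ≠ 0) (h : Sz s k w) : Sz s (k + 1) fun i => F.G (R / s i) (w i) := by
  obtain ⟨hs, C, hC, h⟩ := h
  refine ⟨hs, |R|⁻¹ * C, by positivity, fun i => (F.norm_G (div_ne hR hs i) _).trans ?_⟩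
  have hsi := (hs i).1
  rw [abs_div, abs_of_pos hsi, inv_div, zpow_add_one₀ hsi.ne']
  calc s i / |R| * ‖w i‖ ≤ s i / |R| * (C * s i ^ k) :=
        mul_le_mul_of_nonneg_left (h i) (by positivity)
    _ = _ := by ring

lemma sz_K (hR : R ≠ 0) (h : Sz s k w) : Sz s k fun i => F.K (R / s i) (w i) :=
  h.of_le 1 fun i => by rw [one_mul]; exact F.norm_K (div_ne hR h.1 i) _

lemma sz_scalar (hs : ∀ i, 0 < s i ∧ s i ≤ 1) :
    Sz s (-1) fun i => Complex.I * ((R / s i : ℝ) : ℂ) := by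
  refine ⟨hs, |R|, abs_nonneg _, fun i => ?_⟩
  rw [norm_mul, Complex.norm_I, Complex.norm_real, Real.norm_eq_abs, abs_div,
    abs_of_pos (hs i).1, zpow_neg_one, one_mul, div_eq_mul_inv]

lemma sz_X_K (hR : R ≠ 0) (h : Sz s k w) : Sz s (-1 + k) fun i => F.X (F.K (R / s i) (w i)) :=
  ((sz_scalar h.1).smul (h.sub (F.sz_K hR h))).congr fun i => F.X_K (div_ne hR h.1 i) _

lemma Y_K (hρ : ρ ≠ 0) (a : V) :
    F.Y (F.K ρ a) = F.K ρ (F.Y a) + (Complex.I * ρ) • F.G ρ (F.β (F.G ρ a)) := by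
  rw [K_apply, map_smul, F.Y_G hρ, K_apply, smul_add]

lemma Y_GβG (hρ : ρ ≠ 0) (a : V) : F.Y (F.G ρ (F.β (F.G ρ a))) = F.G ρ (F.β (F.G ρ (F.Y a))) +
    (F.G ρ (F.β₂ (F.G ρ a)) + (2 : ℂ) • F.G ρ (F.β (F.G ρ (F.β (F.G ρ a))))) := by
  rw [F.Y_G hρ, F.commY, F.Y_G hρ]
  simp only [map_add]
  module

lemma sz_GβG (hR : R ≠ 0) (h : Sz s k w) :
    Sz s (k + 2) fun i => F.G (R / s i) (F.β (F.G (R / s i) (w i))) :=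
  (F.sz_G hR (F.sz_β (F.sz_G hR h))).mono (by omega)

lemma sz_GβG_comm (hR : R ≠ 0) (h : Sz s k w) :
    Sz s (k + 2) fun i => (F.G (R / s i) (F.β₂ (F.G (R / s i) (w i))) + (2 : ℂ) •
      F.G (R / s i) (F.β (F.G (R / s i) (F.β (F.G (R / s i) (w i)))))) :=
  ((F.sz_G hR (F.sz_β₂ (F.sz_G hR h))).mono (by omega)).add
    (((F.sz_GβG hR (F.sz_β (F.sz_G hR h))).const_smul 2).mono (by omega))

lemma quasi_K (hR : R ≠ 0) (hu : Sz s 0 u) (hr : Sz s 3 r) (hq : F.Quasi s E₀ u r) :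
    Sz s 0 (fun i => F.K (R / s i) (u i)) ∧
    Sz s (-1) (fun i => F.X (F.K (R / s i) (u i))) ∧
    Sz s (-2) (fun i => F.Y (F.K (R / s i) (u i))) ∧
    ∃ r', Sz s 3 r' ∧ F.Quasi s E₀ (fun i => F.K (R / s i) (u i)) r' := by
  obtain ⟨-, hY⟩ := F.quasi_bound hu hr hq
  refine ⟨F.sz_K hR hu, F.sz_X_K hR hu, ?_, fun i => F.K (R / s i) (r i) + ((s i : ℂ) ^ 4) •
      (Complex.I * ((R / s i : ℝ) : ℂ)) •
      ((2 : ℂ) • F.G (R / s i) (F.β (F.G (R / s i) (F.Y (u i)))) +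
      (F.G (R / s i) (F.β₂ (F.G (R / s i) (u i))) + (2 : ℂ) •
      F.G (R / s i) (F.β (F.G (R / s i) (F.β (F.G (R / s i) (u i))))))), ?_, fun i => ?_⟩
  · exact ((F.sz_K hR hY).add (((sz_scalar hu.1).smul (F.sz_GβG hR hu)).mono (by norm_num))).congr
      fun i => F.Y_K (div_ne hR hu.1 i) _
  · exact (F.sz_K hR hr).add (((Sz.pow hu.1 4).smul ((sz_scalar hu.1).smul
      ((((F.sz_GβG hR hY).const_smul 2).mono (j := 0) (by norm_num)).add
        ((F.sz_GβG_comm hR hu).mono (by norm_num))))).mono (by norm_num))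
  · have hρ := div_ne hR hu.1 i
    have h1 : F.K (R / s i) (((s i : ℂ) ^ 4) • (F.X (F.X (u i)) + F.Y (F.Y (u i)))) =
      F.K (R / s i) ((E₀ : ℂ) • u i + r i) := by rw [hq i]
    have h2 : F.X (F.X (F.K (R / s i) (u i))) = F.K (R / s i) (F.X (F.X (u i))) := by
      rw [F.X_K hρ, F.K_X hρ, map_smul, map_sub, F.X_K hρ, F.K_X hρ]
    rw [map_smul, map_add, map_add, map_smul] at h1
    simp only
    rw [h2, F.Y_K hρ, map_add, F.Y_K hρ, map_smul, F.Y_GβG hρ]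
    rw [← sub_eq_zero] at h1 ⊢
    rw [← h1]
    module

end Frame

namespace Sz

variable {ι : Type*} {s : ι → ℝ}

lemma inv_sq (hs : ∀ i, 0 < s i ∧ s i ≤ 1) : Sz s (-2) fun i => ((s i : ℂ) ^ 2)⁻¹ := by
  refine ⟨hs, 1, zero_le_one, fun i => ?_⟩
  rw [norm_inv, norm_pow, Complex.norm_real, Real.norm_eq_abs, abs_of_pos (hs i).1, one_mul, zpow_neg]
  norm_cast

lemma tendsto_mul {l : Filter ι} {δ : ι → ℝ} {a : ι → ℂ} (h : Sz s 0 a)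
    (hδ : Tendsto δ l (𝓝 0)) : Tendsto (fun i => (δ i : ℂ) * a i) l (𝓝 0) := by
  obtain ⟨-, C, hC, h⟩ := h
  refine squeeze_zero_norm (a := fun i => |δ i| * C) (fun i => ?_) (by simpa using hδ.abs.mul_const C)
  rw [norm_mul, Complex.norm_real, Real.norm_eq_abs]
  exact mul_le_mul_of_nonneg_left (by simpa using h i) (abs_nonneg _)

end Sz

namespace Frame

variable {ι V : Type*} [NormedAddCommGroup V] [InnerProductSpace ℂ V]
variable (F : Frame V) {s : ι → ℝ} {E₀ ρ R : ℝ} {w r u : ι → V} {k : ℤ}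

lemma mult_K {E E' : V →ₗ[ℂ] V} {c d : ℂ} (hE : IsMult F.X F.Y E E' c d) (hρ : ρ ≠ 0) (a : V) :
    E (F.K ρ a) = F.K ρ (E a) + (Complex.I * ρ * c) • F.G ρ (E (F.G ρ a)) := by
  have h := F.G_comm hρ (T := E) (Q := c • E) hE.X_comm a
  rw [LinearMap.smul_apply, map_smul] at h
  have h' := congrArg (fun v => (Complex.I * ρ) • v) h
  rw [K_apply, map_smul, h', K_apply]
  module

lemma mult_average {E E' : V →ₗ[ℂ] V} {c d : ℂ} (hE : IsMult F.X F.Y E E' c d) (hR : R ≠ 0)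
    (hu : Sz s 0 u) :
    Sz s 1 fun i => (2⁻¹ : ℂ) * (inner ℂ (u i) (E (F.K (R / s i) (u i))) +
      inner ℂ (F.K (R / s i) (u i)) (E (u i))) -
      inner ℂ (F.K (R / s i) (u i)) (E (F.K (R / s i) (u i))) := by
  have hR' : -R ≠ 0 := neg_ne_zero.2 hR
  have z : ∀ {w : ι → V}, Sz s 0 w → Sz s 1 fun i => (Complex.I * ((-R / s i : ℝ) : ℂ) * c) •
      F.G (-R / s i) (E (F.G (-R / s i) (w i))) := fun h =>
    ((((sz_scalar h.1).const_smul c).smul (F.sz_G hR' (hE.sz (F.sz_G hR' h)))).mono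
      (by norm_num)).congr fun i => by simp only [smul_eq_mul]; rw [mul_comm c]
  have hsz := ((hu.inner (z (F.sz_K hR hu))).sub ((hu.inner (z hu)).const_smul 2⁻¹)).mono
    (j := 1) (by norm_num)
  refine hsz.congr fun i => ?_
  have hρ := div_ne hR hu.1 i
  have hρ' := div_ne hR' hu.1 i
  have hn : -(R / s i) = -R / s i := by ring
  have h1 := F.mult_K hE hρ' (F.K (R / s i) (u i))
  have h2 := F.mult_K hE hρ' (u i)
  have h3 := F.K_neg_K hρ (u i)
  rw [F.K_adj hρ, F.K_adj hρ, hn]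
  rw [hn] at h3
  rw [h3, map_smul, map_add, h2] at h1
  have h4 := congrArg (inner ℂ (u i)) h1
  simp only [inner_add_right, inner_smul_right, smul_eq_mul] at h4 ⊢
  linear_combination h4

/-- The part of a quasimode away from `X = 0` does not correlate through a multiplier invariant
along `Y`. -/
lemma mult_away {E E' : V →ₗ[ℂ] V} {c : ℂ} (hE : IsMult F.X F.Y E E' c 0) {l : Filter ι}
    {δ : ι → ℝ} (hs : Tendsto s l (𝓝 0)) (hδ : Tendsto δ l (𝓝 0))
    (hu : Sz s 0 u) (hY : Sz s (-2) fun i => F.Y (u i)) (hr : Sz s 3 r)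
    (hq : F.Quasi s E₀ u fun i => (δ i : ℂ) • r i) :
    ∃ C, ∀ R ≠ 0, ∃ e : ι → ℂ, Tendsto e l (𝓝 0) ∧
      ∀ i, ‖2 * c * inner ℂ (u i) (E (u i - F.K (R / s i) (u i)))‖ ≤ C / R ^ 2 + ‖e i‖ := by
  obtain ⟨-, C₁, hC₁, h₁⟩ := hu
  obtain ⟨hs', C₂, hC₂, h₂⟩ := hY
  refine ⟨2 * (C₁ * C₂ * F.bd), fun R hR => ⟨fun i => (δ i : ℂ) * (((s i : ℂ) ^ 4)⁻¹ *
    (inner ℂ (r i) (E (F.G (R / s i) (u i))) - inner ℂ (E' (u i)) (F.G (R / s i) (r i)))) -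
    c ^ 2 * inner ℂ (E' (u i)) (F.G (R / s i) (u i)), ?_, fun i => ?_⟩⟩
  · have hu : Sz s 0 u := ⟨hs', C₁, hC₁, h₁⟩
    have hG := F.sz_G hR hu
    have h5 : Sz s 1 fun i => c ^ 2 * inner ℂ (E' (u i)) (F.G (R / s i) (u i)) :=
      (((hE.sz' hu).inner hG).const_smul (c ^ 2)).mono (by norm_num)
    have h6 : Sz s 4 fun i => inner ℂ (r i) (E (F.G (R / s i) (u i))) -
        inner ℂ (E' (u i)) (F.G (R / s i) (r i)) :=
      ((hr.inner (hE.sz hG)).mono (by norm_num)).sub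
        (((hE.sz' hu).inner (F.sz_G hR hr)).mono (by norm_num))
    obtain ⟨-, C, hC, h⟩ := h6
    rw [show (0:ℂ) = 0 - 0 by simp]
    refine Tendsto.sub ?_ (h5.tendsto hs)
    refine squeeze_zero_norm (a := fun i => |δ i| * C) (fun i => ?_) ?_
    · have hsi := (hs' i).1
      rw [norm_mul, norm_mul, Complex.norm_real, Real.norm_eq_abs, norm_inv, norm_pow,
        Complex.norm_real, Real.norm_eq_abs, abs_of_pos hsi]
      refine mul_le_mul_of_nonneg_left ?_ (abs_nonneg _)
      rw [inv_mul_le_iff₀ (by positivity), mul_comm]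
      exact_mod_cast h i
    · simpa using hδ.abs.mul_const C
  · have hρ := div_ne hR hs' i
    have hsi := (hs' i).1
    have hsc : (s i : ℂ) ^ 4 ≠ 0 := by simp [hsi.ne']
    generalize hρ' : R / s i = ρ at *
    have a1 := inner_sq_comm F.symX (T := E ∘ₗ F.G ρ) (Q := c • (E ∘ₗ F.G ρ))
      (fun a => by
        simp only [LinearMap.smul_apply, LinearMap.comp_apply, hE.X_comm, F.X_G_eq hρ,
          F.G_X hρ]) (u i) (u i)
    have a2 := inner_sq_comm F.symY (T := E ∘ₗ F.G ρ) (Q := E ∘ₗ F.G ρ ∘ₗ F.β ∘ₗ F.G ρ)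
      (fun a => by
        simp only [LinearMap.comp_apply, hE.Y_comm, F.Y_G hρ, map_add, zero_smul, add_zero])
        (u i) (u i)
    have a3 : inner ℂ (((s i : ℂ) ^ 4) • (F.X (F.X (u i)) + F.Y (F.Y (u i)))) (E (F.G ρ (u i))) =
      inner ℂ ((E₀ : ℂ) • u i + (δ i : ℂ) • r i) (E (F.G ρ (u i))) := by rw [hq i]
    have a4 : inner ℂ (u i) (E (F.G ρ (((s i : ℂ) ^ 4) • (F.X (F.X (u i)) + F.Y (F.Y (u i)))))) =
      inner ℂ (u i) (E (F.G ρ ((E₀ : ℂ) • u i + (δ i : ℂ) • r i))) := by rw [hq i]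
    have a5 : inner ℂ (F.X (u i)) (E (F.G ρ (u i))) =
        inner ℂ (u i) (E (u i - F.K ρ (u i))) + c * inner ℂ (u i) (E (F.G ρ (u i))) := by
      rw [F.symX, hE.X_comm, F.X_G_eq hρ, inner_add_right, inner_smul_right]
    rw [inner_smul_left, inner_add_left, inner_add_left, inner_smul_left, inner_smul_left] at a3
    simp only [LinearMap.smul_apply, LinearMap.comp_apply, map_add, map_smul, inner_add_right,
      inner_smul_right, F.G_X hρ, map_pow, Complex.conj_ofReal] at a1 a2 a3 a4
    have key : 2 * c * inner ℂ (u i) (E (u i - F.K ρ (u i))) =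
      ((δ i : ℂ) * (((s i : ℂ) ^ 4)⁻¹ *
      (inner ℂ (r i) (E (F.G ρ (u i))) - inner ℂ (E' (u i)) (F.G ρ (r i)))) -
      c ^ 2 * inner ℂ (E' (u i)) (F.G ρ (u i))) -
      (inner ℂ (F.Y (u i)) (E (F.G ρ (F.β (F.G ρ (u i))))) +
        inner ℂ (u i) (E (F.G ρ (F.β (F.G ρ (F.Y (u i))))))) := by
      rw [hE.adj, hE.adj]
      refine mul_left_cancel₀ hsc ?_
      linear_combination a3 - a4 - (s i : ℂ) ^ 4 * (a1 + a2 + c * a5) - (δ i : ℂ) *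
        (inner ℂ (r i) (E (F.G ρ (u i))) - inner ℂ (u i) (E (F.G ρ (r i)))) * mul_inv_cancel₀ hsc
    have hGβG : ∀ v, ‖F.G ρ (F.β (F.G ρ v))‖ ≤ (s i ^ 2 / R ^ 2) * F.bd * ‖v‖ := fun v => by
      have hG : ∀ v, ‖F.G ρ v‖ ≤ s i / |R| * ‖v‖ := fun v => by
        have := F.norm_G hρ v
        rwa [← hρ', abs_div, abs_of_pos hsi, inv_div, hρ'] at this
      have hb := F.bd_nonneg
      calc ‖F.G ρ (F.β (F.G ρ v))‖ ≤ s i / |R| * (F.bd * (s i / |R| * ‖v‖)) := by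
            refine (hG _).trans ?_
            gcongr
            refine (F.norm_β _).trans ?_
            gcongr
            exact hG v
        _ = _ := by rw [← sq_abs R]; ring
    have h1 := h₁ i
    have h2 := h₂ i
    rw [zpow_zero, mul_one] at h1
    rw [key]
    refine (norm_sub_le _ _).trans ((add_comm _ _).trans_le ?_)
    simp only [hρ']
    refine add_le_add ((norm_add_le _ _).trans ?_) le_rfl
    have hb := F.bd_nonneg
    have e1 : C₂ * s i ^ (-2 : ℤ) * (s i ^ 2 / R ^ 2 * F.bd * C₁) = C₁ * C₂ * F.bd / R ^ 2 := by
      rw [zpow_neg]; norm_cast; field_simp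
    have e2 : 2 * (C₁ * C₂ * F.bd) / R ^ 2 = C₁ * C₂ * F.bd / R ^ 2 + C₁ * C₂ * F.bd / R ^ 2 := by
      ring
    rw [e2]
    refine add_le_add ?_ ?_
    · refine (norm_inner_le_norm _ _).trans ?_
      rw [← e1]
      refine mul_le_mul h2 ((hE.norm_le _).trans ((hGβG _).trans ?_)) (norm_nonneg _) (by positivity)
      gcongr
    · refine (norm_inner_le_norm _ _).trans ?_
      calc _ ≤ C₁ * (s i ^ 2 / R ^ 2 * F.bd * (C₂ * s i ^ (-2 : ℤ))) := by
            refine mul_le_mul h1 ((hE.norm_le _).trans ((hGβG _).trans ?_)) (norm_nonneg _) hC₁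
            gcongr
        _ = _ := by rw [← e1]; ring

lemma G_sub_G_norm {S : ℝ} (hR : 0 < R) (hS : 0 < S) {σ : ℝ} (hσ : 0 < σ) (v : V) :
    ‖F.G (R / σ) v - F.G (S / σ) v - (Complex.I * ((S - R : ℝ) : ℂ) * (σ : ℂ)⁻¹) •
      F.G (R / σ) (F.G (R / σ) v)‖ ≤ |S - R| ^ 2 / (R ^ 2 * S) * σ * ‖v‖ := by
  have hR' : R / σ ≠ 0 := by positivity
  have hS' : S / σ ≠ 0 := by positivity
  have h1 := F.G_sub_G hR' hS' v
  have h2 := F.G_sub_G hS' hR' v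
  have h3 : F.G (S / σ) v = F.G (R / σ) v - (F.G (R / σ) v - F.G (S / σ) v) := by abel
  have h4 : F.G (R / σ) v - F.G (S / σ) v - (Complex.I * ((S - R : ℝ) : ℂ) * (σ : ℂ)⁻¹) •
      F.G (R / σ) (F.G (R / σ) v) = ((S - R : ℝ) * (σ : ℂ)⁻¹) ^ 2 •
        F.G (R / σ) (F.G (R / σ) (F.G (S / σ) v)) := by
    rw [h1]
    conv_lhs => enter [1]; rw [h3, h1]
    rw [map_sub, map_smul, smul_sub, smul_smul]
    have hI := Complex.I_sq
    have e1 : Complex.I * (((S / σ : ℝ) : ℂ) - ((R / σ : ℝ) : ℂ)) =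
      Complex.I * ((S - R : ℝ) : ℂ) * (σ : ℂ)⁻¹ := by push_cast; ring
    have e2 : Complex.I * ((S - R : ℝ) : ℂ) * (σ : ℂ)⁻¹ * (Complex.I * ((S - R : ℝ) : ℂ) * (σ : ℂ)⁻¹)
      = -((S - R : ℝ) * (σ : ℂ)⁻¹) ^ 2 := by linear_combination ((S - R : ℝ) * (σ : ℂ)⁻¹) ^ 2 * hI
    rw [e1, e2]
    module
  have hb : ∀ {T : ℝ}, 0 < T → ∀ v, ‖F.G (T / σ) v‖ ≤ σ / T * ‖v‖ := fun {T} hT v => by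
    have := F.norm_G (ρ := T / σ) (by positivity) v
    rwa [abs_div, abs_of_pos hσ, abs_of_pos hT, inv_div] at this
  rw [h4, norm_smul, norm_pow, norm_mul, norm_inv, Complex.norm_real, Complex.norm_real,
    Real.norm_eq_abs, Real.norm_eq_abs, abs_of_pos hσ]
  calc _ ≤ (|S - R| * σ⁻¹) ^ 2 * (σ / R * (σ / R * (σ / S * ‖v‖))) := by
        gcongr
        refine (hb hR _).trans ?_
        gcongr
        refine (hb hR _).trans ?_
        gcongr
        exact hb hS _
    _ = _ := by field_simp

/-- The commutator term vanishes on quasimodes, for the squared resolvent. -/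
lemma tendsto_β_G_G (hR : R ≠ 0) {l : Filter ι} {δ : ι → ℝ} (hs : Tendsto s l (𝓝 0))
    (hδ : Tendsto δ l (𝓝 0)) (hE₀ : E₀ ≠ 0) (hu : Sz s 0 u) (hX : Sz s (-2) fun i => F.X (u i))
    (hY : Sz s (-2) fun i => F.Y (u i)) (hr : Sz s 3 r)
    (hq : F.Quasi s E₀ u fun i => (δ i : ℂ) • r i) :
    Tendsto (fun i => ((s i : ℂ) ^ 2)⁻¹ *
      inner ℂ (u i) (F.β (F.G (R / s i) (F.G (R / s i) (u i))))) l (𝓝 0) := by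
  have p4 := Sz.pow hu.1 4
  have hG := F.sz_G hR hu
  have hZ := F.sz_GβG hR hu
  have hYG : Sz s (-1) fun i => F.Y (F.G (R / s i) (u i)) :=
    ((F.sz_G hR hY).add (hZ.mono (by norm_num))).congr fun i => F.Y_G (div_ne hR hu.1 i) _
  have hβG := F.sz_β hG
  have hXZ : Sz s 1 fun i => F.X (F.G (R / s i) (F.β (F.G (R / s i) (u i)))) :=
    (hβG.sub (F.sz_K hR hβG)).congr fun i => F.X_G_eq (div_ne hR hu.1 i) _
  have b1 : Sz s 2 fun i => inner ℂ (r i) (F.Y (F.G (R / s i) (u i))) -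
      inner ℂ (F.Y (u i)) (F.G (R / s i) (r i)) -
      2 * inner ℂ (r i) (F.G (R / s i) (F.β (F.G (R / s i) (u i)))) :=
    (((hr.inner hYG).mono (by norm_num)).sub ((hY.inner (F.sz_G hR hr)).mono (by norm_num))).sub
      (((hr.inner hZ).const_smul 2).mono (by norm_num))
  have b2 : Sz s 3 fun i => 2 * E₀ * inner ℂ (u i) (F.G (R / s i) (F.β₁ (F.G (R / s i)
        (F.G (R / s i) (u i))))) + ((s i : ℂ) ^ 4 * (2 * inner ℂ (F.X (u i))
      (F.X (F.G (R / s i) (F.β (F.G (R / s i) (u i))))) + inner ℂ (F.Y (u i))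
      (F.G (R / s i) (F.β₂ (F.G (R / s i) (u i))) + (2 : ℂ) •
      F.G (R / s i) (F.β (F.G (R / s i) (F.β (F.G (R / s i) (u i)))))) -
      inner ℂ (F.X (u i)) (F.β (F.G (R / s i) (u i))) -
      inner ℂ (u i) (F.β (u i - F.K (R / s i) (u i))))) :=
    (((hu.inner (F.sz_G hR (F.sz_β₁ (F.sz_G hR hG)))).const_smul (2 * E₀)).mono
      (by norm_num)).add <| (p4.mul ((((((hX.inner hXZ).const_smul 2).mono (j := -1)
      (by norm_num)).add ((hY.inner (F.sz_GβG_comm hR hu)).mono (by norm_num))).sub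
      ((hX.inner hβG).mono (by norm_num))).sub
      ((hu.inner (F.sz_β (hu.sub (F.sz_K hR hu)))).mono (by norm_num)))).mono (by norm_num)
  have key : ∀ i, ((s i : ℂ) ^ 2)⁻¹ *
      inner ℂ (u i) (F.β (F.G (R / s i) (F.G (R / s i) (u i)))) = (2 * E₀ : ℂ)⁻¹ *
      (δ i * (((s i : ℂ) ^ 2)⁻¹ * (inner ℂ (r i) (F.Y (F.G (R / s i) (u i))) -
      inner ℂ (F.Y (u i)) (F.G (R / s i) (r i)) -
      2 * inner ℂ (r i) (F.G (R / s i) (F.β (F.G (R / s i) (u i)))))) + ((s i : ℂ) ^ 2)⁻¹ *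
      (2 * E₀ * inner ℂ (u i) (F.G (R / s i) (F.β₁ (F.G (R / s i)
        (F.G (R / s i) (u i))))) + ((s i : ℂ) ^ 4 * (2 * inner ℂ (F.X (u i))
      (F.X (F.G (R / s i) (F.β (F.G (R / s i) (u i))))) + inner ℂ (F.Y (u i))
      (F.G (R / s i) (F.β₂ (F.G (R / s i) (u i))) + (2 : ℂ) •
      F.G (R / s i) (F.β (F.G (R / s i) (F.β (F.G (R / s i) (u i)))))) -
      inner ℂ (F.X (u i)) (F.β (F.G (R / s i) (u i))) -
      inner ℂ (u i) (F.β (u i - F.K (R / s i) (u i))))))) := by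
    intro i
    have hρ := div_ne hR hu.1 i
    have hq' := hq i
    generalize R / s i = ρ at hρ ⊢
    have a1 := inner_sq_comm F.symX (T := F.Y ∘ₗ F.G ρ) (Q := F.β ∘ₗ F.G ρ)
      (fun a => by simp only [LinearMap.comp_apply, F.comm, F.X_G_eq hρ, F.G_X hρ]) (u i) (u i)
    have a2 := inner_sq_comm F.symY (T := F.Y ∘ₗ F.G ρ) (Q := F.Y ∘ₗ F.G ρ ∘ₗ F.β ∘ₗ F.G ρ)
      (fun a => by simp only [LinearMap.comp_apply, F.Y_G hρ, map_add]) (u i) (u i)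
    simp only [LinearMap.comp_apply] at a1 a2
    have a3 : inner ℂ (((s i : ℂ) ^ 4) • (F.X (F.X (u i)) + F.Y (F.Y (u i)))) (F.Y (F.G ρ (u i))) =
      inner ℂ ((E₀ : ℂ) • u i + (δ i : ℂ) • r i) (F.Y (F.G ρ (u i))) := by rw [hq']
    have a4 : inner ℂ (u i) (F.Y (F.G ρ (((s i : ℂ) ^ 4) • (F.X (F.X (u i)) + F.Y (F.Y (u i)))))) =
      inner ℂ (u i) (F.Y (F.G ρ ((E₀ : ℂ) • u i + (δ i : ℂ) • r i))) := by rw [hq']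
    have a5 : inner ℂ (((s i : ℂ) ^ 4) • (F.X (F.X (u i)) + F.Y (F.Y (u i))))
      (F.G ρ (F.β (F.G ρ (u i)))) = inner ℂ ((E₀ : ℂ) • u i + (δ i : ℂ) • r i)
      (F.G ρ (F.β (F.G ρ (u i)))) := by rw [hq']
    have a6 := congrArg (inner ℂ (F.Y (u i))) (F.Y_GβG hρ (u i))
    have a7 : inner ℂ (F.Y (u i)) (F.Y (F.G ρ (F.β (F.G ρ (u i))))) =
      inner ℂ (F.Y (F.Y (u i))) (F.G ρ (F.β (F.G ρ (u i)))) := (F.symY _ _).symm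
    have a8 : inner ℂ (F.X (u i)) (F.X (F.G ρ (F.β (F.G ρ (u i))))) =
      inner ℂ (F.X (F.X (u i))) (F.G ρ (F.β (F.G ρ (u i)))) := (F.symX _ _).symm
    have a9 : inner ℂ (u i) (F.Y (F.G ρ (F.β (F.G ρ (F.Y (u i)))))) =
      inner ℂ (F.Y (u i)) (F.G ρ (F.β (F.G ρ (F.Y (u i))))) := (F.symY _ _).symm
    have a10 : inner ℂ (u i) (F.Y (F.G ρ (r i))) = inner ℂ (F.Y (u i)) (F.G ρ (r i)) :=
      (F.symY _ _).symm
    have a11 := congrArg (inner ℂ (u i)) (F.G_comm hρ F.commX (F.G ρ (u i)))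
    rw [inner_smul_left, inner_add_left, inner_add_left, inner_smul_left, inner_smul_left] at a3 a5
    rw [inner_add_right] at a6 a11
    simp only [map_add, map_smul, inner_add_right, inner_smul_right, F.G_X hρ, map_pow,
      Complex.conj_ofReal] at a1 a3 a4 a5
    have hE : (2 * E₀ : ℂ) ≠ 0 := by simp [hE₀]
    rw [eq_inv_mul_iff_mul_eq₀ hE]
    linear_combination ((s i : ℂ) ^ 2)⁻¹ * (a3 - a4 - (s i : ℂ) ^ 4 * (a1 + a2 + a9 - a6 + 2 * a7 +
      2 * a8) - 2 * a5 + 2 * E₀ * a11 - δ i * a10)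
  have p2 := Sz.inv_sq hu.1
  have b1' := (p2.mul b1).tendsto_mul hδ
  have b2' := ((p2.mul b2).mono (j := 1) (by norm_num)).tendsto hs
  simp only [key]
  simpa only [add_zero, mul_zero] using (b1'.add b2').const_mul ((2 * E₀ : ℂ)⁻¹)

end Frame

lemma eq_zero_of_quadratic {g : ℝ → ℂ} {C : ℝ}
    (h : ∀ R S, 0 < R → 0 < S → ‖g R - g S‖ ≤ C * (|S - R| ^ 2 / (R ^ 2 * S)))
    (h' : ∀ R, 0 < R → ‖g R‖ ≤ C / R) {R : ℝ} (hR : 0 < R) : g R = 0 := by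
  have hd : ∀ x ∈ Set.Ioi (0:ℝ), HasDerivAt g 0 x := by
    intro x hx
    have hx : 0 < x := hx
    rw [hasDerivAt_iff_isLittleO]
    have hO : (fun y => g y - g x - (y - x) • (0:ℂ)) =O[𝓝 x] fun y => (y - x) ^ 2 := by
      refine Asymptotics.IsBigO.of_bound (|C| / (x ^ 2 * (x / 2))) ?_
      filter_upwards [lt_mem_nhds (half_lt_self hx)] with y hy
      have hy0 : 0 < y := (half_pos hx).trans hy
      rw [smul_zero, sub_zero, norm_sub_rev]
      refine (h x y hx hy0).trans ?_
      rw [norm_pow, Real.norm_eq_abs, div_mul_eq_mul_div, ← mul_div_assoc]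
      gcongr
      exact le_abs_self C
    refine hO.trans_isLittleO ?_
    have := (Asymptotics.isLittleO_pow_id (𝕜 := ℝ) one_lt_two).comp_tendsto
      (show Tendsto (fun y => y - x) (𝓝 x) (𝓝 0) by
        simpa using (continuous_id.sub continuous_const).tendsto (f := fun y : ℝ => y - x) x)
    exact this
  have hc : ∀ S, 0 < S → g S = g R := fun S hS =>
    isOpen_Ioi.is_const_of_deriv_eq_zero (convex_Ioi (0:ℝ)).isPreconnected
      (fun x hx => (hd x hx).differentiableAt.differentiableWithinAt)
      (fun x hx => (hd x hx).deriv) hS hR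
  have hlim : Tendsto (fun S : ℝ => C / S) atTop (𝓝 0) := tendsto_const_nhds.div_atTop tendsto_id
  have h0 : ‖g R‖ ≤ 0 := ge_of_tendsto hlim <| by
    filter_upwards [eventually_gt_atTop 0] with S hS
    rw [← hc S hS]
    exact h' S hS
  exact norm_le_zero_iff.1 h0

lemma tendsto_zero_of_quadratic {ι : Type*} {l : Filter ι} {g a : ι → ℝ → ℂ} {C : ℝ}
    (h : ∀ i R S, 0 < R → 0 < S →
      ‖g i R - g i S‖ ≤ |S - R| * ‖a i R‖ + C * (|S - R| ^ 2 / (R ^ 2 * S)))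
    (h' : ∀ i R, 0 < R → ‖g i R‖ ≤ C / R)
    (ha : ∀ R, 0 < R → Tendsto (fun i => a i R) l (𝓝 0)) {R : ℝ} (hR : 0 < R) :
    Tendsto (fun i => g i R) l (𝓝 0) := by
  rw [tendsto_iff_ultrafilter]
  intro U hU
  have hlim : ∀ S, ∃ z, 0 < S → Tendsto (fun i => g i S) U (𝓝 z) := by
    intro S
    by_cases hS : 0 < S
    · obtain ⟨z, -, hz⟩ := (isCompact_closedBall (0:ℂ) (C / S)).ultrafilter_le_nhds'
        (U.map fun i => g i S) (by
          refine Filter.mem_map.2 (Filter.mem_of_superset univ_mem fun i _ => ?_)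
          simpa using h' i S hS)
      exact ⟨z, fun _ => hz⟩
    · exact ⟨0, fun h => absurd h hS⟩
  choose G hG using hlim
  have h0 : G R = 0 := by
    refine eq_zero_of_quadratic (C := C) (fun S T hS hT => ?_) (fun S hS => ?_) hR
    · have h1 := ((hG S hS).sub (hG T hT)).norm
      have h2 : Tendsto (fun i => |T - S| * ‖a i S‖ + C * (|T - S| ^ 2 / (S ^ 2 * T))) U
          (𝓝 (|T - S| * ‖(0:ℂ)‖ + C * (|T - S| ^ 2 / (S ^ 2 * T)))) :=
        ((((ha S hS).mono_left hU).norm).const_mul _).add_const _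
      have h3 := le_of_tendsto_of_tendsto' h1 h2 fun i => h i S T hS hT
      simpa using h3
    · exact le_of_tendsto' (hG S hS).norm fun i => h' i S hS
  exact h0 ▸ hG R hR

namespace Frame

variable {ι V : Type*} [NormedAddCommGroup V] [InnerProductSpace ℂ V]
variable (F : Frame V) {s : ι → ℝ} {E₀ R : ℝ} {r u : ι → V}

lemma tendsto_β_K {l : Filter ι} {δ : ι → ℝ} (hs : Tendsto s l (𝓝 0))
    (hδ : Tendsto δ l (𝓝 0)) (hE₀ : E₀ ≠ 0) (hu : Sz s 0 u) (hX : Sz s (-2) fun i => F.X (u i))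
    (hY : Sz s (-2) fun i => F.Y (u i)) (hr : Sz s 3 r)
    (hq : F.Quasi s E₀ u fun i => (δ i : ℂ) • r i) (hR : 0 < R) :
    Tendsto (fun i => inner ℂ (u i) (F.β (F.K (R / s i) (u i)))) l (𝓝 0) := by
  obtain ⟨hs', C, hC, hC'⟩ := hu
  have hu : Sz s 0 u := ⟨hs', C, hC, hC'⟩
  simp only [zpow_zero, mul_one] at hC'
  have hb := F.bd_nonneg
  have key := tendsto_zero_of_quadratic (l := l) (C := C * F.bd * C)
    (g := fun i S => ((s i : ℂ))⁻¹ * inner ℂ (u i) (F.β (F.G (S / s i) (u i))))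
    (a := fun i S => ((s i : ℂ) ^ 2)⁻¹ * inner ℂ (u i) (F.β (F.G (S / s i) (F.G (S / s i) (u i)))))
    (fun i S T hS hT => ?_) (fun i S hS => ?_)
    (fun S hS => F.tendsto_β_G_G hS.ne' hs hδ hE₀ hu hX hY hr hq) hR
  · have h := key.const_mul (Complex.I * R)
    rw [mul_zero] at h
    refine h.congr fun i => ?_
    rw [K_apply, map_smul, inner_smul_right]
    push_cast
    ring
  · have hσ := (hs' i).1
    have h1 := F.G_sub_G_norm hS hT hσ (u i)
    set w := F.G (S / s i) (u i) - F.G (T / s i) (u i) - (Complex.I * ((T - S : ℝ) : ℂ) *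
      (s i : ℂ)⁻¹) • F.G (S / s i) (F.G (S / s i) (u i)) with hw
    have h2 : ((s i : ℂ))⁻¹ * inner ℂ (u i) (F.β (F.G (S / s i) (u i))) -
        ((s i : ℂ))⁻¹ * inner ℂ (u i) (F.β (F.G (T / s i) (u i))) =
        Complex.I * ((T - S : ℝ) : ℂ) * (((s i : ℂ) ^ 2)⁻¹ *
          inner ℂ (u i) (F.β (F.G (S / s i) (F.G (S / s i) (u i))))) +
        ((s i : ℂ))⁻¹ * inner ℂ (u i) (F.β w) := by
      rw [hw]
      simp only [map_sub, map_smul, inner_sub_right, inner_smul_right]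
      ring
    rw [h2]
    refine (norm_add_le _ _).trans (add_le_add (le_of_eq ?_) ?_)
    · rw [norm_mul, norm_mul, Complex.norm_I, one_mul, Complex.norm_real, Real.norm_eq_abs]
    · rw [norm_mul, norm_inv, Complex.norm_real, Real.norm_eq_abs, abs_of_pos hσ]
      have h3 : ‖inner ℂ (u i) (F.β w)‖ ≤ C * (F.bd * (|T - S| ^ 2 / (S ^ 2 * T) * s i * C)) := by
        refine (norm_inner_le_norm _ _).trans ?_
        gcongr
        · exact hC' i
        · refine (F.norm_β _).trans ?_
          gcongr
          refine h1.trans ?_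
          gcongr
          exact hC' i
      calc _ ≤ (s i)⁻¹ * (C * (F.bd * (|T - S| ^ 2 / (S ^ 2 * T) * s i * C))) := by gcongr
        _ = _ := by field_simp
  · have hσ := (hs' i).1
    rw [norm_mul, norm_inv, Complex.norm_real, Real.norm_eq_abs, abs_of_pos hσ]
    have h1 := F.norm_G (ρ := S / s i) (by positivity) (u i)
    rw [abs_of_pos (by positivity)] at h1
    have h3 : ‖inner ℂ (u i) (F.β (F.G (S / s i) (u i)))‖ ≤ C * (F.bd * ((S / s i)⁻¹ * C)) := by
      refine (norm_inner_le_norm _ _).trans ?_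
      gcongr
      · exact hC' i
      · refine (F.norm_β _).trans ?_
        gcongr
        refine h1.trans ?_
        gcongr
        exact hC' i
    calc _ ≤ (s i)⁻¹ * (C * (F.bd * ((S / s i)⁻¹ * C))) := by gcongr
      _ = _ := by field_simp

end Frame

namespace PerFun

/-- The character `x ↦ exp(2πi k·x)`. -/
noncomputable def char (k : ℤ × ℤ) : PerFun :=
  ⟨fun x => Complex.exp (Complex.I * (2 * π * dotp (latt k) x : ℝ)), by
    unfold dotp
    exact Complex.contDiff_exp.comp (contDiff_const.mul (Complex.ofRealCLM.contDiff.comp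
      (contDiff_const.mul ((contDiff_const.mul contDiff_fst).add
        (contDiff_const.mul contDiff_snd))))), fun m x => by
    simp only
    rw [Complex.exp_eq_exp_iff_exists_int]
    refine ⟨k.1 * m.1 + k.2 * m.2, ?_⟩
    simp [dotp, latt]
    ring⟩

lemma char_apply (k : ℤ × ℤ) (x : Pt) :
    char k x = Complex.exp (Complex.I * (2 * π * dotp (latt k) x : ℝ)) := rfl

lemma norm_char (k : ℤ × ℤ) (x : Pt) : ‖char k x‖ = 1 := Sec.norm_exp_I_mul _

lemma der_char (k : ℤ × ℤ) (v x : Pt) :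
    der v (char k) x = ((2 * π * dotp (latt k) v : ℝ) : ℂ) * char k x := by
  have h : HasFDerivAt (char k) (char k x • (Complex.I • Complex.ofRealCLM.comp
      ((2 * π) • ((latt k).1 • ContinuousLinearMap.fst ℝ ℝ ℝ +
        (latt k).2 • ContinuousLinearMap.snd ℝ ℝ ℝ)))) x := by
    have h1 : HasFDerivAt (fun y : Pt => 2 * π * dotp (latt k) y)
        ((2 * π) • ((latt k).1 • ContinuousLinearMap.fst ℝ ℝ ℝ +
        (latt k).2 • ContinuousLinearMap.snd ℝ ℝ ℝ)) x :=
      ((hasFDerivAt_fst.const_mul _).add (hasFDerivAt_snd.const_mul _)).const_mul _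
    exact ((Complex.ofRealCLM.hasFDerivAt.comp x h1).const_mul Complex.I).cexp
  rw [der_apply, h.fderiv]
  have hI := Complex.I_sq
  simp [dotp]
  linear_combination (-2 * π * ((latt k).1 * v.1 + (latt k).2 * v.2) * char k x) * hI

lemma conj_conj (f : PerFun) : f.conj.conj = f := Subtype.ext (funext fun _ => Complex.conj_conj _)

lemma conj_der_char (k : ℤ × ℤ) (v x : Pt) :
    der v (char k).conj x = -((2 * π * dotp (latt k) v : ℝ) : ℂ) * (char k).conj x := by
  have h : (char k).conj = char (-k) := by
    refine Subtype.ext (funext fun x => ?_)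
    change (starRingEnd ℂ) (char k x) = char (-k) x
    rw [char_apply, char_apply, ← Complex.exp_conj]
    congr 1
    simp [latt, dotp, map_ofNat]
    ring
  rw [h, der_char]
  congr 1
  simp [latt, dotp]
  ring

end PerFun

/-- The magnetic data: a smooth potential for the field `B`, with quantized flux. -/
structure MagData (B0 : ℝ) where
  pot : GaugePot B0
  B : PerFun
  curl : ∀ x, B x = (((fderiv ℝ pot.a x (1, 0)).2 - (fderiv ℝ pot.a x (0, 1)).1 : ℝ) : ℂ)
  flux : ∃ k : ℤ, B0 = 2 * π * k

namespace MagData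

open Sec PerFun

variable {B0 : ℝ} (M : MagData B0)

/-- The covariant derivative in direction `v`. -/
noncomputable def D (v : Pt) : Sec B0 →ₗ[ℂ] Sec B0 := covD M.pot v

lemma D_apply (v : Pt) (u : Sec B0) :
    M.D v u = (v.1 : ℂ) • M.D (1, 0) u + (v.2 : ℂ) • M.D (0, 1) u := by
  conv_lhs => rw [D, covD_eq]
  rfl

lemma D_symm (v : Pt) : (M.D v).IsSymmetric := inner_covD M.pot v

lemma D_comm (v w : Pt) (u : Sec B0) :
    M.D v (M.D w u) = M.D w (M.D v u) + ((Complex.I * (wedge v w : ℝ)) • mul M.B) u := by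
  have h : M.D (1, 0) (M.D (0, 1) u) - M.D (0, 1) (M.D (1, 0) u) = Complex.I • mul M.B u :=
    covD_comm M.pot M.B M.curl u
  rw [sub_eq_iff_eq_add] at h
  rw [LinearMap.smul_apply, M.D_apply v, M.D_apply w, M.D_apply w, M.D_apply v u]
  simp only [map_add, map_smul, h, wedge]
  push_cast
  module

lemma D_mul (v : Pt) (f : PerFun) (u : Sec B0) :
    M.D v (mul f u) = mul f (M.D v u) + mul (f.der v) u := covD_mul _ _ _ _

/-- The magnetic Laplacian on sections. -/
noncomputable def lap (u : Sec B0) : Sec B0 := M.D (1, 0) (M.D (1, 0) u) + M.D (0, 1) (M.D (0, 1) u)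

lemma exists_G (e : ℤ × ℤ) (ρ : ℝ) : ∃ G : Sec B0 →ₗ[ℂ] Sec B0, ρ ≠ 0 →
    ∀ a, M.D (latt e) (G a) + (Complex.I * ρ) • G a = a := by
  by_cases hρ : ρ = 0
  · exact ⟨0, fun h => absurd hρ h⟩
  set T : Sec B0 →ₗ[ℂ] Sec B0 := M.D (latt e) + (Complex.I * ρ) • LinearMap.id with hT
  have hinj : Function.Injective T := by
    rw [← LinearMap.ker_eq_bot, LinearMap.ker_eq_bot']
    intro w hw
    have h1 := norm_symm_add_smul (M.D_symm (latt e)) ρ w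
    have h2 : M.D (latt e) w + (Complex.I * ρ) • w = 0 := hw
    rw [h2, norm_zero] at h1
    have h3 : ρ ^ 2 * ‖w‖ ^ 2 = 0 := by nlinarith [sq_nonneg ‖M.D (latt e) w‖, sq_nonneg (ρ * ‖w‖)]
    simpa [hρ] using h3
  have hsurj : Function.Surjective T := fun v => exists_resolvent M.pot e v M.flux hρ
  exact ⟨(LinearEquiv.ofBijective T ⟨hinj, hsurj⟩).symm, fun _ a =>
    (LinearEquiv.ofBijective T ⟨hinj, hsurj⟩).apply_symm_apply a⟩

/-- The rotation of a lattice vector by a right angle. -/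
def perp (e : ℤ × ℤ) : ℤ × ℤ := (-e.2, e.1)

/-- The squared length of a lattice vector. -/
noncomputable def sqn (e : ℤ × ℤ) : ℝ := (e.1 : ℝ) ^ 2 + (e.2 : ℝ) ^ 2

lemma wedge_perp (e : ℤ × ℤ) : wedge (latt e) (latt (perp e)) = sqn e := by
  simp [wedge, latt, perp, sqn]; ring

lemma sqn_pos {e : ℤ × ℤ} (he : e ≠ 0) : 0 < sqn e := by
  unfold sqn
  by_cases h1 : e.1 = 0
  · have h2 : e.2 ≠ 0 := fun h2 => he (Prod.ext h1 h2)
    positivity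
  · positivity

lemma exists_mul_bound (f : PerFun) (c : ℂ) :
    ∃ C, 0 ≤ C ∧ ∀ a : Sec B0, ‖(c • mul f) a‖ ≤ C * ‖a‖ := by
  obtain ⟨C, hC, h⟩ := f.exists_bound
  refine ⟨‖c‖ * C, by positivity, fun a => ?_⟩
  rw [LinearMap.smul_apply, norm_smul, mul_assoc]
  gcongr
  exact norm_mul_le hC h a

lemma exists_bd (e : ℤ × ℤ) : ∃ C, 0 ≤ C ∧
    (∀ a : Sec B0, ‖((Complex.I * (wedge (latt e) (latt (perp e)) : ℝ)) • mul M.B) a‖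
      ≤ C * ‖a‖) ∧
    (∀ a : Sec B0, ‖((Complex.I * (wedge (latt e) (latt (perp e)) : ℝ)) •
      mul (M.B.der (latt e))) a‖ ≤ C * ‖a‖) ∧
    ∀ a : Sec B0, ‖((Complex.I * (wedge (latt e) (latt (perp e)) : ℝ)) •
      mul (M.B.der (latt (perp e)))) a‖ ≤ C * ‖a‖ := by
  set c := Complex.I * ((wedge (latt e) (latt (perp e)) : ℝ) : ℂ)
  obtain ⟨C₁, h₁, h₁'⟩ := exists_mul_bound (B0 := B0) M.B c
  obtain ⟨C₂, h₂, h₂'⟩ := exists_mul_bound (B0 := B0) (M.B.der (latt e)) c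
  obtain ⟨C₃, h₃, h₃'⟩ := exists_mul_bound (B0 := B0) (M.B.der (latt (perp e))) c
  refine ⟨C₁ + C₂ + C₃, by positivity, fun a => (h₁' a).trans ?_, fun a => (h₂' a).trans ?_,
    fun a => (h₃' a).trans ?_⟩ <;> gcongr <;> linarith

/-- The frame of operators associated to a lattice direction. -/
noncomputable def frame (e : ℤ × ℤ) : Frame (Sec B0) where
  X := M.D (latt e)
  Y := M.D (latt (perp e))
  β := (Complex.I * (wedge (latt e) (latt (perp e)) : ℝ)) • mul M.B
  β₁ := (Complex.I * (wedge (latt e) (latt (perp e)) : ℝ)) • mul (M.B.der (latt e))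
  β₂ := (Complex.I * (wedge (latt e) (latt (perp e)) : ℝ)) • mul (M.B.der (latt (perp e)))
  G ρ := (M.exists_G e ρ).choose
  bd := (M.exists_bd e).choose
  symX := M.D_symm _
  symY := M.D_symm _
  comm := M.D_comm _ _
  commX a := by
    simp only [LinearMap.smul_apply, map_smul, M.D_mul, smul_add]
  commY a := by
    simp only [LinearMap.smul_apply, map_smul, M.D_mul, smul_add]
  bd_nonneg := (M.exists_bd e).choose_spec.1
  norm_β := (M.exists_bd e).choose_spec.2.1
  norm_β₁ := (M.exists_bd e).choose_spec.2.2.1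
  norm_β₂ := (M.exists_bd e).choose_spec.2.2.2
  X_G ρ hρ a := (M.exists_G e ρ).choose_spec hρ a

lemma isMult_char (e k : ℤ × ℤ) : IsMult (M.frame e).X (M.frame e).Y (mul (char k))
    (mul (char k).conj) ((2 * π * dotp (latt k) (latt e) : ℝ) : ℂ)
    ((2 * π * dotp (latt k) (latt (perp e)) : ℝ) : ℂ) where
  adj a b := by rw [inner_mul, conj_conj]
  norm_le a := by simpa using norm_mul_le zero_le_one (fun x => (norm_char k x).le) a
  norm_le' a := by
    simpa using norm_mul_le (f := (char k).conj) zero_le_one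
      (fun x => ((RCLike.norm_conj _).trans (norm_char k x)).le) a
  X_comm a := by
    refine (M.D_mul _ _ _).trans ?_
    congr 1
    ext x
    simp [der_char, mul_assoc]
  Y_comm a := by
    refine (M.D_mul _ _ _).trans ?_
    congr 1
    ext x
    simp [der_char, mul_assoc]
  X_comm' a := by
    rw [sub_eq_add_neg]
    refine (M.D_mul _ _ _).trans ?_
    congr 1
    rw [← neg_smul]
    ext x
    rw [mul_apply, conj_der_char, smul_apply, mul_apply, mul_assoc]
  Y_comm' a := by
    rw [sub_eq_add_neg]
    refine (M.D_mul _ _ _).trans ?_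
    congr 1
    rw [← neg_smul]
    ext x
    rw [mul_apply, conj_der_char, smul_apply, mul_apply, mul_assoc]

lemma quasi_frame {ι : Type*} {s : ι → ℝ} {w r : ι → Sec B0} (e : ℤ × ℤ)
    (h : ∀ i, (s i : ℂ) ^ 4 • M.lap (w i) = w i + r i) :
    (M.frame e).Quasi s (sqn e) w fun i => (sqn e : ℂ) • r i := by
  intro i
  have h1 : M.D (latt e) (M.D (latt e) (w i)) + M.D (latt (perp e)) (M.D (latt (perp e)) (w i)) =
      (sqn e : ℂ) • M.lap (w i) := by
    rw [M.D_apply (latt e), M.D_apply (latt (perp e)), M.D_apply (latt e) (w i),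
      M.D_apply (latt (perp e)) (w i), lap]
    simp only [map_add, map_smul, latt, perp, sqn]
    push_cast
    module
  change (s i : ℂ) ^ 4 • (M.D (latt e) (M.D (latt e) (w i)) +
    M.D (latt (perp e)) (M.D (latt (perp e)) (w i))) = _
  rw [h1, smul_comm, h, smul_add]

lemma frame_cross {e e' : ℤ × ℤ} (h : wedge (latt e) (latt e') ≠ 0) (a : Sec B0) :
    (M.frame e).Y a = ((-(dotp (latt e) (latt e')) / wedge (latt e) (latt e') : ℝ) : ℂ) •
      (M.frame e).X a + ((sqn e / wedge (latt e) (latt e') : ℝ) : ℂ) • (M.frame e').X a := by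
  change M.D (latt (perp e)) a = _ • M.D (latt e) a + _ • M.D (latt e') a
  rw [M.D_apply (latt (perp e)), M.D_apply (latt e), M.D_apply (latt e')]
  obtain ⟨w, hw⟩ : ∃ w : ℂ, w = wedge (latt e) (latt e') := ⟨_, rfl⟩
  have h' : w ≠ 0 := hw ▸ Complex.ofReal_ne_zero.2 h
  have hw' : w = e.1 * e'.2 - e.2 * e'.1 := by rw [hw]; simp [wedge, latt]
  push_cast
  rw [← hw]
  simp only [latt, dotp, sqn, perp]
  match_scalars <;> field_simp <;> rw [hw'] <;> ring

end MagData

section Smoothing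

variable {φ : Pt → ℝ} {F : Pt × Pt → ℂ}

lemma fderiv_partial (hF : ContDiff ℝ 1 F) (x y : Pt) :
    HasFDerivAt (fun x => F (x, y)) ((fderiv ℝ F (x, y)).comp (ContinuousLinearMap.inl ℝ Pt Pt)) x :=
  (hF.differentiable (by norm_num) (x, y)).hasFDerivAt.comp x (hasFDerivAt_prodMk_left x y)

lemma integrable_bump_mul (hφ : Continuous φ) (hc : HasCompactSupport φ) {E : Type*}
    [NormedAddCommGroup E] [NormedSpace ℝ E] {g : Pt → E} (hg : Continuous g) :
    Integrable fun y => φ y • g y :=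
  (hφ.smul hg).integrable_of_hasCompactSupport hc.smul_right

lemma hasFDerivAt_integral_bump (hφ : Continuous φ) (hc : HasCompactSupport φ)
    (hF : ContDiff ℝ 1 F) (x : Pt) :
    HasFDerivAt (fun x => ∫ y, φ y • F (x, y))
      (∫ y, φ y • (fderiv ℝ F (x, y)).comp (ContinuousLinearMap.inl ℝ Pt Pt)) x := by
  have hd : Continuous fun p : Pt × Pt =>
      (fderiv ℝ F p).comp (ContinuousLinearMap.inl ℝ Pt Pt) :=
    (hF.continuous_fderiv (by norm_num)).clm_comp continuous_const
  obtain ⟨C, hC⟩ := ((isCompact_closedBall x 1).prod hc.isCompact).exists_bound_of_continuousOn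
    hd.continuousOn
  refine hasFDerivAt_integral_of_dominated_of_fderiv_le (bound := fun y => ‖φ y‖ * C)
    (Metric.closedBall_mem_nhds x one_pos)
    (Eventually.of_forall fun z => (integrable_bump_mul hφ hc
      (hF.continuous.comp (by fun_prop))).aestronglyMeasurable)
    (integrable_bump_mul hφ hc (hF.continuous.comp (by fun_prop)))
    (integrable_bump_mul hφ hc (hd.comp (by fun_prop))).aestronglyMeasurable
    (Eventually.of_forall fun y z hz => ?_)
    ((hφ.integrable_of_hasCompactSupport hc).norm.mul_const _)
    (Eventually.of_forall fun y z _ => (fderiv_partial hF z y).const_smul _)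
  change ‖φ y • (fderiv ℝ F (z, y)).comp (ContinuousLinearMap.inl ℝ Pt Pt)‖ ≤ _
  by_cases hy : y ∈ tsupport φ
  · exact (norm_smul (φ y) ((fderiv ℝ F (z, y)).comp (ContinuousLinearMap.inl ℝ Pt Pt))).trans_le
      (mul_le_mul_of_nonneg_left (hC (z, y) ⟨hz, hy⟩) (norm_nonneg (φ y)))
  · rw [image_eq_zero_of_notMem_tsupport hy, norm_zero, zero_mul]
    exact (norm_eq_zero.2 (zero_smul ℝ
      ((fderiv ℝ F (z, y)).comp (ContinuousLinearMap.inl ℝ Pt Pt)))).le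

/-- A first order differential operator in the first of two variables. -/
noncomputable def partialOp (v : Pt) (c : Pt → ℂ) (F : Pt × Pt → ℂ) : Pt × Pt → ℂ := fun p =>
  -Complex.I * fderiv ℝ (fun x => F (x, p.2)) p.1 v - c p.1 * F p

lemma partialOp_eq (v : Pt) (c : Pt → ℂ) (hF : ContDiff ℝ 1 F) (p : Pt × Pt) :
    partialOp v c F p = -Complex.I * fderiv ℝ F p (v, 0) - c p.1 * F p := by
  rw [partialOp, (fderiv_partial hF p.1 p.2).fderiv]
  simp

lemma contDiff_partialOp {n : ℕ} (v : Pt) {c : Pt → ℂ} (hc : ContDiff ℝ n c)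
    (hF : ContDiff ℝ (n + 1) F) : ContDiff ℝ n (partialOp v c F) := by
  have h1 : ContDiff ℝ 1 F := hF.of_le (by simp)
  rw [show partialOp v c F = _ from funext fun p => partialOp_eq v c h1 p]
  refine (contDiff_const.mul ?_).sub ((hc.comp contDiff_fst).mul (hF.of_le (by simp)))
  exact (hF.fderiv_right le_rfl).clm_apply contDiff_const

lemma op_integral_bump (hφ : Continuous φ) (hc : HasCompactSupport φ) (v : Pt) (c : Pt → ℂ)
    (hF : ContDiff ℝ 1 F) (x : Pt) :
    -Complex.I * fderiv ℝ (fun x => ∫ y, φ y • F (x, y)) x v - c x * ∫ y, φ y • F (x, y) =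
      ∫ y, φ y • partialOp v c F (x, y) := by
  have hd : Continuous fun y : Pt =>
      (fderiv ℝ F (x, y)).comp (ContinuousLinearMap.inl ℝ Pt Pt) :=
    ((hF.continuous_fderiv (by norm_num)).comp (by fun_prop)).clm_comp continuous_const
  have hF' : Continuous fun y => F (x, y) := hF.continuous.comp (by fun_prop)
  rw [(hasFDerivAt_integral_bump hφ hc hF x).fderiv,
    ContinuousLinearMap.integral_apply (integrable_bump_mul hφ hc hd), ← integral_const_mul,
    ← integral_const_mul, ← integral_sub]
  · refine integral_congr_ae (Eventually.of_forall fun y => ?_)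
    simp only [partialOp_eq v c hF]
    simp [Complex.real_smul]
    ring
  · have := (integrable_bump_mul hφ hc (hd.clm_apply (continuous_const (y := v)))).const_mul
      (-Complex.I)
    exact this
  · exact (integrable_bump_mul hφ hc hF').const_mul _

lemma exists_bump_approx {H : Pt × Pt → ℂ} (hH : Continuous H) {ε : ℝ} (hε : 0 < ε) :
    ∃ r > 0, ∀ φ : ContDiffBump (0 : Pt), φ.rOut ≤ r → ∀ x ∈ fund,
      ‖(∫ y, φ.normed volume y • H (x, y)) - H (x, 0)‖ ≤ ε := by
  have hu := ((isCompact_fund.prod (isCompact_closedBall (0:Pt) 1)).uniformContinuousOn_of_continuous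
    hH.continuousOn)
  obtain ⟨r, hr, h⟩ := Metric.uniformContinuousOn_iff.1 hu ε hε
  refine ⟨min (r / 2) 1, by positivity, fun φ hφ x hx => ?_⟩
  have hcont : Continuous fun y => H (x, y) - H (x, 0) := by fun_prop
  have hi := integrable_bump_mul (φ := φ.normed volume) φ.continuous_normed
    φ.hasCompactSupport_normed (g := fun y => H (x, y)) (by fun_prop)
  have hi0 := integrable_bump_mul (φ := φ.normed volume) φ.continuous_normed
    φ.hasCompactSupport_normed (g := fun _ : Pt => H (x, 0)) (by fun_prop)
  have h0 : H (x, 0) = ∫ y, φ.normed volume y • H (x, 0) := by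
    rw [integral_smul_const, φ.integral_normed, one_smul]
  conv_lhs => rw [h0]
  rw [← integral_sub hi hi0]
  have h1 : ε = ∫ y, φ.normed volume y * ε := by
    rw [integral_mul_const, φ.integral_normed, one_mul]
  rw [h1]
  refine norm_integral_le_of_norm_le (φ.integrable_normed.mul_const _)
    (Eventually.of_forall fun y => ?_)
  rw [← smul_sub, norm_smul, Real.norm_eq_abs, abs_of_nonneg (φ.nonneg_normed y)]
  by_cases hy : y ∈ Metric.ball (0:Pt) φ.rOut
  · refine mul_le_mul_of_nonneg_left ?_ (φ.nonneg_normed y)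
    have hy' : dist y 0 < min (r / 2) 1 := lt_of_lt_of_le hy hφ
    have := h (x, y) ⟨hx, (hy'.trans_le (min_le_right _ _)).le⟩ (x, 0)
      ⟨hx, Metric.mem_closedBall_self zero_le_one⟩ (by
        rw [Prod.dist_eq, dist_self, max_eq_right dist_nonneg]
        exact (hy'.trans_le (min_le_left _ _)).trans (half_lt_self hr))
    rw [dist_eq_norm] at this
    exact this.le
  · have : φ.normed volume y = 0 := by
      rw [← φ.support_normed_eq (μ := volume)] at hy
      exact Function.notMem_support.1 hy
    simp [this]

end Smoothing

section Smoothing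

/-- The twisted translates of a function, as a function of two variables. -/
noncomputable def twist (B0 : ℝ) (u : Pt → ℂ) (p : Pt × Pt) : ℂ :=
  Complex.exp (Complex.I * (-(B0 / 2 * wedge p.2 p.1) : ℝ)) * u (p.1 - p.2)

lemma contDiff_twist_phase (B0 : ℝ) {n : WithTop ℕ∞} : ContDiff ℝ n fun p : Pt × Pt =>
    Complex.exp (Complex.I * (-(B0 / 2 * wedge p.2 p.1) : ℝ)) := by
  have h : ContDiff ℝ n fun p : Pt × Pt => -(B0 / 2 * wedge p.2 p.1) := by
    unfold wedge
    fun_prop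
  exact Complex.contDiff_exp.comp (contDiff_const.mul (Complex.ofRealCLM.contDiff.comp h))

lemma contDiff_twist (B0 : ℝ) {n : WithTop ℕ∞} {u : Pt → ℂ} (hu : ContDiff ℝ n u) :
    ContDiff ℝ n (twist B0 u) :=
  (contDiff_twist_phase B0).mul (hu.comp (contDiff_fst.sub contDiff_snd))

lemma contDiff_smoothing (B0 : ℝ) {u : Pt → ℂ} (hu : Continuous u) (φ : ContDiffBump (0 : Pt)) :
    ContDiff ℝ (⊤ : ℕ∞) fun x => ∫ y, φ.normed volume y • twist B0 u (x, y) := by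
  have h := contDiffOn_convolution_right_with_param_comp (μ := volume) (n := ⊤)
    (ContinuousLinearMap.mul ℝ ℂ) (s := (Set.univ : Set Pt))
    (v := fun x => x) contDiffOn_id (f := u)
    (g := fun p y => φ.normed volume y •
      Complex.exp (Complex.I * (-(B0 / 2 * wedge y p) : ℝ)))
    (k := Metric.closedBall (0:Pt) φ.rOut) isOpen_univ
    (isCompact_closedBall _ _) (fun p x _ hx => by
      have : φ.normed volume x = 0 := by
        by_contra h
        have : x ∈ Function.support (φ.normed volume) := h
        rw [φ.support_normed_eq] at this
        exact hx (Metric.ball_subset_closedBall this)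
      simp [this]) hu.locallyIntegrable
    (ContDiff.contDiffOn ((φ.contDiff_normed.comp contDiff_snd).smul (contDiff_twist_phase B0)))
  rw [contDiffOn_univ] at h
  convert h using 2 with x
  rw [convolution_def, ← integral_sub_left_eq_self _ volume x]
  refine integral_congr_ae (Eventually.of_forall fun t => ?_)
  simp only [twist, ContinuousLinearMap.mul_apply', Complex.real_smul, sub_sub_cancel]
  ring

lemma smoothing_translate {B0 : ℝ} {u : Pt → ℂ} (hu : ∀ (m : ℤ × ℤ) (x : Pt),
      u (x + latt m) = Complex.exp (Complex.I * (B0 / 2 * wedge (latt m) x : ℝ)) * u x)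
    (φ : Pt → ℝ) (m : ℤ × ℤ) (x : Pt) :
    ∫ y, φ y • twist B0 u (x + latt m, y) =
      Complex.exp (Complex.I * (B0 / 2 * wedge (latt m) x : ℝ)) *
        ∫ y, φ y • twist B0 u (x, y) := by
  rw [← integral_const_mul]
  refine integral_congr_ae (Eventually.of_forall fun y => ?_)
  have h : x + latt m - y = x - y + latt m := by abel
  simp only [twist, h, hu, Complex.real_smul]
  have : Complex.exp (Complex.I * (-(B0 / 2 * wedge y (x + latt m)) : ℝ)) *
      Complex.exp (Complex.I * (B0 / 2 * wedge (latt m) (x - y) : ℝ)) =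
      Complex.exp (Complex.I * (B0 / 2 * wedge (latt m) x : ℝ)) *
      Complex.exp (Complex.I * (-(B0 / 2 * wedge y x) : ℝ)) := by
    rw [← Complex.exp_add, ← Complex.exp_add]
    congr 1
    simp [wedge]
    ring
  linear_combination φ y * u (x - y) * this

variable {B0 : ℝ} (M : MagData B0) {α : Pt} {A : Pt → Pt}

lemma lap_apply (hA : ∀ x, M.pot.a x = α + A x) (v : Sec B0) (x : Pt) :
    M.lap v x = magLap α A v x := by
  have h1 : ∀ w : Sec B0, (M.D (1, 0) w).toFun = Dop1 α A w := fun w => funext fun x => by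
    change -Complex.I * fderiv ℝ w x (1, 0) - (dotp (M.pot.a x) (1, 0) : ℝ) * w x = _
    simp [hA, dotp, Dop1, pd1]
  have h2 : ∀ w : Sec B0, (M.D (0, 1) w).toFun = Dop2 α A w := fun w => funext fun x => by
    change -Complex.I * fderiv ℝ w x (0, 1) - (dotp (M.pot.a x) (0, 1) : ℝ) * w x = _
    simp [hA, dotp, Dop2, pd2]
  change (M.D (1, 0) (M.D (1, 0) v)).toFun x + (M.D (0, 1) (M.D (0, 1) v)).toFun x = _
  rw [h1, h1, h2, h2, magLap]

lemma exists_smooth_approx (hA : ∀ x, M.pot.a x = α + A x) {u : Pt → ℂ} (hu : ContDiff ℝ 2 u)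
    (hm : ∀ m : ℤ × ℤ, magTrans B0 m u = u) {ε : ℝ} (hε : 0 < ε) :
    ∃ v : Sec B0, (∀ x ∈ fund, ‖v x - u x‖ ≤ ε) ∧
      ∀ x ∈ fund, ‖M.lap v x - magLap α A u x‖ ≤ ε := by
  have hF : ContDiff ℝ 2 (twist B0 u) := contDiff_twist B0 hu
  set c₁ : Pt → ℂ := fun x => ((α.1 + (A x).1 : ℝ) : ℂ) with hc₁
  set c₂ : Pt → ℂ := fun x => ((α.2 + (A x).2 : ℝ) : ℂ) with hc₂
  have hsm : ∀ n : ℕ, ContDiff ℝ n c₁ ∧ ContDiff ℝ n c₂ := by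
    intro n
    have h := M.pot.smooth.of_le (m := n) (by exact_mod_cast le_top)
    rw [show M.pot.a = fun x => α + A x from funext hA] at h
    exact ⟨Complex.ofRealCLM.contDiff.comp (contDiff_fst.comp h),
      Complex.ofRealCLM.contDiff.comp (contDiff_snd.comp h)⟩
  have hF1 : ContDiff ℝ 1 (partialOp (1, 0) c₁ (twist B0 u)) :=
    contDiff_partialOp (n := 1) _ (hsm 1).1 (by exact_mod_cast hF)
  have hF2 : ContDiff ℝ 1 (partialOp (0, 1) c₂ (twist B0 u)) :=
    contDiff_partialOp (n := 1) _ (hsm 1).2 (by exact_mod_cast hF)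
  have hF11 : Continuous (partialOp (1, 0) c₁ (partialOp (1, 0) c₁ (twist B0 u))) :=
    (contDiff_partialOp (n := 0) _ (hsm 0).1 (by exact_mod_cast hF1)).continuous
  have hF22 : Continuous (partialOp (0, 1) c₂ (partialOp (0, 1) c₂ (twist B0 u))) :=
    (contDiff_partialOp (n := 0) _ (hsm 0).2 (by exact_mod_cast hF2)).continuous
  obtain ⟨r₁, hr₁, h₁⟩ := exists_bump_approx hF.continuous hε
  obtain ⟨r₂, hr₂, h₂⟩ := exists_bump_approx (hF11.add hF22) hε
  have hr : 0 < min r₁ r₂ := lt_min hr₁ hr₂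
  let φ : ContDiffBump (0 : Pt) := ⟨min r₁ r₂ / 2, min r₁ r₂, half_pos hr, half_lt_self hr⟩
  have hφ := φ.continuous_normed (μ := volume)
  have hφc := φ.hasCompactSupport_normed (μ := volume)
  have h0 : (fun x => twist B0 u (x, 0)) = u := funext fun x => by simp [twist, wedge]
  obtain ⟨v, hv⟩ : ∃ v : Sec B0, v.toFun = fun x => ∫ y, φ.normed volume y • twist B0 u (x, y) :=
    ⟨⟨_, contDiff_smoothing B0 hu.continuous φ,
      smoothing_translate (magTrans_eq_iff.1 hm) (φ.normed volume)⟩, rfl⟩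
  refine ⟨v, fun x hx => ?_, fun x hx => ?_⟩
  · have := h₁ φ (min_le_left _ _) x hx
    rwa [congrFun h0 x, ← congrFun hv x] at this
  · have := h₂ φ (min_le_right _ _) x hx
    rw [lap_apply M hA]
    have e1 : Dop1 α A v = fun x => ∫ y, φ.normed volume y • partialOp (1, 0) c₁ (twist B0 u) (x, y) := by
      funext x
      rw [← op_integral_bump hφ hφc (1, 0) c₁ (hF.of_le (by norm_num)), Dop1, pd1, hv]
    have e2 : Dop2 α A v = fun x => ∫ y, φ.normed volume y • partialOp (0, 1) c₂ (twist B0 u) (x, y) := by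
      funext x
      rw [← op_integral_bump hφ hφc (0, 1) c₂ (hF.of_le (by norm_num)), Dop2, pd2, hv]
    have f1 : (fun x => partialOp (1, 0) c₁ (twist B0 u) (x, 0)) = Dop1 α A u := by
      funext x
      simp only [partialOp, h0, congrFun h0 x]
      rfl
    have f2 : (fun x => partialOp (0, 1) c₂ (twist B0 u) (x, 0)) = Dop2 α A u := by
      funext x
      simp only [partialOp, h0, congrFun h0 x]
      rfl
    have e3 : magLap α A v x = ∫ y, φ.normed volume y •
        (partialOp (1, 0) c₁ (partialOp (1, 0) c₁ (twist B0 u)) (x, y) +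
        partialOp (0, 1) c₂ (partialOp (0, 1) c₂ (twist B0 u)) (x, y)) := by
      rw [magLap, e1, e2]
      simp only [smul_add]
      rw [integral_add, ← op_integral_bump hφ hφc (1, 0) c₁ hF1,
        ← op_integral_bump hφ hφc (0, 1) c₂ hF2]
      · rfl
      · exact integrable_bump_mul hφ hφc (hF11.comp (by fun_prop))
      · exact integrable_bump_mul hφ hφc (hF22.comp (by fun_prop))
    have e4 : magLap α A u x = partialOp (1, 0) c₁ (partialOp (1, 0) c₁ (twist B0 u)) (x, 0) +
        partialOp (0, 1) c₂ (partialOp (0, 1) c₂ (twist B0 u)) (x, 0) := by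
      rw [magLap, ← f1, ← f2]
      rfl
    rw [e3, e4]
    exact this

end Smoothing

section Sequence

lemma volume_fund : (volume : Measure Pt).real fund = 1 := by
  rw [fund, ← Set.Icc_prod_Icc, Measure.volume_eq_prod, measureReal_prod_prod]
  simp

lemma integral_fund_const (c : ℝ) : ∫ _ in fund, c = c := by
  rw [setIntegral_const, volume_fund, one_smul]

lemma integral_fund_mono {f g : Pt → ℝ} (hf : Continuous f) (hg : Continuous g)
    (h : ∀ x ∈ fund, f x ≤ g x) : ∫ x in fund, f x ≤ ∫ x in fund, g x :=
  setIntegral_mono_on (hf.continuousOn.integrableOn_compact isCompact_fund)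
    (hg.continuousOn.integrableOn_compact isCompact_fund) measurableSet_fund h

lemma integral_fund_affine {f : Pt → ℝ} (hf : Continuous f) (a b : ℝ) :
    ∫ x in fund, (a * f x + b) = a * (∫ x in fund, f x) + b := by
  rw [integral_add (f := fun x => a * f x) ((continuous_const.mul hf).continuousOn.integrableOn_compact isCompact_fund)
    (continuous_const.continuousOn.integrableOn_compact isCompact_fund), integral_const_mul,
    integral_fund_const]

lemma norm_add_sq_le_two_mul {E : Type*} [SeminormedAddCommGroup E] (a b : E) :
    ‖a + b‖ ^ 2 ≤ 2 * ‖a‖ ^ 2 + 2 * ‖b‖ ^ 2 := by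
  have h := norm_add_le a b
  nlinarith [norm_nonneg (a + b), sq_nonneg (‖a‖ - ‖b‖)]

lemma continuous_proj2 : Continuous proj2 :=
  ((AddCircle.continuous_mk' (1 : ℝ)).comp continuous_fst).prodMk
    ((AddCircle.continuous_mk' (1 : ℝ)).comp continuous_snd)

lemma abs_sq_sub_sq_le {a b ε : ℝ} (ha : 0 ≤ a) (hb : 0 ≤ b) (hε : ε ≤ 1) (h : |a - b| ≤ ε) :
    |a ^ 2 - b ^ 2| ≤ ε * (2 + b ^ 2) := by
  have h0 : 0 ≤ ε := (abs_nonneg _).trans h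
  rw [sq_sub_sq, abs_mul, mul_comm, abs_of_nonneg (add_nonneg ha hb)]
  refine mul_le_mul h ?_ (add_nonneg ha hb) h0
  nlinarith [(abs_le.1 h).2, sq_nonneg (b - 1)]

variable {B0 : ℝ} {α : Pt} {A : Pt → Pt} {u : Pt → ℂ} {v : Sec B0} {ε : ℝ}

lemma continuous_magLap (hA : ContDiff ℝ 1 A) (hu : ContDiff ℝ 2 u) :
    Continuous (magLap α A u) := by
  have h1 : ∀ {n : ℕ} {w : Pt → ℂ} (_ : n ≤ 1), ContDiff ℝ (n + 1) w →
      ContDiff ℝ n (Dop1 α A w) ∧ ContDiff ℝ n (Dop2 α A w) := by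
    intro n w hn hw
    have hA' : ContDiff ℝ n A := hA.of_le (by exact_mod_cast hn)
    have hw' : ContDiff ℝ n w := hw.of_le (by simp)
    have hd := hw.fderiv_right (m := n) le_rfl
    exact ⟨(contDiff_const.mul (hd.clm_apply contDiff_const)).sub
        ((Complex.ofRealCLM.contDiff.comp (contDiff_const.add (contDiff_fst.comp hA'))).mul hw'),
      (contDiff_const.mul (hd.clm_apply contDiff_const)).sub
        ((Complex.ofRealCLM.contDiff.comp (contDiff_const.add (contDiff_snd.comp hA'))).mul hw')⟩
  have h2 := h1 (n := 1) le_rfl (w := u) (by exact_mod_cast hu)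
  exact (h1 (n := 0) zero_le_one (by exact_mod_cast h2.1)).1.continuous.add
    (h1 (n := 0) zero_le_one (by exact_mod_cast h2.2)).2.continuous

lemma tendsto_integral_of_approx {u : ℕ → Pt → ℂ} {v : ℕ → Sec B0} {ε : ℕ → ℝ}
    (hu : ∀ n, Continuous (u n)) (h1 : ∀ n, ∫ x in fund, ‖u n x‖ ^ 2 = 1)
    (hε : ∀ n, ε n ≤ 1) (hε0 : Tendsto ε atTop (𝓝 0))
    (h : ∀ n, ∀ x ∈ fund, ‖v n x - u n x‖ ≤ ε n) {f : T2 → ℂ} (hf : Continuous f) {z : ℂ}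
    (ht : Tendsto (fun n => ∫ x in fund, f (proj2 x) * ((‖u n x‖ ^ 2 : ℝ) : ℂ)) atTop (𝓝 z)) :
    Tendsto (fun n => ∫ x in fund, f (proj2 x) * ((‖v n x‖ ^ 2 : ℝ) : ℂ)) atTop (𝓝 z) := by
  obtain ⟨C, hC⟩ := isCompact_univ.exists_bound_of_continuousOn hf.continuousOn
  have hC0 : 0 ≤ C := (norm_nonneg _).trans (hC 0 trivial)
  have hfp := hf.comp continuous_proj2
  have hi : ∀ w : Pt → ℂ, Continuous w →
      Continuous fun x => f (proj2 x) * ((‖w x‖ ^ 2 : ℝ) : ℂ) := fun w hw =>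
    hfp.mul (Complex.continuous_ofReal.comp (hw.norm.pow 2))
  refine tendsto_of_tendsto_of_dist ht (squeeze_zero (fun _ => dist_nonneg) (fun n => ?_)
    (by simpa using hε0.const_mul (C * 3)))
  rw [dist_eq_norm, ← integral_sub (hi _ (hu n)).integrableOn_fund
    (hi _ (v n).continuous).integrableOn_fund]
  have h2 : ∫ x in fund, (C * ε n * ‖u n x‖ ^ 2 + C * ε n * 2) = C * 3 * ε n := by
    rw [integral_fund_affine (f := fun x => ‖u n x‖ ^ 2) ((hu n).norm.pow 2), h1]
    ring
  rw [← h2]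
  refine (norm_integral_le_integral_norm _).trans (integral_fund_mono
    ((hi _ (hu n)).sub (hi _ (v n).continuous)).norm ((continuous_const.mul
      ((hu n).norm.pow 2)).add continuous_const) fun x hx => ?_)
  rw [← mul_sub, norm_mul, ← Complex.ofReal_sub, Complex.norm_real, Real.norm_eq_abs, abs_sub_comm]
  refine (mul_le_mul (hC _ trivial) (abs_sq_sub_sq_le (norm_nonneg _) (norm_nonneg _) (hε n)
    ((abs_norm_sub_norm_le _ _).trans (h n x hx))) (abs_nonneg _) hC0).trans_eq ?_
  ring

lemma norm_le_two_of_approx (hu : Continuous u) (h1 : ∫ x in fund, ‖u x‖ ^ 2 = 1)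
    (hε : ε ≤ 1) (h : ∀ x ∈ fund, ‖v x - u x‖ ≤ ε) : ‖v‖ ≤ 2 := by
  have h2 : ‖v‖ ^ 2 ≤ ∫ x in fund, (2 * ‖u x‖ ^ 2 + 2) := by
    rw [Sec.norm_sq]
    refine integral_fund_mono (v.continuous.norm.pow 2)
      ((continuous_const.mul (hu.norm.pow 2)).add continuous_const) fun x hx => ?_
    have h3 := norm_add_sq_le_two_mul (u x) (v x - u x)
    rw [add_sub_cancel] at h3
    have h4 : ‖v x - u x‖ ^ 2 ≤ 1 := pow_le_one₀ (norm_nonneg _) ((h x hx).trans hε)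
    linarith
  rw [integral_fund_affine (f := fun x => ‖u x‖ ^ 2) (hu.norm.pow 2), h1] at h2
  nlinarith [norm_nonneg v]

lemma norm_remainder_le (M : MagData B0) (hA : ContDiff ℝ 1 A) (hu : ContDiff ℝ 2 u) {h : ℝ}
    (h0 : 0 ≤ h) (h1 : h ≤ 1) (hv : ∀ x ∈ fund, ‖v x - u x‖ ≤ ε)
    (hl : ∀ x ∈ fund, ‖M.lap v x - magLap α A u x‖ ≤ ε) (hε : 0 ≤ ε) :
    ‖((h ^ 2 : ℝ) : ℂ) • M.lap v - v‖ ≤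
      2 * (∫ x in fund, ‖((h ^ 2 : ℝ) : ℂ) * magLap α A u x - u x‖ ^ 2) ^ ((1 : ℝ) / 2) + 4 * ε := by
  set Q := ∫ x in fund, ‖((h ^ 2 : ℝ) : ℂ) * magLap α A u x - u x‖ ^ 2
  have hQ : 0 ≤ Q := integral_nonneg fun _ => by positivity
  have hc : Continuous fun x => ‖((h ^ 2 : ℝ) : ℂ) * magLap α A u x - u x‖ ^ 2 :=
    ((continuous_const.mul (continuous_magLap hA hu)).sub hu.continuous).norm.pow 2
  have h2 : ‖((h ^ 2 : ℝ) : ℂ) • M.lap v - v‖ ^ 2 ≤ ∫ x in fund,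
      (2 * ‖((h ^ 2 : ℝ) : ℂ) * magLap α A u x - u x‖ ^ 2 + 8 * ε ^ 2) := by
    rw [Sec.norm_sq]
    refine integral_fund_mono ((Sec.continuous _).norm.pow 2)
      ((continuous_const.mul hc).add continuous_const) fun x hx => ?_
    rw [Sec.sub_apply, Sec.smul_apply]
    have h3 := norm_add_sq_le_two_mul (((h ^ 2 : ℝ) : ℂ) * magLap α A u x - u x)
      (((h ^ 2 : ℝ) : ℂ) * (M.lap v x - magLap α A u x) - (v x - u x))
    have h4 : ‖((h ^ 2 : ℝ) : ℂ) * (M.lap v x - magLap α A u x) - (v x - u x)‖ ≤ 2 * ε := by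
      refine (norm_sub_le _ _).trans ?_
      rw [norm_mul, Complex.norm_real, Real.norm_of_nonneg (by positivity)]
      have := mul_le_mul (pow_le_one₀ h0 h1 : h ^ 2 ≤ 1) (hl x hx) (norm_nonneg _) zero_le_one
      linarith [hv x hx]
    have h5 := pow_le_pow_left₀ (norm_nonneg _) h4 2
    have h6 : ((h ^ 2 : ℝ) : ℂ) * M.lap v x - v x = ((h ^ 2 : ℝ) : ℂ) * magLap α A u x - u x +
      (((h ^ 2 : ℝ) : ℂ) * (M.lap v x - magLap α A u x) - (v x - u x)) := by ring
    rw [h6]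
    linarith
  rw [integral_fund_affine hc] at h2
  rw [← Real.sqrt_eq_rpow]
  have h7 := Real.sq_sqrt hQ
  have h8 := Real.sqrt_nonneg Q
  refine abs_le_of_sq_le_sq' ?_ (by positivity) |>.2
  nlinarith [mul_nonneg h8 hε]

lemma exists_quasimodes (M : MagData B0) (hA : ∀ x, M.pot.a x = α + A x) {ν : Measure T2}
    (hν : IsQuantumLimit B0 α A ν) :
    ∃ (s δ : ℕ → ℝ) (v r : ℕ → Sec B0), Tendsto s atTop (𝓝 0) ∧ Tendsto δ atTop (𝓝 0) ∧
      Sz s 0 v ∧ Sz s 3 r ∧ (∀ n, (s n : ℂ) ^ 4 • M.lap (v n) = v n + (δ n : ℂ) • r n) ∧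
      ∀ f : T2 → ℂ, Continuous f →
        Tendsto (fun n => ∫ x in fund, f (proj2 x) * ((‖v n x‖ ^ 2 : ℝ) : ℂ)) atTop
          (𝓝 (∫ p, f p ∂ν)) := by
  obtain ⟨-, h, u, hpos, hlim, hsm, hm, h1, ho, hf⟩ := hν
  obtain ⟨N, hN⟩ := eventually_atTop.1 (hlim.eventually_le_const (zero_lt_one' ℝ))
  have hA1 : ContDiff ℝ 1 A := by
    have e : A = fun x => M.pot.a x - α := funext fun x => by simp [hA]
    rw [e]
    exact (M.pot.smooth.of_le (by exact_mod_cast le_top)).sub contDiff_const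
  have hsh : Tendsto (fun n => n + N) atTop atTop := tendsto_add_atTop_nat N
  choose v hv hl using fun n => exists_smooth_approx M hA (hsm (n + N)) (hm (n + N))
    (pow_pos (hpos (n + N)) 2)
  have hh1 : ∀ n, h (n + N) ≤ 1 := fun n => hN _ (Nat.le_add_left _ _)
  set s : ℕ → ℝ := fun n => √(h (n + N)) with hs
  have hs0 : ∀ n, 0 < s n := fun n => Real.sqrt_pos.2 (hpos _)
  have hs2 : ∀ n, s n ^ 2 = h (n + N) := fun n => Real.sq_sqrt (hpos _).le
  have hs4 : ∀ n, s n ^ 4 = h (n + N) ^ 2 := fun n => by rw [← hs2]; ring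
  have hslim : Tendsto s atTop (𝓝 0) := by
    simpa [hs, Function.comp_def] using (Real.continuous_sqrt.tendsto 0).comp (hlim.comp hsh)
  have hss : ∀ n, 0 < s n ∧ s n ≤ 1 := fun n => ⟨hs0 n, Real.sqrt_le_one.2 (hh1 n)⟩
  set Rm : ℕ → Sec B0 := fun n => ((h (n + N) ^ 2 : ℝ) : ℂ) • M.lap (v n) - v n with hRm
  set δ : ℕ → ℝ := fun n => ‖Rm n‖ / s n ^ 3 + s n with hδ
  have hδ0 : ∀ n, 0 < δ n := fun n => add_pos_of_nonneg_of_pos (by have := hs0 n; positivity) (hs0 n)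
  refine ⟨s, δ, v, fun n => ((δ n)⁻¹ : ℂ) • Rm n, hslim, ?_, ⟨hss, 2, by norm_num, fun n => ?_⟩,
    ⟨hss, 1, zero_le_one, fun n => ?_⟩, fun n => ?_, fun f hfc => ?_⟩
  · have ho' := (ho.comp_tendsto hsh).tendsto_div_nhds_zero
    have hz : Tendsto (fun n => 2 * ((∫ x in fund, ‖((h (n + N) ^ 2 : ℝ) : ℂ) *
        magLap α A (u (n + N)) x - u (n + N) x‖ ^ 2) ^ ((1 : ℝ) / 2) /
        h (n + N) ^ ((3 : ℝ) / 2)) + 4 * s n + s n) atTop (𝓝 0) := by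
      simpa using ((ho'.const_mul 2).add (hslim.const_mul 4)).add hslim
    refine squeeze_zero (fun n => (hδ0 n).le) (fun n => ?_) hz
    have e : h (n + N) ^ ((3 : ℝ) / 2) = s n ^ 3 := by
      change _ = √(h (n + N)) ^ 3
      rw [Real.sqrt_eq_rpow, ← Real.rpow_natCast, ← Real.rpow_mul (hpos _).le]
      norm_num
    rw [e]
    refine add_le_add_left ?_ _
    rw [div_le_iff₀ (pow_pos (hs0 n) 3)]
    refine (norm_remainder_le M hA1 (hsm _) (hpos _).le (hh1 n) (hv n) (hl n)
      (by positivity)).trans_eq ?_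
    rw [← hs4]
    have := (hs0 n).ne'
    field_simp
  · simpa using norm_le_two_of_approx (hsm _).continuous (h1 _)
      (pow_le_one₀ (hpos _).le (hh1 n)) (hv n)
  · rw [norm_smul, norm_inv, Complex.norm_real, Real.norm_of_nonneg (hδ0 n).le, one_mul,
      inv_mul_le_iff₀ (hδ0 n)]
    have h3 : ‖Rm n‖ / s n ^ 3 ≤ δ n := le_add_of_nonneg_right (hs0 n).le
    rw [div_le_iff₀ (pow_pos (hs0 n) 3)] at h3
    exact_mod_cast h3
  · rw [smul_smul, mul_inv_cancel₀ (by exact_mod_cast (hδ0 n).ne'), one_smul, hRm]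
    simp only [← hs4]
    push_cast
    abel
  · exact tendsto_integral_of_approx (fun n => (hsm (n + N)).continuous) (fun n => h1 _)
      (fun n => pow_le_one₀ (hpos _).le (hh1 n)) (by simpa using (hlim.comp hsh).pow 2) hv hfc
      ((hf f hfc).comp hsh)

end Sequence

section Torus

/-- The characters of the torus. -/
noncomputable def charT (k : ℤ × ℤ) : C(T2, ℂ) :=
  ⟨fun p => fourier k.1 p.1 * fourier k.2 p.2, by fun_prop⟩

lemma charT_proj2 (k : ℤ × ℤ) (x : Pt) : charT k (proj2 x) = PerFun.char k x := by
  change fourier k.1 (x.1 : UnitAddCircle) * fourier k.2 (x.2 : UnitAddCircle) = _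
  rw [fourier_coe_apply, fourier_coe_apply, PerFun.char_apply, ← Complex.exp_add]
  congr 1
  simp [dotp, latt]
  ring

lemma charT_add (k : ℤ × ℤ) (p q : T2) : charT k (p + q) = charT k p * charT k q := by
  simp [charT, AddCircle.toCircle_add]
  ring

lemma proj2_surjective : Function.Surjective proj2 := fun p => by
  obtain ⟨x, hx⟩ := QuotientAddGroup.mk_surjective p.1
  obtain ⟨y, hy⟩ := QuotientAddGroup.mk_surjective p.2
  exact ⟨(x, y), Prod.ext hx hy⟩

lemma proj2_add (x y : Pt) : proj2 (x + y) = proj2 x + proj2 y := rfl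

lemma exists_latt_of_proj2_eq {x y : Pt} (h : proj2 x = proj2 y) :
    ∃ m : ℤ × ℤ, y = x + latt m := by
  have h0 : ∀ {a b : ℝ}, (a : UnitAddCircle) = b → ∃ n : ℤ, b = a + n := fun {a b} hab => by
    have h1 : ((b - a : ℝ) : UnitAddCircle) = 0 := by rw [AddCircle.coe_sub, hab, sub_self]
    obtain ⟨n, hn⟩ := (AddCircle.coe_eq_zero_iff 1).1 h1
    exact ⟨n, by rw [zsmul_one] at hn; linarith⟩
  obtain ⟨m, hm⟩ := h0 (congrArg Prod.fst h)
  obtain ⟨n, hn⟩ := h0 (congrArg Prod.snd h)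
  exact ⟨(m, n), Prod.ext hm hn⟩

lemma tendsto_of_tendsto_charT {ι : Type*} {l : Filter ι} (Φ : ι → C(T2, ℂ) →ₗ[ℂ] ℂ) {C : ℝ}
    (hC0 : 0 ≤ C) (hC : ∀ i f, ‖Φ i f‖ ≤ C * ‖f‖)
    (h : ∀ k, Tendsto (fun i => Φ i (charT k)) l (𝓝 0)) (f : C(T2, ℂ)) :
    Tendsto (fun i => Φ i f) l (𝓝 0) := by
  let φ : C(T2, UnitAddTorus (Fin 2)) := ⟨_, Homeomorph.finTwoArrow.symm.continuous⟩
  let S : Submodule ℂ C(UnitAddTorus (Fin 2), ℂ) :=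
    { carrier := {g | Tendsto (fun i => Φ i (g.comp φ)) l (𝓝 0)}
      zero_mem' := by
        change Tendsto (fun i => Φ i 0) l (𝓝 0)
        simpa using tendsto_const_nhds
      add_mem' := fun {a b} ha hb => by
        change Tendsto (fun i => Φ i (a.comp φ + b.comp φ)) l (𝓝 0)
        simpa using Tendsto.add ha hb
      smul_mem' := fun c a ha => by
        change Tendsto (fun i => Φ i (c • a.comp φ)) l (𝓝 0)
        simpa using Tendsto.const_mul c ha }
  have hS : IsClosed (S : Set C(UnitAddTorus (Fin 2), ℂ)) := by
    refine isClosed_of_closure_subset fun g hg => Metric.tendsto_nhds.2 fun ε hε => ?_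
    obtain ⟨g', hg', hd⟩ := Metric.mem_closure_iff.1 hg (ε / 2 / (C + 1)) (by positivity)
    filter_upwards [Metric.tendsto_nhds.1 hg' (ε / 2) (half_pos hε)] with i hi
    rw [dist_zero_right] at hi ⊢
    have h1 : Φ i (g.comp φ) = Φ i (g.comp φ - g'.comp φ) + Φ i (g'.comp φ) := by simp
    have h2 : ‖g.comp φ - g'.comp φ‖ ≤ ε / 2 / (C + 1) := by
      refine (ContinuousMap.norm_le _ (by positivity)).2 fun x => ?_
      exact ((g - g').norm_coe_le_norm (φ x)).trans (dist_eq_norm g g' ▸ hd.le)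
    have h3 : C * (ε / 2 / (C + 1)) ≤ ε / 2 := by
      rw [← mul_div_assoc, div_le_iff₀ (by positivity)]
      nlinarith
    rw [h1]
    have h4 := (hC i (g.comp φ - g'.comp φ)).trans (mul_le_mul_of_nonneg_left h2 hC0)
    linarith [norm_add_le (Φ i (g.comp φ - g'.comp φ)) (Φ i (g'.comp φ))]
  have hle : Submodule.span ℂ (Set.range (UnitAddTorus.mFourier (d := Fin 2))) ≤ S := by
    rw [Submodule.span_le]
    rintro _ ⟨n, rfl⟩
    have : (UnitAddTorus.mFourier n).comp φ = charT (n 0, n 1) := by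
      ext p
      exact Fin.prod_univ_two fun i => fourier (n i) (φ p i)
    change Tendsto (fun i => Φ i ((UnitAddTorus.mFourier n).comp φ)) l (𝓝 0)
    rw [this]
    exact h _
  have hmem : f.comp ⟨_, Homeomorph.finTwoArrow.continuous⟩ ∈ S := by
    refine (Submodule.topologicalClosure_minimal _ hle hS) ?_
    rw [UnitAddTorus.span_mFourier_closure_eq_top]
    trivial
  have hf : (f.comp ⟨_, Homeomorph.finTwoArrow.continuous⟩).comp φ = f := by
    ext p
    rfl
  change Tendsto (fun i => Φ i ((f.comp ⟨_, Homeomorph.finTwoArrow.continuous⟩).comp φ)) l (𝓝 0)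
    at hmem
  rwa [hf] at hmem

lemma integrable_of_continuous {E : Type*} [NormedAddCommGroup E] {f : T2 → E} (hf : Continuous f)
    (μ : Measure T2) [IsFiniteMeasure μ] : Integrable f μ :=
  hf.integrable_of_hasCompactSupport (HasCompactSupport.of_compactSpace f)

lemma ext_of_integral_continuous {μ ν : Measure T2} [IsFiniteMeasure μ] [IsFiniteMeasure ν]
    (h : ∀ f : C(T2, ℂ), ∫ p, f p ∂μ = ∫ p, f p ∂ν) : μ = ν := by
  refine ext_of_forall_integral_eq_of_IsFiniteMeasure fun f => ?_
  have := h ⟨fun p => (f p : ℂ), Complex.continuous_ofReal.comp f.continuous⟩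
  simp only [ContinuousMap.coe_mk, integral_complex_ofReal] at this
  exact_mod_cast this

lemma ext_of_integral_charT {μ ν : Measure T2} [IsFiniteMeasure μ] [IsFiniteMeasure ν]
    (h : ∀ k, ∫ p, charT k p ∂μ = ∫ p, charT k p ∂ν) : μ = ν := by
  have hi : ∀ (f : C(T2, ℂ)) (ξ : Measure T2) [IsFiniteMeasure ξ], Integrable f ξ := fun f ξ _ =>
    integrable_of_continuous f.continuous ξ
  let Φ : C(T2, ℂ) →ₗ[ℂ] ℂ :=
    { toFun := fun f => ∫ p, f p ∂μ - ∫ p, f p ∂ν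
      map_add' := fun f g => by
        simp only [ContinuousMap.add_apply]
        rw [integral_add (hi f μ) (hi g μ), integral_add (hi f ν) (hi g ν)]
        ring
      map_smul' := fun c f => by
        simp only [ContinuousMap.smul_apply, integral_smul, RingHom.id_apply, smul_sub] }
  refine ext_of_integral_continuous fun f => sub_eq_zero.1 ?_
  have hb : ∀ (_ : Unit) (f : C(T2, ℂ)), ‖Φ f‖ ≤ (μ.real Set.univ + ν.real Set.univ) * ‖f‖ := by
    intro _ f
    refine (norm_sub_le _ _).trans ?_
    have := norm_integral_le_of_norm_le_const (μ := μ) (Eventually.of_forall f.norm_coe_le_norm)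
    have := norm_integral_le_of_norm_le_const (μ := ν) (Eventually.of_forall f.norm_coe_le_norm)
    linarith
  exact tendsto_nhds_unique tendsto_const_nhds (tendsto_of_tendsto_charT (l := pure ())
    (fun _ : Unit => Φ) (by positivity) hb
    (fun k => by simp only [Φ, LinearMap.coe_mk, AddHom.coe_mk, h k, sub_self]; exact tendsto_const_nhds) f)

lemma exists_charT_ne_one {k : ℤ × ℤ} (hk : k ≠ 0) : ∃ p, charT k p ≠ 1 := by
  have h1 := MagData.sqn_pos hk
  refine ⟨proj2 ((k.1 : ℝ) / (2 * MagData.sqn k), (k.2 : ℝ) / (2 * MagData.sqn k)), ?_⟩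
  rw [charT_proj2, PerFun.char_apply]
  have h2 : 2 * π * dotp (latt k) ((k.1 : ℝ) / (2 * MagData.sqn k), (k.2 : ℝ) / (2 * MagData.sqn k))
      = π := by
    have : dotp (latt k) ((k.1 : ℝ) / (2 * MagData.sqn k), (k.2 : ℝ) / (2 * MagData.sqn k)) =
      MagData.sqn k / (2 * MagData.sqn k) := by simp [dotp, latt, MagData.sqn]; ring
    rw [this]
    field_simp
  rw [h2, mul_comm, Complex.exp_pi_mul_I]
  norm_num

lemma integral_charT_volume {k : ℤ × ℤ} (hk : k ≠ 0) : ∫ p, charT k p = 0 := by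
  obtain ⟨c, hc⟩ := exists_charT_ne_one hk
  have : (volume : Measure T2).IsAddLeftInvariant :=
    inferInstanceAs ((volume : Measure UnitAddCircle).prod volume).IsAddLeftInvariant
  have h := integral_add_right_eq_self (μ := (volume : Measure T2)) (fun p => charT k p) c
  simp only [charT_add, integral_mul_const] at h
  have h2 : (∫ p, charT k p) * (charT k c - 1) = 0 := by rw [mul_sub, h]; ring
  exact (mul_eq_zero.1 h2).resolve_right (sub_ne_zero.2 hc)

lemma eq_smul_volume {κ : Measure T2} [IsFiniteMeasure κ]
    (h : ∀ k : ℤ × ℤ, k ≠ 0 → ∫ p, charT k p ∂κ = 0) : κ = κ Set.univ • volume := by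
  have : IsFiniteMeasure (κ Set.univ • (volume : Measure T2)) :=
    Measure.smul_finite _ (measure_ne_top κ _)
  refine ext_of_integral_charT fun k => ?_
  rw [integral_smul_measure]
  by_cases hk : k = 0
  · have h0 : ∀ p, charT 0 p = 1 := fun p => by simp [charT]
    have h1 : (volume : Measure T2) Set.univ = 1 := by
      rw [Measure.volume_eq_prod, ← Set.univ_prod_univ, Measure.prod_prod]
      simp [AddCircle.measure_univ]
    simp [hk, h0, Measure.real, h1]
  · rw [h k hk, integral_charT_volume hk, smul_zero]

lemma exists_continuous_lift {E : Type*} [TopologicalSpace E] {g : Pt → E} (hg : Continuous g)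
    (hp : IsPeriodic g) : ∃ f : C(T2, E), ∀ x, f (proj2 x) = g x := by
  have hq : IsOpenQuotientMap (⟨proj2, continuous_proj2⟩ : C(Pt, T2)) :=
    QuotientAddGroup.isOpenQuotientMap_mk.prodMap QuotientAddGroup.isOpenQuotientMap_mk
  have hg' : Function.FactorsThrough (⟨g, hg⟩ : C(Pt, E)) (⟨proj2, continuous_proj2⟩ : C(Pt, T2)) :=
    fun x y hxy => by
      obtain ⟨m, rfl⟩ := exists_latt_of_proj2_eq hxy
      exact (hp.add_latt m x).symm
  exact ⟨hq.isQuotientMap.lift ⟨g, hg⟩ hg', fun x =>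
    DFunLike.congr_fun (hq.isQuotientMap.lift_comp ⟨g, hg⟩ hg') x⟩

lemma exists_limit_measure {ι : Type*} (W : Ultrafilter ι) (Ψ : ι → C(T2, ℝ) →ₗ[ℝ] ℝ)
    (hpos : ∀ i f, (∀ p, 0 ≤ f p) → 0 ≤ Ψ i f) {C : ℝ} (hC : ∀ i f, |Ψ i f| ≤ C * ‖f‖) :
    ∃ σ : Measure T2, IsFiniteMeasure σ ∧
      ∀ f : C(T2, ℝ), Tendsto (fun i => Ψ i f) W (𝓝 (∫ p, f p ∂σ)) := by
  have hlim : ∀ f : C(T2, ℝ), ∃ L, Tendsto (fun i => Ψ i f) W (𝓝 L) := fun f => by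
    obtain ⟨L, -, hL⟩ := (isCompact_Icc : IsCompact (Set.Icc (-(C * ‖f‖)) (C * ‖f‖))).ultrafilter_le_nhds
      (W.map fun i => Ψ i f) (by
        rw [le_principal_iff]
        exact Eventually.of_forall (f := (W : Filter ι)) fun i => abs_le.1 (hC i f))
    exact ⟨L, hL⟩
  choose L hL using hlim
  let Λ : CompactlySupportedContinuousMap T2 ℝ →ₚ[ℝ] ℝ := PositiveLinearMap.mk₀
    { toFun := fun f => L (f : C(T2, ℝ))
      map_add' := fun f g => tendsto_nhds_unique (hL _)
        (((hL (f : C(T2, ℝ))).add (hL (g : C(T2, ℝ)))).congr fun i => (map_add (Ψ i) _ _).symm)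
      map_smul' := fun c f => tendsto_nhds_unique (hL _)
        (((hL (f : C(T2, ℝ))).const_mul c).congr fun i => (map_smul (Ψ i) c _).symm) }
    fun f hf => ge_of_tendsto' (hL _) fun i => hpos i _ hf
  refine ⟨RealRMK.rieszMeasure Λ, inferInstance, fun f => ?_⟩
  have := RealRMK.integral_rieszMeasure Λ (CompactlySupportedContinuousMap.continuousMapEquiv f)
  have h2 : ∫ p, f p ∂(RealRMK.rieszMeasure Λ) = L f := this
  rw [h2]
  exact hL f

end Torus

section Pairing

open Sec PerFun

variable {B0 : ℝ}

lemma integrableOn_pairing (f : C(T2, ℂ)) (a b : Sec B0) :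
    IntegrableOn (fun x => (starRingEnd ℂ) (a x) * (f (proj2 x) * b x)) fund := by
  refine Continuous.integrableOn_fund ?_
  exact (Complex.continuous_conj.comp a.continuous).mul
    ((f.continuous.comp continuous_proj2).mul b.continuous)

/-- The sesquilinear form `∫ f ā b` on sections. -/
noncomputable def pairing (f : C(T2, ℂ)) : Sec B0 →ₗ⋆[ℂ] Sec B0 →ₗ[ℂ] ℂ :=
  LinearMap.mk₂'ₛₗ (starRingEnd ℂ) (RingHom.id ℂ)
    (fun a b => ∫ x in fund, (starRingEnd ℂ) (a x) * (f (proj2 x) * b x))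
    (fun a a' b => by
      rw [← integral_add (integrableOn_pairing f a b) (integrableOn_pairing f a' b)]
      congr 1 with x
      simp only [Sec.add_apply, map_add]
      ring)
    (fun c a b => by
      rw [smul_eq_mul, ← integral_const_mul]
      congr 1 with x
      simp only [Sec.smul_apply, map_mul]
      ring)
    (fun a b b' => by
      rw [← integral_add (integrableOn_pairing f a b) (integrableOn_pairing f a b')]
      congr 1 with x
      simp only [Sec.add_apply]
      ring)
    (fun c a b => by
      rw [smul_eq_mul, ← integral_const_mul]
      congr 1 with x
      simp only [Sec.smul_apply, RingHom.id_apply]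
      ring)

lemma pairing_apply (f : C(T2, ℂ)) (a b : Sec B0) :
    pairing f a b = ∫ x in fund, (starRingEnd ℂ) (a x) * (f (proj2 x) * b x) := rfl

lemma pairing_eq_inner {f : C(T2, ℂ)} {g : PerFun} (h : ∀ x, f (proj2 x) = g x) (a b : Sec B0) :
    pairing f a b = inner ℂ a (mul g b) := by
  rw [pairing_apply, Sec.inner_def]
  congr 1 with x
  rw [h, mul_apply]

lemma pairing_self (f : C(T2, ℂ)) (a : Sec B0) :
    pairing f a a = ∫ x in fund, f (proj2 x) * ((‖a x‖ ^ 2 : ℝ) : ℂ) := by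
  rw [pairing_apply]
  congr 1 with x
  rw [mul_left_comm, ← Complex.normSq_eq_conj_mul_self, Complex.normSq_eq_norm_sq]

/-- The pairing as a functional of the test function. -/
noncomputable def pairingFun (a b : Sec B0) : C(T2, ℂ) →ₗ[ℂ] ℂ where
  toFun f := pairing f a b
  map_add' f g := by
    simp only [pairing_apply]
    rw [← integral_add (integrableOn_pairing f a b) (integrableOn_pairing g a b)]
    congr 1 with x
    simp only [ContinuousMap.add_apply]
    ring
  map_smul' c f := by
    simp only [pairing_apply, RingHom.id_apply]
    rw [smul_eq_mul, ← integral_const_mul]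
    congr 1 with x
    simp only [ContinuousMap.smul_apply, smul_eq_mul]
    ring

lemma norm_pairing_le (f : C(T2, ℂ)) (a b : Sec B0) :
    ‖pairing f a b‖ ≤ ‖f‖ * (‖a‖ ^ 2 + ‖b‖ ^ 2) := by
  have ha : IntegrableOn (fun x => ‖a x‖ ^ 2) fund :=
    (a.continuous.norm.pow 2).continuousOn.integrableOn_compact isCompact_fund
  have hb : IntegrableOn (fun x => ‖b x‖ ^ 2) fund :=
    (b.continuous.norm.pow 2).continuousOn.integrableOn_compact isCompact_fund
  rw [pairing_apply, Sec.norm_sq, Sec.norm_sq, ← integral_add ha hb, ← integral_const_mul]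
  refine norm_integral_le_of_norm_le ((ha.add hb).const_mul _) (ae_of_all _ fun x => ?_)
  rw [norm_mul, norm_mul, RCLike.norm_conj]
  have h1 := f.norm_coe_le_norm (proj2 x)
  calc ‖a x‖ * (‖f (proj2 x)‖ * ‖b x‖) ≤ ‖a x‖ * (‖f‖ * ‖b x‖) := by gcongr
    _ ≤ _ := by
      have := norm_nonneg f
      nlinarith [mul_nonneg this (sq_nonneg (‖a x‖ - ‖b x‖)), mul_nonneg this (sq_nonneg ‖a x‖),
        mul_nonneg this (sq_nonneg ‖b x‖)]

/-- Bounded sequences of sections have densities converging to a finite measure along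
ultrafilters. -/
lemma exists_limit_density {ι : Type*} (W : Ultrafilter ι) (a : ι → Sec B0) {C : ℝ}
    (hC : ∀ i, ‖a i‖ ≤ C) : ∃ σ : Measure T2, IsFiniteMeasure σ ∧
      ∀ f : C(T2, ℂ), Tendsto (fun i => pairing f (a i) (a i)) W (𝓝 (∫ p, f p ∂σ)) := by
  have hfa : ∀ i (f : C(T2, ℝ)), IntegrableOn (fun x => f (proj2 x) * ‖a i x‖ ^ 2) fund :=
    fun i f => ((f.continuous.comp continuous_proj2).mul
      ((a i).continuous.norm.pow 2)).continuousOn.integrableOn_compact isCompact_fund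
  let Ψ : ι → C(T2, ℝ) →ₗ[ℝ] ℝ := fun i =>
    { toFun := fun f => ∫ x in fund, f (proj2 x) * ‖a i x‖ ^ 2
      map_add' := fun f g => by
        rw [← integral_add (hfa i f) (hfa i g)]
        congr 1 with x
        simp only [ContinuousMap.add_apply]
        ring
      map_smul' := fun c f => by
        rw [smul_eq_mul, ← integral_const_mul]
        congr 1 with x
        simp only [ContinuousMap.smul_apply, smul_eq_mul, RingHom.id_apply]
        ring }
  have hΨ : ∀ i f, Ψ i f = ∫ x in fund, f (proj2 x) * ‖a i x‖ ^ 2 := fun _ _ => rfl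
  obtain ⟨σ, hσ, hlim⟩ := exists_limit_measure W Ψ (C := C ^ 2)
    (fun i f hf => integral_nonneg fun x => mul_nonneg (hf _) (sq_nonneg _)) fun i f => by
      have hi : IntegrableOn (fun x => ‖a i x‖ ^ 2) fund :=
        ((a i).continuous.norm.pow 2).continuousOn.integrableOn_compact isCompact_fund
      have h1 : ‖Ψ i f‖ ≤ ∫ x in fund, ‖f‖ * ‖a i x‖ ^ 2 := by
        refine norm_integral_le_of_norm_le (hi.const_mul _) (ae_of_all _ fun x => ?_)
        rw [norm_mul, norm_pow, norm_norm]
        gcongr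
        exact f.norm_coe_le_norm _
      rw [integral_const_mul, ← Sec.norm_sq] at h1
      refine h1.trans ?_
      rw [mul_comm]
      gcongr
      exact hC i
  refine ⟨σ, hσ, fun f => ?_⟩
  let fre : C(T2, ℝ) := ⟨fun p => (f p).re, Complex.continuous_re.comp f.continuous⟩
  let fim : C(T2, ℝ) := ⟨fun p => (f p).im, Complex.continuous_im.comp f.continuous⟩
  have h1 : ∫ p, f p ∂σ = ((∫ p, fre p ∂σ : ℝ) : ℂ) + ((∫ p, fim p ∂σ : ℝ) : ℂ) * Complex.I :=
    (integral_re_add_im (𝕜 := ℂ) (integrable_of_continuous f.continuous σ)).symm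
  have h2 : ∀ i, pairing f (a i) (a i) = ((Ψ i fre : ℝ) : ℂ) + ((Ψ i fim : ℝ) : ℂ) * Complex.I := by
    intro i
    have hi : IntegrableOn (fun x => f (proj2 x) * ((‖a i x‖ ^ 2 : ℝ) : ℂ)) fund :=
      Continuous.integrableOn_fund ((f.continuous.comp continuous_proj2).mul
        (Complex.continuous_ofReal.comp ((a i).continuous.norm.pow 2)))
    rw [pairing_self, ← integral_re_add_im (𝕜 := ℂ) hi]
    simp only [RCLike.re_eq_complex_re, RCLike.im_eq_complex_im, Complex.re_mul_ofReal,
      Complex.im_mul_ofReal]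
    rfl
  rw [h1]
  refine (((Complex.continuous_ofReal.tendsto _).comp (hlim fre)).add
    (((Complex.continuous_ofReal.tendsto _).comp (hlim fim)).mul_const Complex.I)).congr
    fun i => (h2 i).symm

end Pairing

lemma tendsto_curry_of_forall {g : ℕ × ℕ → ℂ} {l : Filter ℂ}
    (h : ∀ j, Tendsto (fun n => g (j, n)) atTop l) :
    Tendsto g ((atTop : Filter ℕ).curry atTop) l :=
  Tendsto.curry (f := fun j n => g (j, n)) (Eventually.of_forall h)

namespace MagData

open Sec PerFun

variable {B0 : ℝ} (M : MagData B0) {s δ : ℕ → ℝ} {v r : ℕ → Sec B0}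

/-- The part of `v` with bounded momentum (at scale `(j + 1) / s n`) in direction `e`. -/
noncomputable def part (s : ℕ → ℝ) (v : ℕ → Sec B0) (e : ℤ × ℤ) (p : ℕ × ℕ) : Sec B0 :=
  (M.frame e).K (((p.1 : ℝ) + 1) / s p.2) (v p.2)

lemma norm_part_le (hv : Sz s 0 v) (e : ℤ × ℤ) (p : ℕ × ℕ) :
    ‖M.part s v e p‖ ≤ ‖v p.2‖ :=
  (M.frame e).norm_K (Frame.div_ne (by positivity) hv.1 _) _

lemma conj_char (k : ℤ × ℤ) : (char k).conj = char (-k) := by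
  refine Subtype.ext (funext fun x => ?_)
  change (starRingEnd ℂ) (char k x) = char (-k) x
  rw [char_apply, char_apply, ← Complex.exp_conj]
  congr 1
  simp [latt, dotp, map_ofNat]
  ring

lemma pairing_charT (k : ℤ × ℤ) (a b : Sec B0) :
    pairing (charT k) a b = inner ℂ a (mul (char k) b) := pairing_eq_inner (charT_proj2 k) a b

lemma exists_norm_le (hv : Sz s 0 v) : ∃ C, 0 ≤ C ∧ ∀ n, ‖v n‖ ≤ C := by
  obtain ⟨-, C, hC, h⟩ := hv
  exact ⟨C, hC, fun n => by simpa using h n⟩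

lemma tendsto_part_average (hs : Tendsto s atTop (𝓝 0)) (hv : Sz s 0 v) (e : ℤ × ℤ)
    (f : C(T2, ℂ)) :
    Tendsto (fun p : ℕ × ℕ => 2⁻¹ * (pairing f (v p.2) (M.part s v e p) +
      pairing f (M.part s v e p) (v p.2)) - pairing f (M.part s v e p) (M.part s v e p))
      ((atTop : Filter ℕ).curry atTop) (𝓝 0) := by
  obtain ⟨C, hC, hvC⟩ := exists_norm_le hv
  refine tendsto_of_tendsto_charT (fun p => (2⁻¹ : ℂ) • (pairingFun (v p.2) (M.part s v e p) +
      pairingFun (M.part s v e p) (v p.2)) - pairingFun (M.part s v e p) (M.part s v e p))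
      (C := 4 * C ^ 2) (by positivity) (fun p f => ?_) (fun k => ?_) f
  · change ‖2⁻¹ * (pairing f (v p.2) (M.part s v e p) + pairing f (M.part s v e p) (v p.2)) -
      pairing f (M.part s v e p) (M.part s v e p)‖ ≤ _
    have h1 := norm_pairing_le f (v p.2) (M.part s v e p)
    have h2 := norm_pairing_le f (M.part s v e p) (v p.2)
    have h3 := norm_pairing_le f (M.part s v e p) (M.part s v e p)
    have h4 : ‖v p.2‖ ^ 2 ≤ C ^ 2 := by gcongr; exact hvC _
    have h5 : ‖M.part s v e p‖ ^ 2 ≤ C ^ 2 := by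
      gcongr; exact (M.norm_part_le hv e p).trans (hvC _)
    have h6 : ‖f‖ * (‖v p.2‖ ^ 2 + ‖M.part s v e p‖ ^ 2) ≤ ‖f‖ * (C ^ 2 + C ^ 2) := by gcongr
    have h7 : ‖f‖ * (‖M.part s v e p‖ ^ 2 + ‖M.part s v e p‖ ^ 2) ≤ ‖f‖ * (C ^ 2 + C ^ 2) := by
      gcongr
    refine (norm_sub_le _ _).trans ?_
    rw [norm_mul]
    have h8 := norm_add_le (pairing f (v p.2) (M.part s v e p))
      (pairing f (M.part s v e p) (v p.2))
    norm_num
    linarith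
  · refine tendsto_curry_of_forall fun j => ?_
    refine ((((M.frame e).mult_average (M.isMult_char e k) (R := (j : ℝ) + 1) (by positivity)
      hv).tendsto hs)).congr fun n => ?_
    simp only [LinearMap.sub_apply, LinearMap.smul_apply, LinearMap.add_apply]
    change _ = 2⁻¹ * (pairing (charT k) _ _ + pairing (charT k) _ _) - pairing (charT k) _ _
    simp only [pairing_charT]
    rfl

lemma tendsto_part_cross (hs : Tendsto s atTop (𝓝 0)) (hv : Sz s 0 v) (hr : Sz s 3 r)
    (hq : ∀ n, (s n : ℂ) ^ 4 • M.lap (v n) = v n + r n) {e e' : ℤ × ℤ}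
    (he : wedge (latt e) (latt e') ≠ 0) (f : C(T2, ℂ)) :
    Tendsto (fun p => pairing f (M.part s v e' p) (M.part s v e p))
      ((atTop : Filter ℕ).curry atTop) (𝓝 0) := by
  obtain ⟨C, hC, hvC⟩ := exists_norm_le hv
  have h0 : e ≠ 0 := fun h => he (by simp [h, wedge, latt])
  have h0' : e' ≠ 0 := fun h => he (by simp [h, wedge, latt])
  refine tendsto_of_tendsto_charT (fun p => pairingFun (M.part s v e' p) (M.part s v e p))
      (C := C ^ 2 + C ^ 2) (by positivity) (fun p f => ?_) (fun k => ?_) f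
  · refine (norm_pairing_le f (M.part s v e' p) (M.part s v e p)).trans ?_
    rw [mul_comm]
    gcongr
    · exact (M.norm_part_le hv e' p).trans (hvC _)
    · exact (M.norm_part_le hv e p).trans (hvC _)
  · refine tendsto_curry_of_forall fun j => ?_
    have hj : (j : ℝ) + 1 ≠ 0 := by positivity
    have hq1 := M.quasi_frame e hq
    have hq2 := M.quasi_frame e' hq
    obtain ⟨h1, h2, h3, r', h4, h5⟩ := (M.frame e).quasi_K hj hv (hr.const_smul _) hq1
    obtain ⟨h1', h2', h3', -⟩ := (M.frame e').quasi_K hj hv (hr.const_smul _) hq2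
    obtain ⟨Cγ, -, hγ⟩ := exists_mul_bound (B0 := B0) M.B
      (Complex.I * (wedge (latt e') (latt (perp e)) : ℝ))
    have he' : wedge (latt e') (latt e) ≠ 0 := fun h => he (by
      rw [← neg_eq_zero, ← h]; simp only [wedge]; ring)
    have hX : Sz s (-2) fun n => (M.frame e).X ((M.frame e').K (((j : ℝ) + 1) / s n) (v n)) := by
      have hc : ((sqn e' / wedge (latt e') (latt e) : ℝ) : ℂ) ≠ 0 :=
        Complex.ofReal_ne_zero.2 (div_ne_zero (sqn_pos h0').ne' he')
      refine ((h3'.sub ((h2'.mono (by norm_num)).const_smul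
        ((-(dotp (latt e') (latt e)) / wedge (latt e') (latt e) : ℝ) : ℂ))).const_smul
        (((sqn e' / wedge (latt e') (latt e) : ℝ) : ℂ)⁻¹)).congr fun n => ?_
      rw [M.frame_cross he', add_sub_cancel_left, inv_smul_smul₀ hc]
    have hY : Sz s (-2) fun n => (M.frame e).Y ((M.frame e').K (((j : ℝ) + 1) / s n) (v n)) :=
      ((hX.const_smul _).add ((h2'.mono (by norm_num)).const_smul _)).congr fun n =>
        M.frame_cross he _
    have key := ((M.frame e).inner_cross_small (M.isMult_char e k) (X' := (M.frame e').X)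
      (M.frame e').symX (M.D_comm _ _) hγ (M.frame_cross he) (M.isMult_char e' k).X_comm'
      h1 h2 h3 h4 h5 h1' h2' hX hY).tendsto hs
    have hs0 : (sqn e : ℂ) ≠ 0 := Complex.ofReal_ne_zero.2 (sqn_pos h0).ne'
    have key' := key.const_mul ((sqn e : ℂ)⁻¹)
    rw [mul_zero] at key'
    refine key'.congr fun n => ?_
    rw [inv_mul_cancel_left₀ hs0]
    exact (pairing_charT _ _ _).symm

lemma tendsto_part_perp (hs : Tendsto s atTop (𝓝 0)) (hv : Sz s 0 v) (hr : Sz s 3 r)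
    (hq : ∀ n, (s n : ℂ) ^ 4 • M.lap (v n) = v n + r n) {e k : ℤ × ℤ}
    (he : e ≠ 0) (hk : dotp (latt k) (latt (perp e)) ≠ 0) :
    Tendsto (fun p => pairing (charT k) (M.part s v e p) (M.part s v e p))
      ((atTop : Filter ℕ).curry atTop) (𝓝 0) := by
  refine tendsto_curry_of_forall fun j => ?_
  have hj : (j : ℝ) + 1 ≠ 0 := by positivity
  obtain ⟨h1, h2, h3, r', h4, h5⟩ :=
    (M.frame e).quasi_K hj hv (hr.const_smul _) (M.quasi_frame e hq)
  have key := ((M.frame e).inner_mult_small (M.isMult_char e k) h1 h2 h3 h4 h5).tendsto hs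
  have hc : 2 * ((2 * π * dotp (latt k) (latt (perp e)) : ℝ) : ℂ) * (sqn e : ℂ) ≠ 0 := by
    have := (sqn_pos he).ne'
    have := Real.pi_ne_zero
    norm_cast
    positivity
  have key' := key.const_mul (2 * ((2 * π * dotp (latt k) (latt (perp e)) : ℝ) : ℂ) * (sqn e : ℂ))⁻¹
  rw [mul_zero] at key'
  refine key'.congr fun n => ?_
  rw [inv_mul_cancel_left₀ hc]
  exact (pairing_charT _ _ _).symm

lemma sz_smul_of_tendsto (hδ : Tendsto δ atTop (𝓝 0)) (hr : Sz s 3 r) :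
    Sz s 3 fun n => (δ n : ℂ) • r n := by
  obtain ⟨C, hC⟩ := (Metric.isBounded_range_of_tendsto δ hδ).exists_norm_le
  refine hr.of_le C fun n => ?_
  rw [norm_smul, Complex.norm_real]
  gcongr
  exact hC _ ⟨n, rfl⟩

lemma quasi_frame_smul (hq : ∀ n, (s n : ℂ) ^ 4 • M.lap (v n) = v n + (δ n : ℂ) • r n)
    (e : ℤ × ℤ) : (M.frame e).Quasi s (sqn e) v fun n => (δ n : ℂ) • (sqn e : ℂ) • r n := by
  intro n
  rw [M.quasi_frame e hq n]
  exact congrArg _ (smul_comm _ _ _)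

lemma tendsto_part_away_aux (hs : Tendsto s atTop (𝓝 0)) (hδ : Tendsto δ atTop (𝓝 0))
    (hv : Sz s 0 v) (hr : Sz s 3 r)
    (hq : ∀ n, (s n : ℂ) ^ 4 • M.lap (v n) = v n + (δ n : ℂ) • r n) {e k : ℤ × ℤ}
    (hk : dotp (latt k) (latt e) ≠ 0) (hk' : dotp (latt k) (latt (perp e)) = 0) :
    Tendsto (fun p => pairing (charT k) (v p.2) (v p.2 - M.part s v e p))
      ((atTop : Filter ℕ).curry atTop) (𝓝 0) := by
  have hY := ((M.frame e).quasi_bound hv ((sz_smul_of_tendsto hδ hr).const_smul _)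
    (M.quasi_frame e hq)).2
  have hE := M.isMult_char e k
  rw [hk', mul_zero, Complex.ofReal_zero] at hE
  obtain ⟨C, h⟩ := (M.frame e).mult_away hE hs hδ hv hY (hr.const_smul _)
    (M.quasi_frame_smul hq e)
  set c : ℂ := 2 * ((2 * π * dotp (latt k) (latt e) : ℝ) : ℂ) with hc
  have hc0 : c ≠ 0 := by
    have := Real.pi_ne_zero
    rw [hc]
    norm_cast
    positivity
  have hlim : Tendsto (fun j : ℕ => |C| / ((j : ℝ) + 1) ^ 2) atTop (𝓝 0) := by
    refine tendsto_const_nhds.div_atTop ?_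
    exact (tendsto_pow_atTop two_ne_zero).comp
      (tendsto_atTop_add_const_right _ _ tendsto_natCast_atTop_atTop)
  rw [Metric.tendsto_nhds]
  intro ε hε
  rw [eventually_curry_iff]
  have hcε : 0 < ‖c‖ * ε := mul_pos (norm_pos_iff.2 hc0) hε
  filter_upwards [Metric.tendsto_nhds.1 hlim _ (half_pos hcε)] with j hj
  obtain ⟨ζ, hζ, hle⟩ := h ((j : ℝ) + 1) (by positivity)
  filter_upwards [Metric.tendsto_nhds.1 hζ _ (half_pos hcε)] with n hn
  have h1 := hle n
  rw [norm_mul] at h1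
  rw [dist_zero_right] at hn hj ⊢
  rw [Real.norm_of_nonneg (by positivity)] at hj
  rw [pairing_charT]
  change ‖c‖ * ‖inner ℂ (v n) (mul (char k) (v n - M.part s v e (j, n)))‖ ≤ _ at h1
  have h2 : C / ((j : ℝ) + 1) ^ 2 ≤ |C| / ((j : ℝ) + 1) ^ 2 := by
    gcongr
    exact le_abs_self C
  exact lt_of_mul_lt_mul_left (by linarith) (norm_nonneg c)

lemma conj_pairing_charT (k : ℤ × ℤ) (a b : Sec B0) :
    (starRingEnd ℂ) (pairing (charT (-k)) a b) = pairing (charT k) b a := by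
  rw [pairing_charT, pairing_charT, inner_conj_symm, inner_mul, conj_char, neg_neg]

lemma tendsto_part_away (hs : Tendsto s atTop (𝓝 0)) (hδ : Tendsto δ atTop (𝓝 0))
    (hv : Sz s 0 v) (hr : Sz s 3 r)
    (hq : ∀ n, (s n : ℂ) ^ 4 • M.lap (v n) = v n + (δ n : ℂ) • r n) {e k : ℤ × ℤ}
    (hk : dotp (latt k) (latt e) ≠ 0) (hk' : dotp (latt k) (latt (perp e)) = 0) :
    Tendsto (fun p => pairing (charT k) (M.part s v e p) (M.part s v e p) -
      pairing (charT k) (v p.2) (v p.2)) ((atTop : Filter ℕ).curry atTop) (𝓝 0) := by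
  have hneg : ∀ w : Pt, dotp (latt (-k)) w = -dotp (latt k) w := fun w => by
    simp [dotp, latt]; ring
  have h1 := M.tendsto_part_away_aux hs hδ hv hr hq hk hk'
  have h2 := (Complex.continuous_conj.tendsto _).comp
    (M.tendsto_part_away_aux hs hδ hv hr hq (e := e) (k := -k) (by rwa [hneg, neg_ne_zero])
    (by rw [hneg, hk', neg_zero]))
  have h3 := M.tendsto_part_average hs hv e (charT k)
  have h4 := (h3.add ((h1.add h2).const_mul (2⁻¹ : ℂ))).neg
  simp only [map_zero, add_zero, mul_zero, neg_zero] at h4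
  refine h4.congr fun p => ?_
  simp only [Function.comp_apply, conj_pairing_charT, map_sub]
  ring

lemma tendsto_part_field (hs : Tendsto s atTop (𝓝 0)) (hδ : Tendsto δ atTop (𝓝 0))
    (hv : Sz s 0 v) (hr : Sz s 3 r)
    (hq : ∀ n, (s n : ℂ) ^ 4 • M.lap (v n) = v n + (δ n : ℂ) • r n) {e : ℤ × ℤ} (he : e ≠ 0)
    {f : C(T2, ℂ)} (hf : ∀ x, f (proj2 x) = M.B x) (hB : ∀ x, (starRingEnd ℂ) (M.B x) = M.B x) :
    Tendsto (fun p => pairing f (M.part s v e p) (M.part s v e p))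
      ((atTop : Filter ℕ).curry atTop) (𝓝 0) := by
  obtain ⟨hX, hY⟩ := (M.frame e).quasi_bound hv ((sz_smul_of_tendsto hδ hr).const_smul _)
    (M.quasi_frame e hq)
  have hE : (sqn e : ℝ) ≠ 0 := (sqn_pos he).ne'
  have hconj : M.B.conj = M.B := Subtype.ext (funext hB)
  have h1 : Tendsto (fun p => pairing f (v p.2) (M.part s v e p))
      ((atTop : Filter ℕ).curry atTop) (𝓝 0) := by
    refine tendsto_curry_of_forall fun j => ?_
    have h := ((M.frame e).tendsto_β_K hs hδ hE hv hX hY (hr.const_smul _)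
      (M.quasi_frame_smul hq e) (R := (j : ℝ) + 1) (by positivity)).const_mul
      (Complex.I * (wedge (latt e) (latt (perp e)) : ℝ))⁻¹
    rw [mul_zero] at h
    refine h.congr fun n => ?_
    change _ * inner ℂ (v n) ((Complex.I * (wedge (latt e) (latt (perp e)) : ℝ)) •
      mul M.B (M.part s v e (j, n))) = _
    rw [inner_smul_right, wedge_perp, inv_mul_cancel_left₀, pairing_eq_inner hf]
    exact mul_ne_zero Complex.I_ne_zero (Complex.ofReal_ne_zero.2 hE)
  have h2 := (Complex.continuous_conj.tendsto _).comp h1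
  have h3 := M.tendsto_part_average hs hv e f
  have h4 := (((h1.add h2).const_mul (2⁻¹ : ℂ))).sub h3
  simp only [map_zero, add_zero, mul_zero, sub_zero] at h4
  refine h4.congr fun p => ?_
  have h5 : (starRingEnd ℂ) (pairing f (v p.2) (M.part s v e p)) =
      pairing f (M.part s v e p) (v p.2) := by
    rw [pairing_eq_inner hf, pairing_eq_inner hf, inner_conj_symm, inner_mul, hconj]
  simp only [Function.comp_apply, h5]
  ring

end MagData

namespace MagData

open Sec PerFun

variable {B0 : ℝ} (M : MagData B0) {s δ : ℕ → ℝ} {v r : ℕ → Sec B0}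

lemma exists_limit_parts (hs : Tendsto s atTop (𝓝 0)) (hδ : Tendsto δ atTop (𝓝 0))
    (hv : Sz s 0 v) (hr : Sz s 3 r)
    (hq : ∀ n, (s n : ℂ) ^ 4 • M.lap (v n) = v n + (δ n : ℂ) • r n)
    (hB : ∀ x, (starRingEnd ℂ) (M.B x) = M.B x) (ν : Measure T2) [IsFiniteMeasure ν]
    (hν : ∀ f : C(T2, ℂ), Tendsto (fun n => pairing f (v n) (v n)) atTop (𝓝 (∫ p, f p ∂ν))) :
    ∃ σ : ℤ × ℤ → Measure T2, (∀ e, IsFiniteMeasure (σ e)) ∧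
      (∀ F : Finset (ℤ × ℤ), (∀ e ∈ F, ∀ e' ∈ F, e ≠ e' → wedge (latt e) (latt e') ≠ 0) →
        ∑ e ∈ F, σ e ≤ ν) ∧
      (∀ e k, e ≠ 0 → dotp (latt k) (latt (perp e)) ≠ 0 → ∫ p, charT k p ∂σ e = 0) ∧
      (∀ e k, dotp (latt k) (latt e) ≠ 0 → dotp (latt k) (latt (perp e)) = 0 →
        ∫ p, charT k p ∂σ e = ∫ p, charT k p ∂ν) ∧
      ∀ e, e ≠ 0 → ∀ f : C(T2, ℂ), (∀ x, f (proj2 x) = M.B x) → ∫ p, f p ∂σ e = 0 := by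
  obtain ⟨C, hC, hvC⟩ := exists_norm_le hv
  have hne : ((atTop : Filter ℕ).curry (atTop : Filter ℕ)).NeBot := by
    refine ⟨fun h => ?_⟩
    have h' : ∀ᶠ _ in (atTop : Filter ℕ).curry (atTop : Filter ℕ), False := by simp [h]
    rw [eventually_curry_iff] at h'
    simp at h'
    obtain ⟨a, h'⟩ := h'
    obtain ⟨b, h'⟩ := h' a le_rfl
    exact lt_irrefl b (h' b)
  let W : Ultrafilter (ℕ × ℕ) := Ultrafilter.of ((atTop : Filter ℕ).curry atTop)
  have hW : (W : Filter (ℕ × ℕ)) ≤ (atTop : Filter ℕ).curry atTop := Ultrafilter.of_le _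
  have hνW : ∀ f : C(T2, ℂ), Tendsto (fun p : ℕ × ℕ => pairing f (v p.2) (v p.2)) W
      (𝓝 (∫ p, f p ∂ν)) := fun f =>
    (tendsto_curry_of_forall (g := fun p => pairing f (v p.2) (v p.2)) fun _ => hν f).mono_left hW
  choose σ hσ hσlim using fun e => exists_limit_density W (M.part s v e)
    fun p => (M.norm_part_le hv e p).trans (hvC _)
  refine ⟨σ, hσ, fun F hF => ?_, fun e k he hk => ?_, fun e k hk hk' => ?_, fun e he f hf => ?_⟩
  · obtain ⟨κ, hκ, hlim⟩ := exists_limit_density W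
      (fun p => v p.2 - ∑ e ∈ F, M.part s v e p) (C := C + ∑ e ∈ F, C) fun p =>
        (norm_sub_le _ _).trans (add_le_add (hvC _) ((norm_sum_le _ _).trans
          (Finset.sum_le_sum fun e _ => (M.norm_part_le hv e p).trans (hvC _))))
    have hrs := sz_smul_of_tendsto hδ hr
    have key : κ + ∑ e ∈ F, σ e = ν := by
      have : IsFiniteMeasure (∑ e ∈ F, σ e) := inferInstance
      refine ext_of_integral_continuous fun f => ?_
      rw [integral_add_measure (integrable_of_continuous f.continuous _)
        (integrable_of_continuous f.continuous _),
        integral_finsetSum_measure fun e _ => integrable_of_continuous f.continuous _]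
      have h1 := (hlim f).add (tendsto_finsetSum F fun e _ => hσlim e f)
      have h2 := tendsto_finsetSum F fun e _ =>
        ((M.tendsto_part_average hs hv e f).mono_left hW).const_mul 2
      have h3 := tendsto_finsetSum F fun e he => tendsto_finsetSum (F.erase e) fun e' he' =>
        (M.tendsto_part_cross hs hv hrs hq (hF e' (Finset.mem_of_mem_erase he') e he
          (Finset.ne_of_mem_erase he')) f).mono_left hW
      have h4 := (h1.add h2).sub h3
      simp only [mul_zero, Finset.sum_const_zero, add_zero, sub_zero] at h4
      refine tendsto_nhds_unique h4 ((hνW f).congr fun p => ?_)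
      have h5 : ∀ e ∈ F, ∑ e' ∈ F.erase e, pairing f (M.part s v e p) (M.part s v e' p) =
          ∑ e' ∈ F, pairing f (M.part s v e p) (M.part s v e' p) -
          pairing f (M.part s v e p) (M.part s v e p) := fun e he => by
        rw [← Finset.sum_erase_add _ _ he, add_sub_cancel_right]
      rw [Finset.sum_congr rfl h5]
      simp only [map_sub, map_sum, LinearMap.sub_apply, LinearMap.sum_apply,
        Finset.sum_sub_distrib, Finset.sum_add_distrib, ← Finset.mul_sum]
      rw [Finset.sum_comm]
      ring
    rw [← key]
    exact Measure.le_add_left le_rfl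
  · exact tendsto_nhds_unique (hσlim e (charT k))
      ((M.tendsto_part_perp hs hv (sz_smul_of_tendsto hδ hr) hq he hk).mono_left hW)
  · have h := ((M.tendsto_part_away hs hδ hv hr hq hk hk').mono_left hW).add (hνW (charT k))
    simp only [sub_add_cancel, zero_add] at h
    exact tendsto_nhds_unique (hσlim e (charT k)) h
  · exact tendsto_nhds_unique (hσlim e f)
      ((M.tendsto_part_field hs hδ hv hr hq he hf hB).mono_left hW)

end MagData

section Invariance

open MagData

lemma dotp_unitPerp (k e : ℤ × ℤ) (t : ℝ) : dotp (latt k) (t • unitPerp e) =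
    t * (dotp (latt k) (latt (perp e)) / Real.sqrt ((e.1 : ℝ) ^ 2 + (e.2 : ℝ) ^ 2)) := by
  simp [dotp, latt, unitPerp, perp]
  ring

lemma unitPerp_sq {e : ℤ × ℤ} (he : e ≠ 0) : (unitPerp e).1 ^ 2 + (unitPerp e).2 ^ 2 = 1 := by
  have h : 0 < (e.1 : ℝ) ^ 2 + (e.2 : ℝ) ^ 2 := sqn_pos he
  simp only [unitPerp, div_pow, Real.sq_sqrt h.le]
  field_simp
  ring

lemma map_translate_eq {σ : Measure T2} [IsFiniteMeasure σ] {e : ℤ × ℤ}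
    (h : ∀ k, dotp (latt k) (latt (perp e)) ≠ 0 → ∫ p, charT k p ∂σ = 0) (t : ℝ) :
    Measure.map (fun p => p + proj2 (t • unitPerp e)) σ = σ := by
  refine ext_of_integral_charT fun k => ?_
  rw [integral_map (by fun_prop) (charT k).continuous.aestronglyMeasurable]
  simp only [charT_add, integral_mul_const]
  by_cases hk : dotp (latt k) (latt (perp e)) = 0
  · rw [charT_proj2, PerFun.char_apply, dotp_unitPerp, hk]
    simp
  · rw [h k hk, zero_mul]

lemma measure_compl_Zset {B : Pt → ℝ} {Binf : Pt → Pt → ℝ} {e : ℤ × ℤ} (he : e ≠ 0)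
    (hBinf : ∀ x θ : Pt, Tendsto (fun T : ℝ => (1 / T) * ∫ t in (0:ℝ)..T, B (x + t • θ))
      atTop (𝓝 (Binf x θ)))
    (hBinfnn : ∀ x θ : Pt, θ.1 ^ 2 + θ.2 ^ 2 = 1 → 0 ≤ Binf x θ)
    {f : C(T2, ℝ)} (hf : ∀ x, f (proj2 x) = B x) {σ : Measure T2} [IsFiniteMeasure σ]
    (hσ : ∀ t : ℝ, Measure.map (fun p => p + proj2 (t • unitPerp e)) σ = σ)
    (h0 : ∫ p, f p ∂σ = 0) : σ (Zset Binf e)ᶜ = 0 := by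
  set θ := unitPerp e with hθ
  have hcont : Continuous fun q : T2 × ℝ => f (q.1 + proj2 (q.2 • θ)) := by
    refine f.continuous.comp (continuous_fst.add (continuous_proj2.comp ?_))
    fun_prop
  let F : ℕ → T2 → ℝ := fun n p => (1 / (n : ℝ)) * ∫ t in (0:ℝ)..n, f (p + proj2 (t • θ))
  have hFc : ∀ n, Continuous (F n) := fun n =>
    (intervalIntegral.continuous_parametric_intervalIntegral_of_continuous'
      (f := fun p t => f (p + proj2 (t • θ))) hcont 0 n).const_mul _
  have hF0 : ∀ n, ∫ p, F n p ∂σ = 0 := fun n => by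
    simp only [F, integral_const_mul]
    simp only [intervalIntegral.integral_of_le (Nat.cast_nonneg n)]
    rw [integral_integral_swap]
    · have h1 : ∀ t : ℝ, ∫ p, f (p + proj2 (t • θ)) ∂σ = 0 := fun t => by
        rw [← h0]
        conv_rhs => rw [← hσ t]
        rw [integral_map (by fun_prop) f.continuous.aestronglyMeasurable]
      simp [h1]
    · exact Integrable.of_bound hcont.aestronglyMeasurable ‖f‖
        (ae_of_all _ fun q => f.norm_coe_le_norm _)
  have hFb : ∀ n p, ‖F n p‖ ≤ ‖f‖ := fun n p => by
    have h1 : ‖∫ t in (0:ℝ)..n, f (p + proj2 (t • θ))‖ ≤ ‖f‖ * |(n : ℝ) - 0| :=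
      intervalIntegral.norm_integral_le_of_norm_le_const fun t _ => f.norm_coe_le_norm _
    rw [sub_zero, Nat.abs_cast] at h1
    simp only [F, norm_mul, norm_div, norm_one, Real.norm_natCast]
    rcases n.eq_zero_or_pos with rfl | hn
    · simp
    · have : (0 : ℝ) < n := by exact_mod_cast hn
      rw [div_mul_eq_mul_div, one_mul, div_le_iff₀ this]
      exact h1
  have hlim : ∀ y, Tendsto (fun n => F n (proj2 y)) atTop (𝓝 (Binf y θ)) := fun y => by
    refine ((hBinf y θ).comp tendsto_natCast_atTop_atTop).congr fun n => ?_
    simp only [F, ← proj2_add, hf, Function.comp_apply]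
  let b : T2 → ℝ := fun p => Binf (Function.surjInv proj2_surjective p) θ
  have hb : ∀ p, Tendsto (fun n => F n p) atTop (𝓝 (b p)) := fun p => by
    have h := hlim (Function.surjInv proj2_surjective p)
    rwa [Function.surjInv_eq proj2_surjective p] at h
  have hbm : AEStronglyMeasurable b σ := aestronglyMeasurable_of_tendsto_ae atTop
    (fun n => (hFc n).aestronglyMeasurable) (ae_of_all _ hb)
  have hbi : Integrable b σ := Integrable.of_bound hbm ‖f‖ (ae_of_all _ fun p =>
    le_of_tendsto (hb p).norm (Eventually.of_forall fun n => hFb n p))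
  have hb0 : ∫ p, b p ∂σ = 0 := by
    refine tendsto_nhds_unique (tendsto_integral_of_dominated_convergence (fun _ => ‖f‖)
      (fun n => (hFc n).aestronglyMeasurable) (integrable_const _)
      (fun n => ae_of_all _ (hFb n)) (ae_of_all _ hb)) ?_
    simp only [hF0]
    exact tendsto_const_nhds
  have hae : b =ᵐ[σ] 0 := (integral_eq_zero_iff_of_nonneg
    (fun p => hBinfnn _ _ (unitPerp_sq he)) hbi).1 hb0
  refine measure_mono_null (t := {p | ¬b p = 0}) (fun p hp hbp => hp fun y hy => ?_)
    (ae_iff.1 hae)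
  have h := hlim y
  rw [hy] at h
  exact (tendsto_nhds_unique h (hb p)).trans hbp

end Invariance

section Decomposition

open MagData

/-- Representatives of the primitive lattice vectors up to sign. -/
def Canonical (e : ℤ × ℤ) : Prop := Int.gcd e.1 e.2 = 1 ∧ (0 < e.1 ∨ e.1 = 0 ∧ 0 < e.2)

lemma Canonical.ne_zero {e : ℤ × ℤ} (h : Canonical e) : e ≠ 0 := by
  rintro rfl
  simp [Canonical] at h

lemma Canonical.wedge_ne_zero {e e' : ℤ × ℤ} (h : Canonical e) (h' : Canonical e') (hne : e ≠ e') :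
    wedge (latt e) (latt e') ≠ 0 := by
  intro h0
  have h1 : e.1 * e'.2 = e.2 * e'.1 := by
    simp only [wedge, latt] at h0
    exact_mod_cast sub_eq_zero.1 h0
  obtain ⟨hg, hs⟩ := h
  obtain ⟨hg', hs'⟩ := h'
  have d1 : e.1 ∣ e'.1 := Int.dvd_of_dvd_mul_right_of_gcd_one ⟨_, h1.symm⟩ hg
  have d2 : e'.1 ∣ e.1 := Int.dvd_of_dvd_mul_right_of_gcd_one
    ⟨e.2, by rw [mul_comm, h1, mul_comm]⟩ hg'
  have d3 : e.2 ∣ e'.2 := Int.dvd_of_dvd_mul_right_of_gcd_one ⟨_, h1⟩ (by rwa [Int.gcd_comm])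
  have d4 : e'.2 ∣ e.2 := Int.dvd_of_dvd_mul_right_of_gcd_one
    ⟨e.1, by rw [mul_comm, ← h1, mul_comm]⟩ (by rwa [Int.gcd_comm])
  have e1 : e.1 = e'.1 := Int.dvd_antisymm (by omega) (by omega) d1 d2
  refine hne (Prod.ext e1 ?_)
  rcases eq_or_ne e.1 0 with h2 | h2
  · exact Int.dvd_antisymm (by omega) (by omega) d3 d4
  · rw [← e1, mul_comm e.2] at h1
    exact (mul_left_cancel₀ h2 h1).symm

lemma exists_canonical {k : ℤ × ℤ} (hk : k ≠ 0) :
    ∃ (j : ℤ) (e : ℤ × ℤ), j ≠ 0 ∧ Canonical e ∧ k = (j * e.1, j * e.2) := by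
  have hg : 0 < Int.gcd k.1 k.2 := Nat.pos_of_ne_zero fun h => hk (by
    rw [Int.gcd_eq_zero_iff] at h; exact Prod.ext h.1 h.2)
  obtain ⟨a, b, hab, ha, hb⟩ := Int.exists_gcd_one hg
  have hg' : ((Int.gcd k.1 k.2 : ℕ) : ℤ) ≠ 0 := by exact_mod_cast hg.ne'
  by_cases hc : 0 < a ∨ a = 0 ∧ 0 < b
  · exact ⟨_, (a, b), hg', ⟨hab, hc⟩, Prod.ext (by simpa [mul_comm] using ha)
      (by simpa [mul_comm] using hb)⟩
  · refine ⟨_, (-a, -b), neg_ne_zero.2 hg', ⟨by simpa using hab, ?_⟩,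
      Prod.ext (by simpa [mul_comm] using ha) (by simpa [mul_comm] using hb)⟩
    have : ¬(a = 0 ∧ b = 0) := by rintro ⟨rfl, rfl⟩; simp at hab
    simp only
    omega

lemma exists_decomposition {ν : Measure T2} [IsProbabilityMeasure ν] {σ : ℤ × ℤ → Measure T2}
    (hsum : ∀ F : Finset (ℤ × ℤ), (∀ e ∈ F, ∀ e' ∈ F, e ≠ e' → wedge (latt e) (latt e') ≠ 0) →
        ∑ e ∈ F, σ e ≤ ν)
    (hperp : ∀ e k, e ≠ 0 → dotp (latt k) (latt (perp e)) ≠ 0 → ∫ p, charT k p ∂σ e = 0)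
    (haway : ∀ e k, dotp (latt k) (latt e) ≠ 0 → dotp (latt k) (latt (perp e)) = 0 →
        ∫ p, charT k p ∂σ e = ∫ p, charT k p ∂ν) :
    ∃ c₀ : ℝ≥0∞, c₀ ≤ 1 ∧ ∃ νΛ : ℤ × ℤ → Measure T2,
      (∀ e, νΛ e = 0 ∨ Canonical e ∧ νΛ e = σ e) ∧
      ν = c₀ • (volume : Measure T2) + Measure.sum νΛ := by
  classical
  let νΛ : ℤ × ℤ → Measure T2 := fun e => if Canonical e then σ e else 0
  have hle : Measure.sum νΛ ≤ ν := by
    refine Measure.le_iff.2 fun S hS => ?_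
    rw [Measure.sum_apply _ hS, ENNReal.tsum_eq_iSup_sum]
    refine iSup_le fun F => ?_
    have h1 := hsum (F.filter Canonical) fun e he e' he' =>
      (Finset.mem_filter.1 he).2.wedge_ne_zero (Finset.mem_filter.1 he').2
    refine le_trans (le_of_eq ?_) (h1 S)
    rw [Measure.finsetSum_apply, Finset.sum_filter]
    refine Finset.sum_congr rfl fun e _ => ?_
    by_cases he : Canonical e <;> simp [νΛ, he]
  have hfin : IsFiniteMeasure (Measure.sum νΛ) := isFiniteMeasure_of_le ν hle
  have hκ : IsFiniteMeasure (ν - Measure.sum νΛ) := isFiniteMeasure_of_le ν Measure.sub_le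
  have hadd : ν - Measure.sum νΛ + Measure.sum νΛ = ν := Measure.sub_add_cancel_of_le hle
  have key : ∀ k : ℤ × ℤ, k ≠ 0 → ∫ p, charT k p ∂(ν - Measure.sum νΛ) = 0 := fun k hk => by
    obtain ⟨j, e, hj, he, rfl⟩ := exists_canonical hk
    have hi : ∀ (ξ : Measure T2) [IsFiniteMeasure ξ], Integrable (charT (j * e.1, j * e.2)) ξ :=
      fun ξ _ => integrable_of_continuous (charT _).continuous ξ
    have hj' : (j : ℝ) ≠ 0 := by exact_mod_cast hj
    have h1 : ∫ p, charT (j * e.1, j * e.2) p ∂Measure.sum νΛ =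
        ∫ p, charT (j * e.1, j * e.2) p ∂ν := by
      refine (hasSum_integral_measure (hi _)).unique ?_
      convert hasSum_single e fun e' he' => ?_ using 1
      · simp only [νΛ, if_pos he]
        refine (haway e _ ?_ ?_).symm
        · have h2 : dotp (latt (j * e.1, j * e.2)) (latt e) = j * sqn e := by
            simp [dotp, latt, sqn]; ring
          rw [h2]
          exact mul_ne_zero hj' (sqn_pos he.ne_zero).ne'
        · simp [dotp, latt, perp]; ring
      · by_cases hc : Canonical e'
        · simp only [νΛ, if_pos hc]
          refine hperp e' _ hc.ne_zero ?_
          have h2 : dotp (latt (j * e.1, j * e.2)) (latt (perp e')) =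
              j * wedge (latt e') (latt e) := by
            simp [dotp, latt, perp, wedge]; ring
          rw [h2]
          exact mul_ne_zero hj' (hc.wedge_ne_zero he he')
        · simp [νΛ, hc]
    rw [← hadd, integral_add_measure (hi _) (hi _)] at h1
    exact right_eq_add.1 h1
  refine ⟨(ν - Measure.sum νΛ) Set.univ, ?_, νΛ, fun e => ?_, ?_⟩
  · exact (Measure.sub_le _).trans prob_le_one
  · by_cases he : Canonical e
    · exact Or.inr ⟨he, if_pos he⟩
    · exact Or.inl (if_neg he)
  · rw [← eq_smul_volume key, hadd]

end Decomposition

/-- The magnetic data of the twisted operator `𝓛_α`. -/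
noncomputable def magDataOf {B : Pt → ℝ} (hBsm : ContDiff ℝ (⊤ : ℕ∞) B) (hBper : IsPeriodic B)
    {B0 : ℝ} (hflux : ∃ k : ℤ, B0 = 2 * π * k)
    {Aper : Pt → Pt} (hApersm : ContDiff ℝ (⊤ : ℕ∞) Aper) (hAperper : IsPeriodic Aper)
    {A : Pt → Pt} (hA : ∀ x, A x = A0 B0 x + Aper x)
    (hcurl : ∀ x, pdR1 (fun y => (A y).2) x - pdR2 (fun y => (A y).1) x = B x) (α : Pt) :
    MagData B0 where
  pot :=
    { a := fun x => α + A x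
      smooth := by
        rw [show A = fun x => A0 B0 x + Aper x from funext hA]
        refine contDiff_const.add (ContDiff.add ?_ hApersm)
        unfold A0
        fun_prop
      shift := fun m x => by
        simp only [hA, hAperper.add_latt]
        ext <;> simp [A0] <;> ring }
  B := ⟨fun x => (B x : ℂ), Complex.ofRealCLM.contDiff.comp hBsm, fun m x => by
    simp only [hBper m x]⟩
  curl := fun x => by
    have hd : DifferentiableAt ℝ A x := by
      rw [show A = fun x => A0 B0 x + Aper x from funext hA]
      refine DifferentiableAt.add ?_ (hApersm.differentiable (by simp) x)
      unfold A0
      fun_prop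
    change ((B x : ℝ) : ℂ) = _
    simp only [fderiv_const_add]
    rw [← hcurl x, pdR1, pdR2, hd.hasFDerivAt.snd.fderiv, hd.hasFDerivAt.fst.fderiv]
    rfl
  flux := hflux

/-- first item of Theorem A.1: if `B̂₀ > 0` and `B_∞ ≥ 0`, every
quantum limit decomposes as `c₀·Leb + Σ_Λ ν_Λ` where each `ν_Λ` is a finite measure
supported on the critical set `𝒵_Λ(B)` and invariant under translations in the
direction of `Λ^⊥`. -/
theorem statement19
    (B : Pt → ℝ) (hBsm : ContDiff ℝ (⊤ : ℕ∞) B) (hBper : IsPeriodic B)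
    (B0 : ℝ) (hB0 : B0 = ∫ x in fund, B x) (hflux : ∃ k : ℤ, B0 = 2 * π * k)
    (hB0pos : 0 < B0)
    (Aper : Pt → Pt) (hApersm : ContDiff ℝ (⊤ : ℕ∞) Aper) (hAperper : IsPeriodic Aper)
    (A : Pt → Pt) (hA : ∀ x, A x = A0 B0 x + Aper x)
    (hcurl : ∀ x, pdR1 (fun y => (A y).2) x - pdR2 (fun y => (A y).1) x = B x)
    (Binf : Pt → Pt → ℝ)
    (hBinf : ∀ x θ : Pt, Tendsto (fun T : ℝ => (1 / T) * ∫ t in (0:ℝ)..T, B (x + t • θ))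
      atTop (𝓝 (Binf x θ)))
    (hBinfnn : ∀ x θ : Pt, θ.1 ^ 2 + θ.2 ^ 2 = 1 → 0 ≤ Binf x θ)
    (α : Pt) (ν : Measure T2) (hν : IsQuantumLimit B0 α A ν) :
    ∃ c₀ : ℝ≥0∞, c₀ ≤ 1 ∧ ∃ νΛ : ℤ × ℤ → Measure T2,
      (∀ e : ℤ × ℤ, Int.gcd e.1 e.2 ≠ 1 → νΛ e = 0) ∧
      (∀ e : ℤ × ℤ, IsFiniteMeasure (νΛ e)) ∧
      (∀ e : ℤ × ℤ, Int.gcd e.1 e.2 = 1 → νΛ e (Zset Binf e)ᶜ = 0) ∧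
      (∀ e : ℤ × ℤ, Int.gcd e.1 e.2 = 1 → ∀ t : ℝ,
        Measure.map (fun p => p + proj2 (t • unitPerp e)) (νΛ e) = νΛ e) ∧
      ν = c₀ • (volume : Measure T2) + Measure.sum νΛ := by
  have : IsProbabilityMeasure ν := hν.1
  let M := magDataOf hBsm hBper hflux hApersm hAperper hA hcurl α
  have hMB : ∀ x, M.B x = (B x : ℂ) := fun _ => rfl
  obtain ⟨s, δ, v, r, hs, hδ, hv, hr, hq, hlim⟩ := exists_quasimodes M (fun _ => rfl) hν
  obtain ⟨σ, hσ, hsum, hperp, haway, hfield⟩ := M.exists_limit_parts hs hδ hv hr hq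
    (fun x => by rw [hMB, Complex.conj_ofReal]) ν fun f =>
      (hlim f f.continuous).congr fun n => (pairing_self f (v n)).symm
  obtain ⟨c₀, hc₀, νΛ, hνΛ, heq⟩ := exists_decomposition hsum hperp haway
  have hinv : ∀ (e : ℤ × ℤ) (t : ℝ), Measure.map (fun p => p + proj2 (t • unitPerp e)) (νΛ e) = νΛ e := by
    intro e t
    rcases hνΛ e with h | ⟨he, h⟩
    · rw [h, Measure.map_zero]
    · rw [h]
      exact map_translate_eq (fun k => hperp e k he.ne_zero) t
  refine ⟨c₀, hc₀, νΛ, fun e he => ?_, fun e => ?_, fun e _ => ?_, fun e _ => hinv e, heq⟩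
  · exact (hνΛ e).resolve_right fun h => he h.1.1
  · rcases hνΛ e with h | ⟨-, h⟩ <;> rw [h] <;> infer_instance
  · rcases hνΛ e with h | ⟨he, h⟩
    · rw [h, Measure.coe_zero, Pi.zero_apply]
    · obtain ⟨f, hf⟩ := exists_continuous_lift hBsm.continuous hBper
      have hinv' := hinv e
      rw [h] at hinv' ⊢
      refine measure_compl_Zset he.ne_zero hBinf hBinfnn hf hinv' ?_
      have h0 := hfield e he.ne_zero
        ⟨fun p => (f p : ℂ), Complex.continuous_ofReal.comp f.continuous⟩ fun x => by
          rw [hMB, ← hf]; rfl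
      simp only [ContinuousMap.coe_mk, integral_complex_ofReal] at h0
      exact_mod_cast h0
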